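/- Let φ : ℝ^n → [0,∞) be a C^1 radially symmetric, radially nonincreasing kernel with support equal to the closed ball of radius r₀ > 0, and let U : ℝ^n → ℝ be a C^1 radial confining potential (U(x) → ∞ as |x| → ∞). Let ℋ ⊆ ℝ^{nN} × ℝ^{nN} denote the set of initial data whose solutions of the confined Cucker–Smale system satisfy |x_i(t) − x_j(t)| ≥ r₀ for all i ≠ j and all t ≥ 0. Then for almost every initial datum (x₀, v₀) ∈ (ℝ^{nN} × ℝ^{nN}) \ ℋ (with respect to Lebesgue measure), the solution satisfies ∫_0^∞ Σ_{i≠j} φ(x_i(s) − x_j(s)) ds = ∞. In particular, this holds for almost every initial datum for which |x_i⁰ − x_j⁰| < r₀ for at least one pair i ≠ j. -/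

import Mathlib

open Set MeasureTheory Filter

namespace CS
open Topology

/-- Polynomial growth from polynomial derivative bound. -/
lemma growth {F : Type*} [NormedAddCommGroup F] [NormedSpace ℝ F] {f f' : ℝ → F} {T C : ℝ} (k : ℕ)
    (hf : ∀ t ∈ Icc 0 T, HasDerivWithinAt f (f' t) (Icc 0 T) t)
    (hb : ∀ t ∈ Icc 0 T, ‖f' t‖ ≤ C * t ^ k) :
    ∀ t ∈ Icc 0 T, ‖f t - f 0‖ ≤ C * t ^ (k + 1) / (k + 1) := by
  have := image_norm_le_of_norm_deriv_right_le_deriv_boundary (f := fun t => f t - f 0) (f' := f')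
    (a := 0) (b := T) (B := fun t => C * t ^ (k + 1) / (k + 1)) (B' := fun t => C * t ^ k)
    (fun t ht => ((hf t ht).continuousWithinAt.sub continuousWithinAt_const))
    (fun t ht => by
      exact ((hf t ⟨ht.1, ht.2.le⟩).sub_const (f 0)).mono_of_mem_nhdsWithin
        (mem_of_superset (Icc_mem_nhdsGE ht.2) (Icc_subset_Icc_left ht.1)))
    (by simp)
    (fun t => by
      have := ((hasDerivAt_pow (k + 1) t).const_mul C).div_const ((k : ℝ) + 1)
      refine this.congr_deriv ?_
      have : (k : ℝ) + 1 ≠ 0 := by positivity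
      rw [Nat.add_sub_cancel, Nat.cast_add, Nat.cast_one]
      field_simp)
    (fun t ht => hb t ⟨ht.1, ht.2.le⟩)
  intro t ht
  exact this ht

lemma scalar_aux {N0 ε K : ℝ} {η : ℝ} {d : ℝ → ℝ}
    (h0 : ∀ t ∈ Icc 0 η, |d t| ≤ N0 * t) (hN0 : 0 ≤ N0) (hεK : 0 ≤ ε * K)
    (hstep : ∀ N, 0 ≤ N → (∀ t ∈ Icc 0 η, |d t| ≤ N * t) →
      ∀ t ∈ Icc 0 η, |d t| ≤ (3 / 4 * N + ε * K / 4) * t) :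
    ∀ t ∈ Icc 0 η, |d t| ≤ ε * K * t := by
  have key : ∀ k : ℕ, ∀ t ∈ Icc 0 η, |d t| ≤ (ε * K + (3 / 4) ^ k * N0) * t := by
    intro k
    induction k with
    | zero =>
      intro t ht
      have := h0 t ht
      have := ht.1
      simp only [pow_zero, one_mul]
      nlinarith [mul_nonneg hεK ht.1]
    | succ k ih =>
      intro t ht
      have := hstep _ (by positivity) ih t ht
      refine this.trans (le_of_eq ?_)
      rw [pow_succ]; ring
  intro t ht
  have hlim : Tendsto (fun k : ℕ => (ε * K + (3 / 4 : ℝ) ^ k * N0) * t) atTop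
      (𝓝 ((ε * K + 0 * N0) * t)) :=
    ((tendsto_const_nhds.add ((tendsto_pow_atTop_nhds_zero_of_lt_one (by norm_num)
      (by norm_num)).mul_const _)).mul_const _)
  have := ge_of_tendsto' hlim (fun k => key k t ht)
  simpa using this

set_option maxHeartbeats 2000000 in
lemma scalar_lemma (G g : ℝ → ℝ) (s0 ρ0 F0 L T : ℝ) (hT : 0 < T) (hL : 0 ≤ L)
    (hG : ∀ᶠ s in 𝓝 s0, HasDerivAt G (g s) s) (hg : ContinuousAt g s0)
    (s1 s2 r1 r2 F1 F2 : ℝ → ℝ)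
    (hs1 : ∀ t ∈ Icc 0 T, HasDerivWithinAt s1 (r1 t) (Icc 0 T) t)
    (hs2 : ∀ t ∈ Icc 0 T, HasDerivWithinAt s2 (r2 t) (Icc 0 T) t)
    (hr1 : ∀ t ∈ Icc 0 T, HasDerivWithinAt r1 (-g (s1 t) + F1 t) (Icc 0 T) t)
    (hr2 : ∀ t ∈ Icc 0 T, HasDerivWithinAt r2 (-g (s2 t) + F2 t) (Icc 0 T) t)
    (hs10 : s1 0 = s0) (hs20 : s2 0 = s0) (hr10 : r1 0 = ρ0) (hr20 : r2 0 = ρ0)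
    (hF1 : ∀ t ∈ Icc 0 T, |F1 t - F0| ≤ L * t)
    (hF2 : ∀ t ∈ Icc 0 T, |F2 t - F0| ≤ L * t)
    (hreg : ρ0 ≠ 0 ∨ -g s0 + F0 ≠ 0) (ε : ℝ) (hε : 0 < ε) :
    ∀ᶠ η in 𝓝[>] (0 : ℝ), ∀ K, 0 ≤ K → (∀ t ∈ Icc 0 η, |F1 t - F2 t| ≤ K * t) →
      ∀ t ∈ Icc 0 η, |r1 t - r2 t| ≤ ε * K * t := by
  set a0 := -g s0 + F0 with ha0
  -- choose δ
  obtain ⟨δ, hδ, hδa⟩ : ∃ δ : ℝ, 0 < δ ∧ (ρ0 = 0 → δ = |a0| / 100) := by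
    by_cases h : ρ0 = 0
    · refine ⟨|a0| / 100, ?_, fun _ => rfl⟩
      have : a0 ≠ 0 := by tauto
      positivity
    · exact ⟨1, one_pos, fun h' => absurd h' h⟩
  -- neighborhood of s0
  obtain ⟨r, hr, hball⟩ : ∃ r > 0, ∀ s ∈ Metric.ball s0 r, HasDerivAt G (g s) s ∧
      |g s - g s0| ≤ δ / 2 := by
    have h2 : ∀ᶠ s in 𝓝 s0, |g s - g s0| ≤ δ / 2 := by
      have := hg.tendsto.sub_const (g s0)
      rw [sub_self] at this
      have := (this.abs).eventually (gt_mem_nhds (show |(0:ℝ)| < δ / 2 by simpa using hδ))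
      exact this.mono fun s hs => le_of_lt hs
    obtain ⟨r, hr, h⟩ := Metric.eventually_nhds_iff_ball.1 (hG.and h2)
    exact ⟨r, hr, h⟩
  -- times for which s_i in ball
  have hnear : ∀ s : ℝ → ℝ, ContinuousWithinAt s (Icc 0 T) 0 → s 0 = s0 →
      ∀ᶠ η in 𝓝[>] (0 : ℝ), ∀ t ∈ Icc 0 η, s t ∈ Metric.ball s0 r := by
    intro s hs h0
    have h1 : ∀ᶠ t in 𝓝[Icc 0 T] 0, s t ∈ Metric.ball s0 r :=
      hs.tendsto.eventually (by rw [h0]; exact Metric.ball_mem_nhds _ hr)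
    rw [nhdsWithin_Icc_eq_nhdsGE hT] at h1
    obtain ⟨u, hu, h2⟩ := mem_nhdsGE_iff_exists_Icc_subset.1 h1
    filter_upwards [Ioo_mem_nhdsGT hu] with η hη t ht
    exact h2 ⟨ht.1, ht.2.trans hη.2.le⟩
  have h0T : (0 : ℝ) ∈ Icc 0 T := ⟨le_rfl, hT.le⟩
  have hsmall : ∀ c : ℝ, 0 < c → ∀ᶠ η in 𝓝[>] (0 : ℝ), η < c := fun c hc =>
    mem_of_superset (Ioo_mem_nhdsGT hc) fun x hx => hx.2
  have hmul : ∀ A c : ℝ, 0 < c → ∀ᶠ η in 𝓝[>] (0 : ℝ), A * η < c := by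
    intro A c hc
    have : Tendsto (fun η : ℝ => A * η) (𝓝[>] 0) (𝓝 0) := by
      have : Tendsto (fun η : ℝ => A * η) (𝓝 0) (𝓝 (A * 0)) := by
        exact (continuous_const.mul continuous_id).tendsto 0
      rw [mul_zero] at this
      exact this.mono_left nhdsWithin_le_nhds
    exact this.eventually (gt_mem_nhds hc)
  filter_upwards [hnear s1 (hs1 0 h0T).continuousWithinAt hs10,
    hnear s2 (hs2 0 h0T).continuousWithinAt hs20, hsmall T hT, hsmall 1 one_pos,
    self_mem_nhdsWithin, hmul L (δ / 2) (half_pos hδ),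
    hsmall (ε / 4) (by positivity), hmul (10 * L) (100 * δ) (by positivity),
    hmul (|a0| + δ) (if ρ0 = 0 then 1 else |ρ0| / 2) (by split_ifs <;> positivity),
    hmul (2 * (|ρ0| + |a0| + δ)) (if ρ0 = 0 then 1 else |ρ0| * (ε / 4))
      (by split_ifs <;> positivity),
    hmul (2 * (L + |a0| + δ)) (if ρ0 = 0 then 1 else |ρ0| * (3 / 4))
      (by split_ifs <;> positivity)]
    with η hb1 hb2 hηT hη1 hη0 hLη hηε hLη2 hηρ hηρ2 hηρ3 K hK hFF
  have hη0 : 0 < η := hη0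
  have hsub : Icc 0 η ⊆ Icc 0 T := Icc_subset_Icc_right hηT.le
  -- r_i expansion
  have hexp : ∀ s r F : ℝ → ℝ, (∀ t ∈ Icc 0 T, HasDerivWithinAt r (-g (s t) + F t) (Icc 0 T) t) →
      r 0 = ρ0 → (∀ t ∈ Icc 0 T, |F t - F0| ≤ L * t) →
      (∀ t ∈ Icc 0 η, |g (s t) - g s0| ≤ δ / 2) →
      ∀ t ∈ Icc 0 η, |r t - ρ0 - a0 * t| ≤ δ * t := by
    intro s r F hr hr0 hF hgs t ht
    have := growth (f := fun t => r t - a0 * t) (f' := fun t => (-g (s t) + F t) - a0) (C := δ)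
      (T := η) 0
      (fun t ht => by
        exact (((hr t (hsub ht)).mono hsub).sub
          ((hasDerivWithinAt_id t _).const_mul a0)).congr_deriv (by simp))
      (fun t ht => by
        have h1 := hgs t ht
        have h2 := hF t (hsub ht)
        have h3 : L * t ≤ δ / 2 := le_trans (mul_le_mul_of_nonneg_left ht.2 hL) hLη.le
        rw [Real.norm_eq_abs, pow_zero, mul_one, ha0]
        rw [abs_le] at *
        constructor <;> linarith [h1.1, h1.2, h2.1, h2.2]) t ht
    simp only [mul_zero, sub_zero, hr0, Real.norm_eq_abs, zero_add, pow_one, Nat.cast_zero,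
      div_one] at this
    rw [show r t - ρ0 - a0 * t = r t - a0 * t - ρ0 by ring]
    exact this
  have he1 := hexp s1 r1 F1 hr1 hr10 hF1 (fun t ht => (hball _ (hb1 t ht)).2)
  have he2 := hexp s2 r2 F2 hr2 hr20 hF2 (fun t ht => (hball _ (hb2 t ht)).2)
  refine scalar_aux (N0 := 2 * δ) (fun t ht => ?_) (by positivity) (by positivity) ?_
  · have h1 := he1 t ht
    have h2 := he2 t ht
    rw [abs_le] at *
    constructor <;> linarith [h1.1, h1.2, h2.1, h2.2]
  intro N hN hrN t ht
  -- s1 - s2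
  have hsd : ∀ t ∈ Icc 0 η, |s1 t - s2 t| ≤ N * t ^ 2 / 2 := by
    intro t ht
    have := growth (f := fun t => s1 t - s2 t) (f' := fun t => r1 t - r2 t) (C := N)
      (T := η) 1
      (fun t ht => ((hs1 t (hsub ht)).mono hsub).sub ((hs2 t (hsub ht)).mono hsub))
      (fun t ht => by simpa using hrN t ht) t ht
    simp only [hs10, hs20, sub_self, sub_zero, Real.norm_eq_abs] at this
    norm_num at this
    exact this
  have hH : |(G (s1 t) - F0 * s1 t) - (G (s2 t) - F0 * s2 t)| ≤ (|a0| + δ) * (N * t ^ 2 / 2) := by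
    have := Convex.norm_image_sub_le_of_norm_hasDerivWithin_le (f := fun s => G s - F0 * s)
      (f' := fun s => g s - F0) (s := Metric.ball s0 r) (C := |a0| + δ) (x := s2 t) (y := s1 t)
      (fun s hs => by
        exact (((hball s hs).1.sub ((hasDerivAt_id s).const_mul F0)).congr_deriv
          (by simp)).hasDerivWithinAt)
      (fun s hs => by
        have h1 := (hball s hs).2
        have : g s - F0 = (g s - g s0) - a0 := by rw [ha0]; ring
        rw [this, Real.norm_eq_abs]
        refine (abs_sub _ _).trans ?_
        linarith)
      (convex_ball _ _) (hb2 t ht) (hb1 t ht)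
    rw [Real.norm_eq_abs, Real.norm_eq_abs] at this
    exact this.trans (mul_le_mul_of_nonneg_left (hsd t ht) (by positivity))
  -- the energy difference
  have hΔd : ∀ t ∈ Icc 0 η, HasDerivWithinAt
      (fun t => ((r1 t) ^ 2 - (r2 t) ^ 2) / 2 + ((G (s1 t) - F0 * s1 t) - (G (s2 t) - F0 * s2 t)))
      ((F1 t - F2 t) * r1 t + (F2 t - F0) * (r1 t - r2 t)) (Icc 0 η) t := by
    intro t ht
    have a1 := (hr1 t (hsub ht)).mono hsub
    have a2 := (hr2 t (hsub ht)).mono hsub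
    have b1 := (hs1 t (hsub ht)).mono hsub
    have b2 := (hs2 t (hsub ht)).mono hsub
    have c1 := (hball _ (hb1 t ht)).1.comp_hasDerivWithinAt t b1
    have c2 := (hball _ (hb2 t ht)).1.comp_hasDerivWithinAt t b2
    have := (((a1.pow 2).sub (a2.pow 2)).div_const 2).add
      ((c1.sub (b1.const_mul F0)).sub (c2.sub (b2.const_mul F0)))
    refine this.congr_deriv ?_
    simp only [Nat.cast_ofNat]
    ring
  have hΔ0 : ((r1 0) ^ 2 - (r2 0) ^ 2) / 2 + ((G (s1 0) - F0 * s1 0) - (G (s2 0) - F0 * s2 0)) = 0 := by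
    rw [hr10, hr20, hs10, hs20]; ring
  have ht0 := ht.1
  have htη := ht.2
  have hfac : |r1 t - r2 t| * |r1 t + r2 t| / 2 = |((r1 t) ^ 2 - (r2 t) ^ 2) / 2| := by
    rw [← abs_mul, abs_div, abs_two]; congr 2; ring
  rcases eq_or_lt_of_le ht0 with h00 | htpos
  · subst h00; simp [hr10, hr20]
  by_cases hρ : ρ0 = 0
  · -- turning
    have hδa := hδa hρ
    have ha0pos : 0 < |a0| := by linarith
    have hΔ := growth (C := 2 * |a0| * K + L * N) 2 hΔd (fun t ht => by
      have ht0 := ht.1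
      have h1 := hFF t ht
      have h2 := hF2 t (hsub ht)
      have h3 := hrN t ht
      have h4 : |r1 t| ≤ 2 * |a0| * t := by
        have := he1 t ht
        rw [hρ, sub_zero] at this
        have h5 : |r1 t| ≤ |r1 t - a0 * t| + |a0 * t| := by
          simpa using abs_add_le (r1 t - a0 * t) (a0 * t)
        rw [abs_mul a0 t, abs_of_nonneg ht0] at h5
        nlinarith
      rw [Real.norm_eq_abs]
      refine (abs_add_le _ _).trans ?_
      rw [abs_mul, abs_mul]
      have e1 : |F1 t - F2 t| * |r1 t| ≤ (K * t) * (2 * |a0| * t) :=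
        mul_le_mul h1 h4 (abs_nonneg _) (by positivity)
      have e2 : |F2 t - F0| * |r1 t - r2 t| ≤ (L * t) * (N * t) :=
        mul_le_mul h2 h3 (abs_nonneg _) (by positivity)
      nlinarith) t ht
    rw [hΔ0, sub_zero, Real.norm_eq_abs] at hΔ
    have hsum : 2 * (|a0| - δ) * t ≤ |r1 t + r2 t| := by
      have h1 := he1 t ht
      have h2 := he2 t ht
      rw [hρ, sub_zero] at h1 h2
      have h5 : |2 * a0 * t| ≤ |r1 t + r2 t| + |r1 t - a0 * t| + |r2 t - a0 * t| := by
        have := abs_sub (r1 t + r2 t) ((r1 t - a0 * t) + (r2 t - a0 * t))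
        have h6 := abs_add_le (r1 t - a0 * t) (r2 t - a0 * t)
        have h7 : r1 t + r2 t - (r1 t - a0 * t + (r2 t - a0 * t)) = 2 * a0 * t := by ring
        rw [h7] at this
        linarith
      rw [abs_mul, abs_mul, abs_two, abs_of_nonneg ht0] at h5
      linarith
    have hA : |((r1 t) ^ 2 - (r2 t) ^ 2) / 2| ≤
        (2 * |a0| * K + L * N) * t ^ 3 / 3 + (|a0| + δ) * (N * t ^ 2 / 2) := by
      have h6 := abs_sub (((r1 t) ^ 2 - (r2 t) ^ 2) / 2 +
        ((G (s1 t) - F0 * s1 t) - (G (s2 t) - F0 * s2 t)))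
        ((G (s1 t) - F0 * s1 t) - (G (s2 t) - F0 * s2 t))
      rw [add_sub_cancel_right] at h6
      norm_num at hΔ
      linarith
    rw [← hfac] at hA
    have hB : |r1 t - r2 t| * (2 * (|a0| - δ) * t) / 2 ≤
        (2 * |a0| * K + L * N) * t ^ 3 / 3 + (|a0| + δ) * (N * t ^ 2 / 2) := by
      refine le_trans ?_ hA
      gcongr
    have hδ' : δ = |a0| / 100 := hδa
    set x := |r1 t - r2 t| with hx
    rw [hδ'] at hB
    -- divide by t*|a0|
    have hLt : 10 * L * t ≤ |a0| := by
      have : 10 * L * t ≤ 10 * L * η := by gcongr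
      linarith
    have hC : |a0| * t * (x * (99 / 100)) ≤ |a0| * t * ((2 * K * t) * t / 3 + N * t / 30 + (101 / 100) * N * t / 2) := by
      have : L * N * t ^ 3 / 3 ≤ |a0| * t * (N * t / 30) := by
        have := mul_le_mul_of_nonneg_right hLt (show 0 ≤ N * t ^ 2 / 30 by positivity)
        nlinarith
      nlinarith
    have hD := le_of_mul_le_mul_left hC (by positivity)
    have hKt : K * t ≤ K * (ε / 4) := mul_le_mul_of_nonneg_left (by linarith) hK
    nlinarith [mul_nonneg hN ht0, mul_le_mul_of_nonneg_right hKt ht0]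
  · -- ρ0 ≠ 0
    simp only [hρ, if_false] at hηρ hηρ2 hηρ3
    have hρpos : 0 < |ρ0| := abs_pos.2 hρ
    have hΔ := growth (C := K * (|ρ0| + |a0| + δ) + L * N) 1 hΔd (fun t ht => by
      have ht0 := ht.1
      have ht1 : t ≤ 1 := ht.2.trans hη1.le
      have h1 := hFF t ht
      have h2 := hF2 t (hsub ht)
      have h3 := hrN t ht
      have h4 : |r1 t| ≤ |ρ0| + |a0| + δ := by
        have := he1 t ht
        have h5 : |r1 t| ≤ |r1 t - ρ0 - a0 * t| + |ρ0| + |a0 * t| := by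
          have h6 := abs_add_le (r1 t - ρ0 - a0 * t) (ρ0 + a0 * t)
          have h7 := abs_add_le ρ0 (a0 * t)
          have : r1 t - ρ0 - a0 * t + (ρ0 + a0 * t) = r1 t := by ring
          rw [this] at h6
          linarith
        rw [abs_mul a0 t, abs_of_nonneg ht0] at h5
        nlinarith [abs_nonneg a0]
      rw [Real.norm_eq_abs]
      refine (abs_add_le _ _).trans ?_
      rw [abs_mul, abs_mul]
      have e1 : |F1 t - F2 t| * |r1 t| ≤ (K * t) * (|ρ0| + |a0| + δ) :=
        mul_le_mul h1 h4 (abs_nonneg _) (by positivity)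
      have e2 : |F2 t - F0| * |r1 t - r2 t| ≤ (L * t) * (N * t) :=
        mul_le_mul h2 h3 (abs_nonneg _) (by positivity)
      have e3 : (L * t) * (N * t) ≤ (L * t) * N := by
        have : N * t ≤ N := by nlinarith
        gcongr
      nlinarith) t ht
    rw [hΔ0, sub_zero, Real.norm_eq_abs] at hΔ
    have hsum : |ρ0| ≤ |r1 t + r2 t| := by
      have h1 := he1 t ht
      have h2 := he2 t ht
      have h5 : |2 * ρ0| ≤ |r1 t + r2 t| + |r1 t - ρ0 - a0 * t| + |r2 t - ρ0 - a0 * t|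
          + 2 * |a0 * t| := by
        have e1 := abs_sub (r1 t + r2 t) ((r1 t - ρ0 - a0 * t) + (r2 t - ρ0 - a0 * t) + 2 * (a0 * t))
        have e2 := abs_add_le ((r1 t - ρ0 - a0 * t) + (r2 t - ρ0 - a0 * t)) (2 * (a0 * t))
        have e3 := abs_add_le (r1 t - ρ0 - a0 * t) (r2 t - ρ0 - a0 * t)
        have e4 : |2 * (a0 * t)| = 2 * |a0 * t| := by rw [abs_mul, abs_two]
        have h7 : r1 t + r2 t - ((r1 t - ρ0 - a0 * t) + (r2 t - ρ0 - a0 * t) + 2 * (a0 * t))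
          = 2 * ρ0 := by ring
        rw [h7] at e1
        linarith
      rw [abs_mul, abs_two, abs_mul, abs_of_nonneg ht0] at h5
      have : (|a0| + δ) * t ≤ (|a0| + δ) * η := by gcongr
      nlinarith
    have hA : |((r1 t) ^ 2 - (r2 t) ^ 2) / 2| ≤
        (K * (|ρ0| + |a0| + δ) + L * N) * t ^ 2 / 2 + (|a0| + δ) * (N * t ^ 2 / 2) := by
      have h6 := abs_sub (((r1 t) ^ 2 - (r2 t) ^ 2) / 2 +
        ((G (s1 t) - F0 * s1 t) - (G (s2 t) - F0 * s2 t)))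
        ((G (s1 t) - F0 * s1 t) - (G (s2 t) - F0 * s2 t))
      rw [add_sub_cancel_right] at h6
      norm_num at hΔ
      linarith
    rw [← hfac] at hA
    have hB : |r1 t - r2 t| * |ρ0| / 2 ≤
        (K * (|ρ0| + |a0| + δ) + L * N) * t ^ 2 / 2 + (|a0| + δ) * (N * t ^ 2 / 2) := by
      refine le_trans ?_ hA
      gcongr
    set x := |r1 t - r2 t| with hx
    have e1 : 2 * (|ρ0| + |a0| + δ) * t ≤ |ρ0| * (ε / 4) := by
      have : 2 * (|ρ0| + |a0| + δ) * t ≤ 2 * (|ρ0| + |a0| + δ) * η := by gcongr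
      linarith
    have e2 : 2 * (L + |a0| + δ) * t ≤ |ρ0| * (3 / 4) := by
      have : 2 * (L + |a0| + δ) * t ≤ 2 * (L + |a0| + δ) * η := by gcongr
      linarith
    have f1 := mul_le_mul_of_nonneg_right e1 (show 0 ≤ K * t by positivity)
    have f2 := mul_le_mul_of_nonneg_right e2 (show 0 ≤ N * t by positivity)
    have hp1 : 0 ≤ (|ρ0| + |a0| + δ) * (K * t ^ 2) := by positivity
    have hp2 : 0 ≤ (L + |a0| + δ) * (N * t ^ 2) := by positivity
    have hC : |ρ0| * x ≤ |ρ0| * ((3 / 4 * N + ε * K / 4) * t) := by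
      nlinarith
    exact le_of_mul_le_mul_left hC hρpos

end CS

namespace CS
open Topology

/-- Solutions on `[0,T]`. -/
def IsSol {Z : Type*} [NormedAddCommGroup Z] [NormedSpace ℝ Z] (F : Z → Z) (T : ℝ) (z : ℝ → Z) :
    Prop := ∀ t ∈ Icc 0 T, HasDerivWithinAt z (F (z t)) (Icc 0 T) t

section conv
set_option linter.unusedSectionVars false
variable {Z : Type*} [NormedAddCommGroup Z] [NormedSpace ℝ Z]

lemma poly_bound {Ψ : Z → Z} {h C : ℝ} (hh : 0 ≤ h) (hC : 0 ≤ C)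
    (hgrow : ∀ z, ‖Ψ z - z‖ ≤ h * (C * (1 + ‖z‖))) (d : Z) (k : ℕ) :
    1 + ‖Ψ^[k] d‖ ≤ (1 + ‖d‖) * Real.exp (C * (k * h)) := by
  induction k with
  | zero => simp
  | succ k ih =>
    rw [Function.iterate_succ_apply']
    have h1 := hgrow (Ψ^[k] d)
    have h2 : ‖Ψ (Ψ^[k] d)‖ ≤ ‖Ψ (Ψ^[k] d) - Ψ^[k] d‖ + ‖Ψ^[k] d‖ := by
      simpa using norm_add_le (Ψ (Ψ^[k] d) - Ψ^[k] d) (Ψ^[k] d)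
    have h3 : 1 + ‖Ψ (Ψ^[k] d)‖ ≤ (1 + ‖Ψ^[k] d‖) * (1 + C * h) := by linarith
    have h4 : 1 + C * h ≤ Real.exp (C * h) := by
      have := Real.add_one_le_exp (C * h); linarith
    calc _ ≤ _ := h3
      _ ≤ ((1 + ‖d‖) * Real.exp (C * (k * h))) * Real.exp (C * h) := by
        gcongr
      _ = _ := by
        rw [mul_assoc, ← Real.exp_add]; congr 2; push_cast; ring

lemma poly_norm {Ψ : Z → Z} {h C T : ℝ} (hh : 0 ≤ h) (hC : 0 ≤ C)
    (hgrow : ∀ z, ‖Ψ z - z‖ ≤ h * (C * (1 + ‖z‖))) (d : Z) (k : ℕ) (hk : k * h ≤ T) :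
    ‖Ψ^[k] d‖ ≤ (1 + ‖d‖) * Real.exp (C * T) := by
  have h1 := poly_bound hh hC hgrow d k
  have h2 : (1 + ‖d‖) * Real.exp (C * (k * h)) ≤ (1 + ‖d‖) * Real.exp (C * T) := by gcongr
  linarith

lemma poly_lip {Ψ : Z → Z} {h C T : ℝ} (hh : 0 ≤ h) (hC : 0 ≤ C)
    (hgrow : ∀ z, ‖Ψ z - z‖ ≤ h * (C * (1 + ‖z‖))) (d : Z) (k l : ℕ) (hkl : k ≤ l)
    (hl : l * h ≤ T) :
    ‖Ψ^[l] d - Ψ^[k] d‖ ≤ C * (1 + (1 + ‖d‖) * Real.exp (C * T)) * (((l : ℝ) - k) * h) := by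
  induction l, hkl using Nat.le_induction with
  | base => simp
  | succ l hkl ih =>
    have hl' : (l : ℝ) * h ≤ T := by
      push_cast at hl; linarith
    have h1 := ih hl'
    have h2 := hgrow (Ψ^[l] d)
    have h3 := poly_norm hh hC hgrow d l hl'
    rw [Function.iterate_succ_apply']
    have h4 : ‖Ψ (Ψ^[l] d) - Ψ^[k] d‖ ≤ ‖Ψ (Ψ^[l] d) - Ψ^[l] d‖ + ‖Ψ^[l] d - Ψ^[k] d‖ := by
      simpa using norm_add_le (Ψ (Ψ^[l] d) - Ψ^[l] d) (Ψ^[l] d - Ψ^[k] d)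
    have h5 : h * (C * (1 + ‖Ψ^[l] d‖)) ≤ h * (C * (1 + (1 + ‖d‖) * Real.exp (C * T))) := by
      gcongr
    push_cast
    linarith

lemma poly_inc {Ψ : Z → Z} {h η ε : ℝ} {F : Z → Z} (hh : 0 ≤ h) (d w : Z) (k l : ℕ) (hkl : k ≤ l)
    (h1 : ∀ j, k ≤ j → j < l → ‖F (Ψ^[j] d) - F w‖ ≤ η)
    (h2 : ∀ j, k ≤ j → j < l → ‖Ψ (Ψ^[j] d) - Ψ^[j] d - h • F (Ψ^[j] d)‖ ≤ ε * h) :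
    ‖Ψ^[l] d - Ψ^[k] d - (((l : ℝ) - k) * h) • F w‖ ≤ (η + ε) * (((l : ℝ) - k) * h) := by
  induction l, hkl using Nat.le_induction with
  | base => simp
  | succ l hkl ih =>
    have e1 := ih (fun j hj hj' => h1 j hj (by omega)) (fun j hj hj' => h2 j hj (by omega))
    have e2 := h1 l hkl (by omega)
    have e3 := h2 l hkl (by omega)
    rw [Function.iterate_succ_apply']
    have e4 : Ψ (Ψ^[l] d) - Ψ^[k] d - ((((l + 1 : ℕ) : ℝ) - k) * h) • F w =
        (Ψ (Ψ^[l] d) - Ψ^[l] d - h • F (Ψ^[l] d)) + (h • (F (Ψ^[l] d) - F w)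
         + (Ψ^[l] d - Ψ^[k] d - (((l : ℝ) - k) * h) • F w)) := by
      push_cast
      module
    rw [e4]
    refine (norm_add_le _ _).trans ?_
    have e5 := norm_add_le (h • (F (Ψ^[l] d) - F w)) (Ψ^[l] d - Ψ^[k] d - (((l : ℝ) - k) * h) • F w)
    rw [norm_smul, Real.norm_of_nonneg hh] at e5
    have e6 : h * ‖F (Ψ^[l] d) - F w‖ ≤ h * η := by gcongr
    push_cast
    linarith

lemma floor_bd {h t : ℝ} (hh : 0 < h) (ht : 0 ≤ t) :
    (⌊t / h⌋₊ : ℝ) * h ≤ t ∧ t - h ≤ (⌊t / h⌋₊ : ℝ) * h := by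
  have h1 := Nat.floor_le (div_nonneg ht hh.le)
  have h2 := Nat.lt_floor_add_one (t / h)
  rw [le_div_iff₀ hh] at h1
  rw [div_lt_iff₀ hh] at h2
  constructor <;> linarith

theorem conv [ProperSpace Z] (F : Z → Z) (hF : Continuous F) (Ψ : ℕ → Z → Z) (h : ℕ → ℝ)
    (hpos : ∀ m, 0 < h m) (hlim : Tendsto h atTop (𝓝 0)) (C : ℝ) (hC : 0 ≤ C)
    (hgrow : ∀ m z, ‖Ψ m z - z‖ ≤ h m * (C * (1 + ‖z‖)))
    (hcons : ∀ R ε : ℝ, 0 < ε → ∀ᶠ m in atTop, ∀ z, ‖z‖ ≤ R →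
      ‖Ψ m z - z - h m • F z‖ ≤ ε * h m)
    (T : ℝ) (d : Z) (x : ℝ → Z) (hx : IsSol F T x) 
    (huniq : ∀ y, IsSol F T y → y 0 = d → ∀ t ∈ Icc 0 T, y t = x t) (ε : ℝ) (hε : 0 < ε) :
    ∀ᶠ m in atTop, ∀ k : ℕ, k * h m ≤ T → ‖(Ψ m)^[k] d - x (k * h m)‖ ≤ ε := by
  by_contra hcon
  rw [not_eventually] at hcon
  have hne : NeBot (atTop ⊓ 𝓟 {m : ℕ | ¬ ∀ k : ℕ, k * h m ≤ T → ‖(Ψ m)^[k] d - x (k * h m)‖ ≤ ε}) :=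
    frequently_mem_iff_neBot.1 hcon
  set 𝒰 := Ultrafilter.of (atTop ⊓ 𝓟 {m : ℕ | ¬ ∀ k : ℕ, k * h m ≤ T →
    ‖(Ψ m)^[k] d - x (k * h m)‖ ≤ ε}) with h𝒰
  have hU1 : (𝒰 : Filter ℕ) ≤ atTop := (Ultrafilter.of_le _).trans inf_le_left
  have hU2 : ∀ᶠ m in (𝒰 : Filter ℕ), ∃ k : ℕ, k * h m ≤ T ∧ ε < ‖(Ψ m)^[k] d - x (k * h m)‖ := by
    have : {m : ℕ | ¬ ∀ k : ℕ, k * h m ≤ T → ‖(Ψ m)^[k] d - x (k * h m)‖ ≤ ε} ∈ (𝒰 : Filter ℕ) :=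
      ((Ultrafilter.of_le _).trans inf_le_right) (mem_principal_self _)
    filter_upwards [this] with m hm
    have hm' : ¬ ∀ k : ℕ, k * h m ≤ T → ‖(Ψ m)^[k] d - x (k * h m)‖ ≤ ε := hm
    push Not at hm'
    exact hm'
  have hlimU : Tendsto h 𝒰 (𝓝 0) := hlim.mono_left hU1
  have hT : 0 ≤ T := by
    obtain ⟨m, k, hk, -⟩ := hU2.exists
    exact le_trans (mul_nonneg (Nat.cast_nonneg _) (hpos m).le) hk
  set R := (1 + ‖d‖) * Real.exp (C * T) with hR
  set L := C * (1 + R) with hL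
  have hR0 : 0 ≤ R := by positivity
  have hL0 : 0 ≤ L := by positivity
  have hlip : ∀ m (k l : ℕ), k * h m ≤ T → l * h m ≤ T →
      ‖(Ψ m)^[k] d - (Ψ m)^[l] d‖ ≤ L * |k * h m - l * h m| := by
    intro m k l hk hl
    rcases le_total k l with hkl | hkl
    · have := poly_lip (hpos m).le hC (hgrow m) d k l hkl hl
      rw [norm_sub_rev]
      refine this.trans (mul_le_mul_of_nonneg_left ?_ hL0)
      rw [sub_mul, abs_sub_comm]
      exact le_abs_self _
    · have := poly_lip (hpos m).le hC (hgrow m) d l k hkl hk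
      refine this.trans (mul_le_mul_of_nonneg_left ?_ hL0)
      rw [sub_mul]
      exact le_abs_self _
  have hfl : ∀ t, 0 ≤ t → Tendsto (fun m => (⌊t / h m⌋₊ : ℝ) * h m) 𝒰 (𝓝 t) := by
    intro t ht
    refine tendsto_of_tendsto_of_tendsto_of_le_of_le (g := fun m => t - h m) (h := fun _ => t) ?_
      tendsto_const_nhds (fun m => (floor_bd (hpos m) ht).2) (fun m => (floor_bd (hpos m) ht).1)
    simpa using tendsto_const_nhds.sub hlimU
  have hflT : ∀ t ∈ Icc 0 T, ∀ m, (⌊t / h m⌋₊ : ℝ) * h m ≤ T := fun t ht m =>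
    (floor_bd (hpos m) ht.1).1.trans ht.2
  have hylim : ∀ t, ∃ y, t ∈ Icc 0 T → Tendsto (fun m => (Ψ m)^[⌊t / h m⌋₊] d) 𝒰 (𝓝 y) := by
    intro t
    by_cases ht : t ∈ Icc 0 T
    · have hc := isCompact_closedBall (0 : Z) R
      obtain ⟨y, -, hy⟩ := hc.ultrafilter_le_nhds (𝒰.map (fun m => (Ψ m)^[⌊t / h m⌋₊] d)) (by
        rw [le_principal_iff]
        refine Ultrafilter.mem_map.2 (univ_mem' fun m => ?_)
        simpa using poly_norm (hpos m).le hC (hgrow m) d _ (hflT t ht m))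
      exact ⟨y, fun _ => hy⟩
    · exact ⟨0, fun h => absurd h ht⟩
  choose y hy using hylim
  -- limits of general index sequences
  have hgen : ∀ t ∈ Icc 0 T, ∀ κ : ℕ → ℕ, (∀ᶠ m in (𝒰 : Filter ℕ), κ m * h m ≤ T) →
      Tendsto (fun m => (κ m : ℝ) * h m) 𝒰 (𝓝 t) →
      Tendsto (fun m => (Ψ m)^[κ m] d) 𝒰 (𝓝 (y t)) := by
    intro t ht κ hκ hκt
    have h1 : Tendsto (fun m => (Ψ m)^[κ m] d - (Ψ m)^[⌊t / h m⌋₊] d) 𝒰 (𝓝 0) := by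
      refine squeeze_zero_norm' (a := fun m => L * |κ m * h m - (⌊t / h m⌋₊ : ℝ) * h m|) ?_ ?_
      · filter_upwards [hκ] with m hm
        exact hlip m _ _ hm (hflT t ht m)
      · have := ((hκt.sub (hfl t ht.1)).abs).const_mul L
        simpa using this
    have := h1.add (hy t ht)
    simpa using this
  have hinc : ∀ a ∈ Icc 0 T, ∀ b ∈ Icc 0 T, a ≤ b → ∀ w η, (∀ᶠ m in (𝒰 : Filter ℕ), ∀ k,
      ⌊a / h m⌋₊ ≤ k → k < ⌊b / h m⌋₊ → ‖F ((Ψ m)^[k] d) - F w‖ ≤ η) →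
      ‖y b - y a - (b - a) • F w‖ ≤ η * (b - a) := by
    intro a ha b hb hab w η hη
    have key : ∀ ε' > 0, ‖y b - y a - (b - a) • F w‖ ≤ (η + ε') * (b - a) := by
      intro ε' hε'
      have l1 : Tendsto (fun m => ((⌊b / h m⌋₊ : ℝ) - ⌊a / h m⌋₊) * h m) 𝒰 (𝓝 (b - a)) := by
        have := (hfl b hb.1).sub (hfl a ha.1)
        simpa [sub_mul] using this
      have l2 := (((hy b hb).sub (hy a ha)).sub (l1.smul_const (F w))).norm
      refine le_of_tendsto_of_tendsto l2 (l1.const_mul (η + ε')) ?_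
      filter_upwards [hη, hU1 (hcons R ε' hε')] with m hm hm2
      refine poly_inc (hpos m).le d w _ _ ?_ hm ?_
      · exact Nat.floor_le_floor (div_le_div_of_nonneg_right hab (hpos m).le)
      · intro j hj hj'
        refine hm2 _ (poly_norm (hpos m).le hC (hgrow m) d j ?_)
        refine le_trans ?_ (hflT b hb m)
        have : (j : ℝ) ≤ ⌊b / h m⌋₊ := by exact_mod_cast hj'.le
        exact mul_le_mul_of_nonneg_right this (hpos m).le
    have : Tendsto (fun ε' : ℝ => (η + ε') * (b - a)) (𝓝[>] 0) (𝓝 ((η + 0) * (b - a))) :=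
      ((tendsto_const_nhds.add tendsto_id).mul_const _).mono_left nhdsWithin_le_nhds
    rw [add_zero] at this
    exact ge_of_tendsto this (by filter_upwards [self_mem_nhdsWithin] with e he using key e he)
  have hysol : IsSol F T y := by
    intro t ht
    rw [hasDerivWithinAt_iff_isLittleO, Asymptotics.isLittleO_iff]
    intro c hc
    obtain ⟨δ, hδ, hδF⟩ := Metric.continuousAt_iff.1 (hF.continuousAt (x := y t)) c hc
    have hδ' : 0 < δ / (2 * (L + 1)) := by positivity
    have hclose : ∀ b ∈ Icc 0 T, |b - t| < δ / (2 * (L + 1)) → ∀ᶠ m in (𝒰 : Filter ℕ), ∀ k : ℕ,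
        (min b t - h m ≤ k * h m) → (k * h m ≤ max b t) → ‖F ((Ψ m)^[k] d) - F (y t)‖ ≤ c := by
      intro b hb hbt
      have e1 : ∀ᶠ m in (𝒰 : Filter ℕ), ‖(Ψ m)^[⌊t / h m⌋₊] d - y t‖ < δ / 4 := by
        have := (hy t ht)
        rw [tendsto_iff_norm_sub_tendsto_zero] at this
        exact this.eventually (gt_mem_nhds (by positivity))
      have e2 : ∀ᶠ m in (𝒰 : Filter ℕ), L * (2 * h m) < δ / 4 := by
        have := (hlimU.const_mul 2).const_mul L
        simp only [mul_zero] at this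
        exact this.eventually (gt_mem_nhds (by positivity))
      filter_upwards [e1, e2] with m m1 m2 k hk1 hk2
      have hkT : k * h m ≤ T := hk2.trans (max_le hb.2 ht.2)
      have hf := floor_bd (hpos m) ht.1
      have e3 : |k * h m - (⌊t / h m⌋₊ : ℝ) * h m| ≤ |b - t| + 2 * h m := by
        have hp := hpos m
        rcases le_total b t with hbt' | hbt'
        · rw [min_eq_left hbt'] at hk1
          rw [max_eq_right hbt'] at hk2
          rw [abs_of_nonpos (by linarith : b - t ≤ 0), abs_le]
          constructor <;> linarith
        · rw [min_eq_right hbt'] at hk1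
          rw [max_eq_left hbt'] at hk2
          rw [abs_of_nonneg (by linarith : 0 ≤ b - t), abs_le]
          constructor <;> linarith
      have e4 := hlip m k _ hkT (hflT t ht m)
      have e5 : L * |k * h m - (⌊t / h m⌋₊ : ℝ) * h m| ≤ L * (|b - t| + 2 * h m) :=
        mul_le_mul_of_nonneg_left e3 hL0
      have e6 : L * |b - t| ≤ δ / 2 := by
        have : L * |b - t| ≤ (L + 1) * (δ / (2 * (L + 1))) := by gcongr; linarith
        refine this.trans (le_of_eq ?_)
        field_simp
      have e7 : ‖(Ψ m)^[k] d - y t‖ < δ := by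
        have := norm_add_le ((Ψ m)^[k] d - (Ψ m)^[⌊t / h m⌋₊] d) ((Ψ m)^[⌊t / h m⌋₊] d - y t)
        rw [sub_add_sub_cancel] at this
        linarith
      have := hδF (x := (Ψ m)^[k] d) (by rwa [dist_eq_norm])
      rw [dist_eq_norm] at this
      exact this.le
    have : ∀ᶠ b in 𝓝[Icc 0 T] t, |b - t| < δ / (2 * (L + 1)) := by
      refine mem_nhdsWithin_of_mem_nhds ?_
      have := Metric.ball_mem_nhds t hδ'
      simpa [Metric.ball, Real.dist_eq] using this
    filter_upwards [this, self_mem_nhdsWithin] with b hbt hb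
    have hcl := hclose b hb hbt
    rcases le_total b t with hbt' | hbt'
    · have := hinc b hb t ht hbt' (y t) c (by
        filter_upwards [hcl] with m hm k hk1 hk2
        refine hm k ?_ ?_
        · rw [min_eq_left hbt']
          refine (floor_bd (hpos m) hb.1).2.trans ?_
          exact mul_le_mul_of_nonneg_right (by exact_mod_cast hk1) (hpos m).le
        · rw [max_eq_right hbt']
          refine le_trans ?_ (floor_bd (hpos m) ht.1).1
          exact mul_le_mul_of_nonneg_right (by exact_mod_cast hk2.le) (hpos m).le)
      rw [Real.norm_eq_abs, abs_sub_comm, abs_of_nonneg (by linarith : 0 ≤ t - b)]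
      rw [← norm_neg]
      refine le_trans (le_of_eq ?_) this
      congr 1
      module
    · have := hinc t ht b hb hbt' (y t) c (by
        filter_upwards [hcl] with m hm k hk1 hk2
        refine hm k ?_ ?_
        · rw [min_eq_right hbt']
          refine (floor_bd (hpos m) ht.1).2.trans ?_
          exact mul_le_mul_of_nonneg_right (by exact_mod_cast hk1) (hpos m).le
        · rw [max_eq_left hbt']
          refine le_trans ?_ (floor_bd (hpos m) hb.1).1
          exact mul_le_mul_of_nonneg_right (by exact_mod_cast hk2.le) (hpos m).le)
      rw [Real.norm_eq_abs, abs_of_nonneg (by linarith : 0 ≤ b - t)]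
      exact this
  have hy0 : y 0 = d := by
    have h0 := hy 0 ⟨le_rfl, hT⟩
    simp only [zero_div, Nat.floor_zero, Function.iterate_zero, id] at h0
    exact tendsto_nhds_unique h0 tendsto_const_nhds
  have hyx := huniq y hysol hy0
  choose! κ hκ using fun m => (show (∃ k : ℕ, k * h m ≤ T ∧ ε < ‖(Ψ m)^[k] d - x (k * h m)‖) →
    ∃ k : ℕ, k * h m ≤ T ∧ ε < ‖(Ψ m)^[k] d - x (k * h m)‖ from id)
  have hκU : ∀ᶠ m in (𝒰 : Filter ℕ), (κ m : ℝ) * h m ≤ T ∧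
      ε < ‖(Ψ m)^[κ m] d - x (κ m * h m)‖ := hU2.mono fun m hm => hκ m hm
  obtain ⟨t, ht, htl⟩ := (isCompact_Icc (a := (0:ℝ)) (b := T)).ultrafilter_le_nhds
    (𝒰.map (fun m => (κ m : ℝ) * h m)) (by
      rw [le_principal_iff]
      refine Ultrafilter.mem_map.2 ?_
      filter_upwards [hκU] with m hm
      exact ⟨mul_nonneg (Nat.cast_nonneg _) (hpos m).le, hm.1⟩)
  have htl : Tendsto (fun m => (κ m : ℝ) * h m) 𝒰 (𝓝 t) := htl
  have g1 := hgen t ht κ (hκU.mono fun m hm => hm.1) htl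
  have g2 : Tendsto (fun m => x (κ m * h m)) 𝒰 (𝓝 (x t)) := by
    refine (hx t ht).continuousWithinAt.tendsto.comp (tendsto_nhdsWithin_iff.2 ⟨htl, ?_⟩)
    filter_upwards [hκU] with m hm
    exact ⟨mul_nonneg (Nat.cast_nonneg _) (hpos m).le, hm.1⟩
  have g3 := (g1.sub g2).norm
  rw [hyx t ht, sub_self, norm_zero] at g3
  have := ge_of_tendsto g3 (hκU.mono fun m hm => hm.2.le)
  linarith

end conv
end CS

namespace CS
open Topology

abbrev Eu (n : ℕ) := EuclideanSpace ℝ (Fin n)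
abbrev ZZ (n N : ℕ) := (Fin N → Eu n) × (Fin N → Eu n)

/-- The data of the (truncated) system. -/
structure Sys (n : ℕ) where
  φ : Eu n → ℝ
  U : Eu n → ℝ
  Lφ : NNReal
  φlip : LipschitzWith Lφ φ
  φnn : ∀ z, 0 ≤ φ z
  Bφ : ℝ
  φle : ∀ z, φ z ≤ Bφ
  UC1 : ContDiff ℝ 1 U
  Urad : ∃ u : ℝ → ℝ, ∀ z, U z = u ‖z‖
  Bg : ℝ
  gle : ∀ z, ‖gradient U z‖ ≤ Bg

namespace Sys
variable {n N : ℕ} (S : Sys n)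

noncomputable def fric (z : ZZ n N) (i : Fin N) : Eu n :=
  (N : ℝ)⁻¹ • ∑ j, S.φ (z.1 i - z.1 j) • (z.2 j - z.2 i)
noncomputable def acc (z : ZZ n N) : Fin N → Eu n := fun i => S.fric z i - gradient S.U (z.1 i)
noncomputable def fld (z : ZZ n N) : ZZ n N := (z.2, S.acc z)
noncomputable def Phi (z : ZZ n N) : ℝ := ∑ i, ∑ j ∈ Finset.univ.erase i, S.φ (z.1 i - z.1 j)
noncomputable def step (h : ℝ) (z : ZZ n N) : ZZ n N :=
  (z.1 + h • (z.2 + h • S.acc z), z.2 + h • S.acc z)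

lemma grad_cont : Continuous (gradient S.U) := by
  have h1 := S.UC1.continuous_fderiv (by norm_num)
  exact (InnerProductSpace.toDual ℝ (Eu n)).symm.continuous.comp h1

lemma φ_cont : Continuous S.φ := S.φlip.continuous

lemma fric_cont (i : Fin N) : Continuous (fun z : ZZ n N => S.fric z i) := by
  unfold fric
  have := S.φ_cont
  fun_prop

lemma acc_cont : Continuous (S.acc (N := N)) := by
  refine continuous_pi fun i => ?_
  have h1 := S.fric_cont i
  have h2 := S.grad_cont
  unfold acc
  fun_prop

lemma fld_cont : Continuous (S.fld (N := N)) := by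
  have := S.acc_cont (N := N)
  unfold fld
  fun_prop

lemma Phi_cont : Continuous (S.Phi (N := N)) := by
  unfold Phi
  have := S.φ_cont
  fun_prop

lemma step_cont (h : ℝ) : Continuous (S.step h (N := N)) := by
  have := S.acc_cont (N := N)
  unfold step
  fun_prop

lemma Phi_nonneg (z : ZZ n N) : 0 ≤ S.Phi z :=
  Finset.sum_nonneg fun _ _ => Finset.sum_nonneg fun _ _ => S.φnn _

lemma Bφ_nonneg : 0 ≤ S.Bφ := (S.φnn 0).trans (S.φle 0)
lemma Bg_nonneg : 0 ≤ S.Bg := (norm_nonneg _).trans (S.gle 0)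

/-- upper bound for `Phi` -/
noncomputable def pmax (N : ℕ) : ℝ := N * (N * S.Bφ)

lemma pmax_nonneg : 0 ≤ S.pmax N := by
  have := S.Bφ_nonneg
  unfold pmax; positivity

lemma Phi_le (z : ZZ n N) : S.Phi z ≤ S.pmax N := by
  unfold Phi pmax
  have : ∀ i ∈ (Finset.univ : Finset (Fin N)), ∑ j ∈ Finset.univ.erase i, S.φ (z.1 i - z.1 j)
      ≤ N * S.Bφ := by
    intro i _
    calc _ ≤ ∑ j : Fin N, S.φ (z.1 i - z.1 j) :=
          Finset.sum_le_sum_of_subset_of_nonneg (Finset.subset_univ _) (fun j _ _ => S.φnn _)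
      _ ≤ ∑ j : Fin N, S.Bφ := Finset.sum_le_sum fun j _ => S.φle _
      _ = _ := by simp
  calc _ ≤ ∑ i : Fin N, (N * S.Bφ) := Finset.sum_le_sum this
    _ = _ := by simp

lemma fric_le (z : ZZ n N) (i : Fin N) : ‖S.fric z i‖ ≤ 2 * S.Phi z * ‖z.2‖ := by
  have h1 : ‖∑ j, S.φ (z.1 i - z.1 j) • (z.2 j - z.2 i)‖ ≤ 2 * S.Phi z * ‖z.2‖ := by
    rw [← Finset.add_sum_erase _ _ (Finset.mem_univ i), sub_self (z.2 i), smul_zero, zero_add]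
    calc _ ≤ ∑ j ∈ Finset.univ.erase i, S.φ (z.1 i - z.1 j) * (2 * ‖z.2‖) := by
          refine norm_sum_le_of_le _ fun j _ => ?_
          rw [norm_smul, Real.norm_of_nonneg (S.φnn _)]
          refine mul_le_mul_of_nonneg_left ?_ (S.φnn _)
          have := norm_sub_le (z.2 j) (z.2 i)
          have := norm_le_pi_norm z.2 j
          have := norm_le_pi_norm z.2 i
          linarith
      _ = (∑ j ∈ Finset.univ.erase i, S.φ (z.1 i - z.1 j)) * (2 * ‖z.2‖) := by
          rw [Finset.sum_mul]
      _ ≤ S.Phi z * (2 * ‖z.2‖) := by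
          gcongr
          exact Finset.single_le_sum
            (f := fun i => ∑ j ∈ Finset.univ.erase i, S.φ (z.1 i - z.1 j))
            (fun i _ => Finset.sum_nonneg fun j _ => S.φnn _) (Finset.mem_univ i)
      _ = _ := by ring
  unfold fric
  rw [norm_smul]
  have h2 : ‖(N : ℝ)⁻¹‖ ≤ 1 := by
    rw [norm_inv, Real.norm_natCast]
    exact Nat.cast_inv_le_one N
  calc _ ≤ 1 * ‖∑ j, S.φ (z.1 i - z.1 j) • (z.2 j - z.2 i)‖ := by gcongr
    _ ≤ _ := by rw [one_mul]; exact h1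

noncomputable def Cacc (N : ℕ) : ℝ := 2 * S.pmax N + S.Bg

lemma Cacc_nonneg : 0 ≤ S.Cacc N := by
  have := S.pmax_nonneg (N := N); have := S.Bg_nonneg
  unfold Cacc; positivity

lemma acc_le (z : ZZ n N) : ‖S.acc z‖ ≤ S.Cacc N * (1 + ‖z‖) := by
  have hC := S.Cacc_nonneg (N := N)
  rw [pi_norm_le_iff_of_nonneg (by positivity)]
  intro i
  have h1 := S.fric_le z i
  have h2 := S.gle (z.1 i)
  have h3 : ‖z.2‖ ≤ ‖z‖ := norm_snd_le z
  have h4 := S.Phi_le z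
  have h0 := S.pmax_nonneg (N := N)
  have h5 := S.Bg_nonneg
  have h6 : 2 * S.Phi z * ‖z.2‖ ≤ 2 * S.pmax N * ‖z‖ := by
    gcongr
  have h7 := norm_sub_le (S.fric z i) (gradient S.U (z.1 i))
  unfold acc Cacc
  nlinarith [norm_nonneg z]

noncomputable def Cst (N : ℕ) : ℝ := 1 + S.Cacc N

lemma step_grow (z : ZZ n N) {h : ℝ} (h0 : 0 ≤ h) (h1 : h ≤ 1) :
    ‖S.step h z - z‖ ≤ h * (S.Cst N * (1 + ‖z‖)) := by
  have e : S.step h z - z = h • (z.2 + h • S.acc z, S.acc z) := by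
    ext1 <;> simp [step]
  rw [e, norm_smul, Real.norm_of_nonneg h0]
  refine mul_le_mul_of_nonneg_left ?_ h0
  have h2 := S.acc_le z
  have h3 : ‖z.2‖ ≤ ‖z‖ := norm_snd_le z
  rw [Prod.norm_def]
  unfold Cst
  refine max_le ?_ ?_
  · have := norm_add_le z.2 (h • S.acc z)
    rw [norm_smul, Real.norm_of_nonneg h0] at this
    have : h * ‖S.acc z‖ ≤ 1 * ‖S.acc z‖ := by gcongr
    simp only; linarith
  · simp only; linarith [norm_nonneg z]

lemma step_cons (z : ZZ n N) {h : ℝ} (h0 : 0 ≤ h) :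
    ‖S.step h z - z - h • S.fld z‖ ≤ h * (S.Cacc N * (1 + ‖z‖)) * h := by
  have e : S.step h z - z - h • S.fld z = (h * h) • ((S.acc z, 0) : ZZ n N) := by
    ext1
    · simp [step, fld, smul_smul]
    · simp [step, fld]
  rw [e, norm_smul, Real.norm_of_nonneg (by positivity), Prod.norm_def]
  simp only [norm_zero, norm_nonneg, max_eq_left]
  have := S.acc_le z
  nlinarith [mul_le_mul_of_nonneg_left this (mul_nonneg h0 h0)]

/-- friction as a linear map in `v`. -/
noncomputable def A (x : Fin N → Eu n) : (Fin N → Eu n) →ₗ[ℝ] (Fin N → Eu n) where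
  toFun v := fun i => S.fric (x, v) i
  map_add' v w := by
    ext1 i
    simp only [fric, Pi.add_apply]
    rw [← smul_add, ← Finset.sum_add_distrib]
    refine congrArg _ (Finset.sum_congr rfl fun j _ => ?_)
    module
  map_smul' c v := by
    ext1 i
    simp only [fric, Pi.smul_apply, RingHom.id_apply]
    rw [smul_comm c ((N : ℝ)⁻¹)]
    refine congrArg _ ?_
    rw [Finset.smul_sum]
    refine Finset.sum_congr rfl fun j _ => ?_
    module

lemma A_le (x v : Fin N → Eu n) : ‖S.A x v‖ ≤ 2 * S.Phi (x, v) * ‖v‖ := by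
  have := S.Phi_nonneg (x, v)
  rw [pi_norm_le_iff_of_nonneg (by positivity)]
  intro i
  exact S.fric_le (x, v) i

lemma Phi_indep (x v w : Fin N → Eu n) : S.Phi (x, v) = S.Phi (x, w) := rfl

lemma step_inj {h : ℝ} (h0 : 0 < h) (hs : 4 * (h * S.pmax N) ≤ 1) :
    Function.Injective (S.step h (N := N)) := by
  intro z z' e
  have e2 : z.2 + h • S.acc z = z'.2 + h • S.acc z' := congrArg Prod.snd e
  have e1 : z.1 + h • (z.2 + h • S.acc z) = z'.1 + h • (z'.2 + h • S.acc z') :=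
    congrArg Prod.fst e
  rw [e2] at e1
  have e1 := add_right_cancel e1
  obtain ⟨x, v⟩ := z
  obtain ⟨x', v'⟩ := z'
  simp only at e1 e2
  subst e1
  have e3 : (v - v') + h • S.A x (v - v') = 0 := by
    rw [map_sub]
    have a1 : S.acc (x, v) = S.A x v - fun i => gradient S.U (x i) := rfl
    have a2 : S.acc (x, v') = S.A x v' - fun i => gradient S.U (x i) := rfl
    rw [a1, a2, smul_sub, smul_sub] at e2
    rw [smul_sub]
    have := sub_eq_zero.2 e2
    rw [← this]
    abel
  have e4 : ‖v - v'‖ ≤ h * (2 * S.Phi (x, v - v') * ‖v - v'‖) := by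
    have : v - v' = -(h • S.A x (v - v')) := eq_neg_of_add_eq_zero_left e3
    calc ‖v - v'‖ = ‖h • S.A x (v - v')‖ := by rw [this, norm_neg, ← this]
      _ = h * ‖S.A x (v - v')‖ := by rw [norm_smul, Real.norm_of_nonneg h0.le]
      _ ≤ _ := by gcongr; exact S.A_le _ _
  have e5 := S.Phi_le (x, v - v')
  have e6 : h * S.Phi (x, v - v') ≤ h * S.pmax N := by gcongr
  have e7 : ‖v - v'‖ ≤ 0 := by nlinarith [norm_nonneg (v - v')]
  have e8 : v - v' = 0 := norm_le_zero_iff.1 e7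
  rw [sub_eq_zero.1 e8]

end Sys

open Module in
lemma det_lower {W : Type*} [NormedAddCommGroup W] [NormedSpace ℝ W] [FiniteDimensional ℝ W]
    [MeasurableSpace W] [BorelSpace W] (μ : Measure W) [μ.IsAddHaarMeasure]
    (f : W →ₗ[ℝ] W) (b : ℝ) (hb : b < 1) (hf : ∀ v, ‖f v‖ ≤ b * ‖v‖) (c : W)
    (G : W → ENNReal) (hG : Measurable G) :
    (∫⁻ v, G (v + f v + c) ∂μ) * ENNReal.ofReal ((1 - b) ^ (finrank ℝ W)) ≤ ∫⁻ v, G v ∂μ := by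
  set M : W →ₗ[ℝ] W := LinearMap.id + f with hM
  have hlow : ∀ v, (1 - b) * ‖v‖ ≤ ‖M v‖ := by
    intro v
    have h1 : ‖v‖ ≤ ‖M v‖ + ‖f v‖ := by
      have := norm_sub_le (M v) (f v)
      simpa [hM] using this
    have := hf v
    linarith
  have hinj : Function.Injective M := by
    rw [injective_iff_map_eq_zero]
    intro v hv
    have := hlow v
    rw [hv, norm_zero] at this
    have : ‖v‖ ≤ 0 := by nlinarith [norm_nonneg v]
    exact norm_le_zero_iff.1 this
  have hsurj : Function.Surjective M := LinearMap.surjective_of_injective hinj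
  have hdet : LinearMap.det M ≠ 0 := by
    have := (LinearMap.isUnit_iff_ker_eq_bot M).2 (LinearMap.ker_eq_bot.2 hinj)
    exact (this.map LinearMap.det).ne_zero
  have hball : ENNReal.ofReal ((1 - b) ^ (finrank ℝ W)) ≤ ENNReal.ofReal |LinearMap.det M| := by
    have h1 : Metric.ball (0 : W) (1 - b) ⊆ M '' Metric.ball 0 1 := by
      intro y hy
      obtain ⟨v, rfl⟩ := hsurj y
      refine ⟨v, ?_, rfl⟩
      have := hlow v
      rw [mem_ball_zero_iff] at hy ⊢
      nlinarith
    have h2 := measure_mono (μ := μ) h1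
    rw [Measure.addHaar_image_linearMap, Measure.addHaar_ball_of_pos μ 0 (by linarith : 0 < 1 - b)] at h2
    refine (ENNReal.mul_le_mul_iff_left ?_ ?_).1 h2
    · exact (Metric.measure_ball_pos μ 0 one_pos).ne'
    · exact measure_ball_lt_top.ne
  have h3 : ∫⁻ v, G (v + f v + c) ∂μ = ENNReal.ofReal |(LinearMap.det M)⁻¹| * ∫⁻ v, G v ∂μ := by
    have e1 : ∫⁻ v, G (v + f v + c) ∂μ = ∫⁻ w, G (w + c) ∂(Measure.map M μ) := by
      rw [lintegral_map (f := fun w => G (w + c)) (hG.comp (measurable_add_const c)) M.continuous_of_finiteDimensional.measurable]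
      rfl
    rw [e1, Measure.map_linearMap_addHaar_eq_smul_addHaar μ hdet, lintegral_smul_measure,
      lintegral_add_right_eq_self]
    rfl
  rw [h3]
  calc _ ≤ ENNReal.ofReal |(LinearMap.det M)⁻¹| * (∫⁻ v, G v ∂μ) * ENNReal.ofReal |LinearMap.det M| := by
        gcongr
    _ = (ENNReal.ofReal |(LinearMap.det M)⁻¹| * ENNReal.ofReal |LinearMap.det M|) * (∫⁻ v, G v ∂μ) := by
        ring
    _ = _ := by
      rw [← ENNReal.ofReal_mul (abs_nonneg _), ← abs_mul, inv_mul_cancel₀ hdet, abs_one,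
        ENNReal.ofReal_one, one_mul]

namespace Sys
variable {n N : ℕ} (S : Sys n)
open Module

noncomputable def w (h : ℝ) (z : ZZ n N) : ENNReal :=
  ENNReal.ofReal ((1 - 2 * (h * S.Phi z)) ^ (finrank ℝ (Fin N → Eu n)))

lemma w_meas (h : ℝ) : Measurable (S.w h (N := N)) := by
  have := (S.Phi_cont (N := N)).measurable
  unfold w
  fun_prop

lemma weight_one {h : ℝ} (h0 : 0 < h) (hs : 4 * (h * S.pmax N) ≤ 1) (G : ZZ n N → ENNReal)
    (hG : Measurable G) : ∫⁻ z, G (S.step h z) * S.w h z ≤ ∫⁻ z, G z := by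
  have hm1 : Measurable fun z => G (S.step h z) * S.w h z :=
    (hG.comp (S.step_cont h).measurable).mul (S.w_meas h)
  rw [Measure.volume_eq_prod, lintegral_prod _ hm1.aemeasurable]
  have hinner : ∀ x : Fin N → Eu n, ∫⁻ v, G (S.step h (x, v)) * S.w h (x, v) ≤
      ∫⁻ v, G (x + h • v, v) := by
    intro x
    have hw : ∀ v, S.w h (x, v) = S.w h (x, 0) := fun v => rfl
    simp only [hw]
    have hGx : Measurable fun v : Fin N → Eu n => G (x + h • v, v) := hG.comp (by fun_prop)
    have := det_lower (volume : Measure (Fin N → Eu n)) (h • S.A x) (2 * (h * S.Phi (x, 0)))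
      (by
        have h1 : h * S.Phi (x, (0 : Fin N → Eu n)) ≤ h * S.pmax N := by
          gcongr; exact S.Phi_le _
        linarith)
      (fun v => by
        have := S.A_le x v
        rw [LinearMap.smul_apply, norm_smul, Real.norm_of_nonneg h0.le]
        have h2 : h * ‖S.A x v‖ ≤ h * (2 * S.Phi (x, v) * ‖v‖) := by gcongr
        rw [S.Phi_indep x v 0] at h2
        linarith) (-(h • fun i => gradient S.U (x i))) _ hGx
    have hm2 : Measurable fun v : Fin N → Eu n => G (S.step h (x, v)) :=
      (hG.comp (S.step_cont h).measurable).comp (by fun_prop)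
    rw [lintegral_mul_const _ hm2]
    have e : ∀ v, S.step h (x, v) = (x + h • (v + (h • S.A x) v + -(h • fun i => gradient S.U (x i))),
        v + (h • S.A x) v + -(h • fun i => gradient S.U (x i))) := by
      intro v
      have a1 : S.acc (x, v) = S.A x v - fun i => gradient S.U (x i) := rfl
      have a2 : v + h • S.acc (x, v) =
          v + (h • S.A x) v + -(h • fun i => gradient S.U (x i)) := by
        rw [a1, smul_sub, LinearMap.smul_apply]; abel
      rw [← a2]; rfl
    simp only [e]
    exact this
  calc _ ≤ ∫⁻ x : Fin N → Eu n, ∫⁻ v : Fin N → Eu n, G (x + h • v, v) := lintegral_mono hinner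
    _ = ∫⁻ v : Fin N → Eu n, ∫⁻ x : Fin N → Eu n, G (x + h • v, v) := by
        rw [lintegral_lintegral_swap]
        exact (hG.comp (by fun_prop : Measurable
          fun p : (Fin N → Eu n) × (Fin N → Eu n) => (p.1 + h • p.2, p.2))).aemeasurable
    _ = ∫⁻ v : Fin N → Eu n, ∫⁻ x : Fin N → Eu n, G (x, v) := by
        refine lintegral_congr fun v => ?_
        exact lintegral_add_right_eq_self (fun x => G (x, v)) (h • v)
    _ = _ := by
        rw [lintegral_prod_symm _ hG.aemeasurable]

lemma weight_iter {h : ℝ} (h0 : 0 < h) (hs : 4 * (h * S.pmax N) ≤ 1) (G : ZZ n N → ENNReal)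
    (hG : Measurable G) (k : ℕ) :
    ∫⁻ z, G ((S.step h)^[k] z) * ∏ j ∈ Finset.range k, S.w h ((S.step h)^[j] z) ≤ ∫⁻ z, G z := by
  have hsm := (S.step_cont h (N := N)).measurable
  induction k with
  | zero => simp
  | succ k ih =>
    refine le_trans ?_ ih
    have hm : Measurable fun z : ZZ n N =>
        G ((S.step h)^[k] z) * ∏ j ∈ Finset.range k, S.w h ((S.step h)^[j] z) :=
      (hG.comp (hsm.iterate k)).mul
        (Finset.measurable_prod _ fun j _ => (S.w_meas h).comp (hsm.iterate j))
    refine le_trans (le_of_eq ?_) (S.weight_one h0 hs _ hm)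
    refine lintegral_congr fun z => ?_
    rw [Finset.prod_range_succ', ← mul_assoc]
    rfl

lemma w_lower {h : ℝ} (h0 : 0 < h) (hs : 4 * (h * S.pmax N) ≤ 1) (z : ZZ n N) :
    ENNReal.ofReal (Real.exp (-(4 * (finrank ℝ (Fin N → Eu n)) * (h * S.Phi z)))) ≤ S.w h z := by
  unfold w
  refine ENNReal.ofReal_le_ofReal ?_
  have h1 : h * S.Phi z ≤ h * S.pmax N := by gcongr; exact S.Phi_le _
  have h2 : 0 ≤ h * S.Phi z := mul_nonneg h0.le (S.Phi_nonneg z)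
  set a := h * S.Phi z
  have h3 : Real.exp (-(4 * a)) ≤ 1 - 2 * a := by
    rw [Real.exp_neg, inv_le_iff_one_le_mul₀ (Real.exp_pos _)]
    have := Real.add_one_le_exp (4 * a)
    nlinarith
  calc _ = Real.exp (-(4 * a)) ^ (finrank ℝ (Fin N → Eu n)) := by
        rw [← Real.exp_nat_mul]; congr 1; ring
    _ ≤ _ := by gcongr

/-- constant -/
noncomputable def Kd (n N : ℕ) : ℝ := 4 * (finrank ℝ (Fin N → Eu n))

lemma vol_le {h : ℝ} (h0 : 0 < h) (hs : 4 * (h * S.pmax N) ≤ 1) (k : ℕ) (c : ℝ)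
    (D B : Set (ZZ n N)) (hB : MeasurableSet B)
    (hD : ∀ z ∈ D, h * ∑ j ∈ Finset.range k, S.Phi ((S.step h)^[j] z) ≤ c)
    (hDB : ∀ z ∈ D, (S.step h)^[k] z ∈ B) :
    volume D ≤ ENNReal.ofReal (Real.exp (Kd n N * c)) * volume B := by
  have hsm := (S.step_cont h (N := N)).measurable
  set f : ZZ n N → ENNReal := fun z => B.indicator (fun _ => 1) ((S.step h)^[k] z) *
    ∏ j ∈ Finset.range k, S.w h ((S.step h)^[j] z) with hf
  have hG : Measurable (B.indicator (fun _ => (1 : ENNReal))) := measurable_const.indicator hB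
  have h1 := S.weight_iter h0 hs _ hG k
  rw [lintegral_indicator_const hB, one_mul] at h1
  have hfm : Measurable f := (hG.comp (hsm.iterate k)).mul
        (Finset.measurable_prod _ fun j _ => (S.w_meas h).comp (hsm.iterate j))
  have h2 : D ⊆ {z | ENNReal.ofReal (Real.exp (-(Kd n N * c))) ≤ f z} := by
    intro z hz
    change _ ≤ f z
    rw [hf]
    simp only
    rw [indicator_of_mem (hDB z hz), one_mul]
    calc _ ≤ ENNReal.ofReal (Real.exp (∑ j ∈ Finset.range k,
          -(Kd n N * (h * S.Phi ((S.step h)^[j] z))))) := by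
          refine ENNReal.ofReal_le_ofReal (Real.exp_le_exp.2 ?_)
          rw [Finset.sum_neg_distrib, neg_le_neg_iff, ← Finset.mul_sum, ← Finset.mul_sum]
          refine mul_le_mul_of_nonneg_left (hD z hz) ?_
          unfold Kd; positivity
      _ = ∏ j ∈ Finset.range k, ENNReal.ofReal (Real.exp (-(Kd n N * (h * S.Phi ((S.step h)^[j] z))))) := by
          rw [Real.exp_sum, ENNReal.ofReal_prod_of_nonneg fun _ _ => (Real.exp_pos _).le]
      _ ≤ _ := Finset.prod_le_prod' fun j _ => S.w_lower h0 hs _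
  have h3 := mul_meas_ge_le_lintegral (μ := volume) hfm (ENNReal.ofReal (Real.exp (-(Kd n N * c))))
  have h4 : ENNReal.ofReal (Real.exp (-(Kd n N * c))) * volume D ≤ volume B :=
    le_trans (mul_le_mul_right (measure_mono h2) _) (h3.trans h1)
  calc volume D = (ENNReal.ofReal (Real.exp (Kd n N * c)) * ENNReal.ofReal (Real.exp (-(Kd n N * c)))) * volume D := by
        rw [← ENNReal.ofReal_mul (Real.exp_pos _).le, ← Real.exp_add, add_neg_cancel, Real.exp_zero,
          ENNReal.ofReal_one, one_mul]
    _ = ENNReal.ofReal (Real.exp (Kd n N * c)) * (ENNReal.ofReal (Real.exp (-(Kd n N * c))) * volume D) := by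
        ring
    _ ≤ _ := by gcongr

end Sys
end CS

namespace CS
open Topology

section particle
variable {n : ℕ} {U : Eu n → ℝ}

lemma U_comp (hU : ContDiff ℝ 1 U) {x : ℝ → Eu n} {v : Eu n} {s : Set ℝ} {t : ℝ}
    (hx : HasDerivWithinAt x v s t) :
    HasDerivWithinAt (fun t => U (x t)) (inner ℝ (gradient U (x t)) v) s t := by
  have h1 : HasFDerivAt U _ (x t) :=
    ((hU.differentiable (by norm_num)) (x t)).hasGradientAt.hasFDerivAt
  have := h1.comp_hasDerivWithinAt t hx
  exact this

lemma U_compAt (hU : ContDiff ℝ 1 U) {x : ℝ → Eu n} {v : Eu n} {t : ℝ}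
    (hx : HasDerivAt x v t) :
    HasDerivAt (fun t => U (x t)) (inner ℝ (gradient U (x t)) v) t := by
  have h1 : HasFDerivAt U _ (x t) :=
    ((hU.differentiable (by norm_num)) (x t)).hasGradientAt.hasFDerivAt
  have := h1.comp_hasDerivAt t hx
  exact this

lemma grad_perp (hU : ContDiff ℝ 1 U) (hrad : ∃ u : ℝ → ℝ, ∀ z, U z = u ‖z‖) (x y : Eu n)
    (hxy : inner ℝ x y = 0) : inner ℝ (gradient U x) y = 0 := by
  obtain ⟨u, hu⟩ := hrad
  have h1 : HasDerivAt (fun t : ℝ => x + t • y) y 0 := by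
    have := ((hasDerivAt_id (0:ℝ)).smul_const y).const_add x
    simpa using this
  have h2 : HasDerivAt (fun t : ℝ => x - t • y) (-y) 0 := by
    have := ((hasDerivAt_id (0:ℝ)).smul_const y).const_sub x
    simpa using this
  have h3 := U_compAt hU h1
  have h4 := U_compAt hU h2
  have heq : (fun t : ℝ => U (x + t • y)) = fun t => U (x - t • y) := by
    funext t
    rw [hu, hu]
    congr 1
    rw [← sq_eq_sq₀ (norm_nonneg _) (norm_nonneg _), norm_add_sq_real, norm_sub_sq_real,
      inner_smul_right, hxy]
    ring
  rw [heq] at h3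
  have := h3.unique h4
  simp only [zero_smul, add_zero, sub_zero, inner_neg_right] at this
  linarith

lemma grad_tang (hU : ContDiff ℝ 1 U) (hrad : ∃ u : ℝ → ℝ, ∀ z, U z = u ‖z‖) (x x0 : Eu n) :
    inner ℝ x x0 • gradient U x = inner ℝ (gradient U x) x0 • x := by
  by_cases hx : x = 0
  · subst hx; simp
  have hx2 : ‖x‖ ^ 2 ≠ 0 := by
    have := norm_pos_iff.2 hx; positivity
  set c := inner ℝ x (gradient U x) / ‖x‖ ^ 2 with hc
  set y := gradient U x - c • x with hy
  have hxy : inner ℝ x y = 0 := by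
    rw [hy, inner_sub_right, inner_smul_right, real_inner_self_eq_norm_sq, hc]
    field_simp; ring
  have h1 := grad_perp hU hrad x y hxy
  have h2 : inner ℝ y y = 0 := by
    conv_lhs => rw [hy]
    rw [inner_sub_left, inner_smul_left, ← hy, h1, hxy]; simp
  have h3 : y = 0 := inner_self_eq_zero.1 h2
  have h4 : gradient U x = c • x := by rw [← sub_eq_zero]; exact h3
  rw [h4, inner_smul_left, smul_smul]
  congr 1
  simp [mul_comm]

lemma grad_radial (hU : ContDiff ℝ 1 U) (hrad : ∃ u : ℝ → ℝ, ∀ z, U z = u ‖z‖) (x e : Eu n)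
    (he : ‖e‖ = 1) :
    inner ℝ x (gradient U x) = ‖x‖ * inner ℝ (gradient U (‖x‖ • e)) e := by
  obtain ⟨u, hu⟩ := hrad
  have h1 : HasDerivAt (fun t : ℝ => t • x) x 1 := by
    have := (hasDerivAt_id (1:ℝ)).smul_const x
    simpa using this
  have h2 : HasDerivAt (fun t : ℝ => t • (‖x‖ • e)) (‖x‖ • e) 1 := by
    have := (hasDerivAt_id (1:ℝ)).smul_const (‖x‖ • e)
    simpa using this
  have h3 := U_compAt hU h1
  have h4 := U_compAt hU h2
  have heq : (fun t : ℝ => U (t • x)) = fun t => U (t • (‖x‖ • e)) := by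
    funext t
    rw [hu, hu]
    congr 1
    simp [norm_smul, he]
  rw [heq] at h3
  have := h3.unique h4
  simp only [one_smul, inner_smul_right] at this
  rw [real_inner_comm]
  exact this

lemma grad_cont' (hU : ContDiff ℝ 1 U) : Continuous (gradient U) := by
  have h1 := hU.continuous_fderiv (by norm_num)
  exact (InnerProductSpace.toDual ℝ (Eu n)).symm.continuous.comp h1

/-- Data for a pair of one-particle trajectories. -/
structure Pair (U : Eu n → ℝ) (T L R : ℝ) (x0 v0 f0 : Eu n) (x v f : ℝ → Eu n) : Prop where
  hx : ∀ t ∈ Icc 0 T, HasDerivWithinAt x (v t) (Icc 0 T) t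
  hv : ∀ t ∈ Icc 0 T, HasDerivWithinAt v (f t - gradient U (x t)) (Icc 0 T) t
  x00 : x 0 = x0
  v00 : v 0 = v0
  fL : ∀ t ∈ Icc 0 T, ‖f t - f0‖ ≤ L * t
  xR : ∀ t ∈ Icc 0 T, ‖x t‖ ≤ R
  vR : ∀ t ∈ Icc 0 T, ‖v t‖ ≤ R
  fR : ∀ t ∈ Icc 0 T, ‖f t‖ ≤ R

lemma hsmall (c : ℝ) (hc : 0 < c) : ∀ᶠ η in 𝓝[>] (0 : ℝ), η < c :=
    mem_of_superset (Ioo_mem_nhdsGT hc) fun _ hx => hx.2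

/-- one dimensional case -/
lemma pair_one {U : Eu 1 → ℝ} (hU : ContDiff ℝ 1 U) {T L R : ℝ} (hT : 0 < T) (hL : 0 ≤ L)
    {x0 v0 f0 : Eu 1} {x v f y w e : ℝ → Eu 1}
    (h1 : Pair U T L R x0 v0 f0 x v f) (h2 : Pair U T L R x0 v0 f0 y w e)
    (hreg : v0 ≠ 0 ∨ f0 - gradient U x0 ≠ 0) (c : ℝ) (hc : 0 < c) :
    ∀ᶠ η in 𝓝[>] (0 : ℝ), ∀ K, 0 ≤ K →
      (∀ t ∈ Icc 0 η, ‖f t - e t‖ ≤ K * t) → (∀ t ∈ Icc 0 η, ‖v t - w t‖ ≤ K * t) →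
      ∀ t ∈ Icc 0 η, ‖v t - w t‖ ≤ c * K * t := by
  set b : Eu 1 := EuclideanSpace.single 0 1 with hb
  have hnorm : ∀ z : Eu 1, ‖z‖ = |z 0| := fun z => by
    rw [EuclideanSpace.norm_eq]; simp [Real.sqrt_sq_eq_abs]
  have hz : ∀ z : Eu 1, z = z 0 • b := fun z => by
    ext i; fin_cases i; simp [hb]
  have hcoord : ∀ (z : ℝ → Eu 1) z' s t, HasDerivWithinAt z z' s t →
      HasDerivWithinAt (fun t => z t 0) (z' 0) s t := by
    intro z z' s t h
    exact ((EuclideanSpace.proj (𝕜 := ℝ) (0 : Fin 1)).hasFDerivAt.comp_hasDerivWithinAt t h)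
  have hGd : ∀ s : ℝ, HasDerivAt (fun s : ℝ => U (s • b)) ((gradient U (s • b)) 0) s := by
    intro s
    have := U_compAt hU (((hasDerivAt_id s).smul_const b))
    refine this.congr_deriv ?_
    simp only [id, one_smul]
    generalize gradient U (s • b) = q
    rw [hb, EuclideanSpace.inner_single_right]
    simp
  have hgc : Continuous fun s : ℝ => (gradient U (s • b)) 0 := by
    have := grad_cont' hU
    have h3 : Continuous fun s : ℝ => gradient U (s • b) := by fun_prop
    exact (EuclideanSpace.proj (𝕜 := ℝ) (0 : Fin 1)).continuous.comp h3
  have := scalar_lemma (fun s => U (s • b)) (fun s => (gradient U (s • b)) 0) (x0 0) (v0 0) (f0 0)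
    L T hT hL (Eventually.of_forall hGd) hgc.continuousAt (fun t => x t 0) (fun t => y t 0)
    (fun t => v t 0) (fun t => w t 0) (fun t => f t 0) (fun t => e t 0)
    (fun t ht => hcoord _ _ _ _ (h1.hx t ht)) (fun t ht => hcoord _ _ _ _ (h2.hx t ht))
    (fun t ht => (hcoord _ _ _ _ (h1.hv t ht)).congr_deriv (by
      rw [← hz (x t)]; simp; ring))
    (fun t ht => (hcoord _ _ _ _ (h2.hv t ht)).congr_deriv (by
      rw [← hz (y t)]; simp; ring))
    (by simp [h1.x00]) (by simp [h2.x00]) (by simp [h1.v00]) (by simp [h2.v00])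
    (fun t ht => by have := h1.fL t ht; rw [hnorm] at this; simpa using this)
    (fun t ht => by have := h2.fL t ht; rw [hnorm] at this; simpa using this)
    (by
      rw [← hz x0]
      rcases hreg with h | h
      · left; intro h'; apply h; rw [hz v0, h', zero_smul]
      · right; intro h'; apply h; rw [hz (f0 - gradient U x0)]
        have : (f0 - gradient U x0) 0 = 0 := by simp; linarith
        rw [this, zero_smul]) c hc
  filter_upwards [this] with η hη K hK hfe _ t ht
  have := hη K hK (fun t ht => by have := hfe t ht; rw [hnorm] at this; simpa using this) t ht
  rw [hnorm]; simpa using this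

lemma inner_abs_le {a b : Eu n} {A B : ℝ} (ha : ‖a‖ ≤ A) (hb : ‖b‖ ≤ B) :
    |inner ℝ a b| ≤ A * B :=
  (abs_real_inner_le_norm a b).trans (mul_le_mul ha hb (norm_nonneg _) ((norm_nonneg _).trans ha))

lemma recover {x x0 a q : Eu n} {R κ : ℝ} (hκ : 0 < κ) (hR : 1 ≤ R) (hxR : ‖x‖ ≤ R)
    (hx0 : ‖x0‖ ≤ R) (h1 : κ ≤ inner ℝ x x0) (h2 : κ ≤ ‖x‖ ^ 2)
    (hq : inner ℝ x x0 • a - inner ℝ a x0 • x = q) :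
    κ ^ 2 * ‖a‖ ≤ 2 * R ^ 2 * ‖q‖ + R ^ 3 * |inner ℝ a x| := by
  have e1 : inner ℝ x x0 * inner ℝ a x - inner ℝ a x0 * ‖x‖ ^ 2 = inner ℝ q x := by
    rw [← hq, inner_sub_left, inner_smul_left, inner_smul_left, real_inner_self_eq_norm_sq]
    simp
  have e2 : (‖x‖ ^ 2 * inner ℝ x x0) • a =
      ‖x‖ ^ 2 • q + (inner ℝ x x0 * inner ℝ a x - inner ℝ q x) • x := by
    rw [← e1, ← hq]; module
  have e3 := congrArg norm e2
  rw [norm_smul, Real.norm_eq_abs] at e3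
  have e4 : κ ^ 2 ≤ |‖x‖ ^ 2 * inner ℝ x x0| := by
    refine le_trans ?_ (le_abs_self _)
    rw [sq]; exact mul_le_mul h2 h1 hκ.le (by positivity)
  have e5 : κ ^ 2 * ‖a‖ ≤ ‖‖x‖ ^ 2 • q + (inner ℝ x x0 * inner ℝ a x - inner ℝ q x) • x‖ := by
    rw [← e3]; gcongr
  refine e5.trans ((norm_add_le _ _).trans ?_)
  rw [norm_smul, norm_smul, Real.norm_eq_abs, Real.norm_eq_abs, abs_of_nonneg (sq_nonneg ‖x‖)]
  have e6 : ‖x‖ ^ 2 ≤ R ^ 2 := by gcongr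
  have e7 : |inner ℝ x x0 * inner ℝ a x - inner ℝ q x| ≤ R * R * |inner ℝ a x| + ‖q‖ * R := by
    refine (abs_sub _ _).trans ?_
    rw [abs_mul]
    refine add_le_add ?_ ?_
    · exact mul_le_mul_of_nonneg_right (inner_abs_le hxR hx0) (abs_nonneg _)
    · exact inner_abs_le le_rfl hxR
  have e8 : |inner ℝ x x0 * inner ℝ a x - inner ℝ q x| * ‖x‖ ≤ (R * R * |inner ℝ a x| + ‖q‖ * R) * R :=
    mul_le_mul e7 hxR (norm_nonneg _) (by positivity)
  have e9 : ‖x‖ ^ 2 * ‖q‖ ≤ R ^ 2 * ‖q‖ := by gcongr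
  nlinarith

end particle
end CS

namespace CS
open Topology

section particle2
variable {n : ℕ} {U : Eu n → ℝ}

lemma norm_isl {a b c : Eu n} {A B C : ℝ} (ha : ‖a‖ ≤ A) (hb : ‖b‖ ≤ B) (hc : ‖c‖ ≤ C) :
    ‖inner ℝ a b • c‖ ≤ A * B * C := by
  rw [norm_smul, Real.norm_eq_abs]
  have := inner_abs_le ha hb
  exact mul_le_mul this hc (norm_nonneg _) ((abs_nonneg _).trans this)

lemma Pair.energy (hU : ContDiff ℝ 1 U) {T L R : ℝ} {x0 v0 f0 : Eu n} {x v f : ℝ → Eu n}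
    (h : Pair U T L R x0 v0 f0 x v f) : ∀ t ∈ Icc 0 T,
    HasDerivWithinAt (fun t => ‖v t‖ ^ 2 / 2 + U (x t)) (inner ℝ (v t) (f t)) (Icc 0 T) t := by
  intro t ht
  have h1 := ((h.hv t ht).norm_sq.div_const 2).add (U_comp hU (h.hx t ht))
  refine h1.congr_deriv ?_
  rw [inner_sub_right, real_inner_comm (v t) (gradient U (x t))]
  ring

lemma Pair.mono {T L R : ℝ} {x0 v0 f0 : Eu n} {x v f : ℝ → Eu n}
    (h : Pair U T L R x0 v0 f0 x v f) {T' : ℝ} (hT' : T' ≤ T) : Pair U T' L R x0 v0 f0 x v f := by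
  have hsub : Icc 0 T' ⊆ Icc 0 T := Icc_subset_Icc_right hT'
  exact ⟨fun t ht => (h.hx t (hsub ht)).mono hsub, fun t ht => (h.hv t (hsub ht)).mono hsub,
    h.x00, h.v00, fun t ht => h.fL t (hsub ht), fun t ht => h.xR t (hsub ht),
    fun t ht => h.vR t (hsub ht), fun t ht => h.fR t (hsub ht)⟩

lemma Pair.x_sub {T L R : ℝ} {x0 v0 f0 : Eu n} {x v f : ℝ → Eu n}
    (h : Pair U T L R x0 v0 f0 x v f) : ∀ t ∈ Icc 0 T, ‖x t - x0‖ ≤ R * t := by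
  intro t ht
  have := growth (C := R) 0 h.hx (fun t ht => by simpa using h.vR t ht) t ht
  simpa [h.x00] using this

lemma Pair.f00 {T L R : ℝ} (hT : 0 ≤ T) {x0 v0 f0 : Eu n} {x v f : ℝ → Eu n}
    (h : Pair U T L R x0 v0 f0 x v f) : f 0 = f0 := by
  have := h.fL 0 ⟨le_rfl, hT⟩
  rw [mul_zero] at this
  exact sub_eq_zero.1 (norm_le_zero_iff.1 this)

lemma Pair.rho (hU : ContDiff ℝ 1 U) (hrad : ∃ u : ℝ → ℝ, ∀ z, U z = u ‖z‖)
    {T L R : ℝ} {x0 v0 f0 b : Eu n} (hb : ‖b‖ = 1) {x v f : ℝ → Eu n}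
    (h : Pair U T L R x0 v0 f0 x v f) : ∀ t ∈ Icc 0 T,
    HasDerivWithinAt (fun t => inner ℝ (x t) (v t))
      (-(2 * U (√(2 * (‖x t‖ ^ 2 / 2)) • b) + √(2 * (‖x t‖ ^ 2 / 2)) *
        inner ℝ (gradient U (√(2 * (‖x t‖ ^ 2 / 2)) • b)) b) +
        (2 * (‖v t‖ ^ 2 / 2 + U (x t)) + inner ℝ (x t) (f t))) (Icc 0 T) t := by
  intro t ht
  refine ((h.hx t ht).inner ℝ (h.hv t ht)).congr_deriv ?_
  rw [mul_div_cancel₀ _ (two_ne_zero), Real.sqrt_sq (norm_nonneg _), ← grad_radial hU hrad _ b hb]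
  obtain ⟨u, hu⟩ := hrad
  have : U (‖x t‖ • b) = U (x t) := by
    rw [hu, hu, norm_smul, hb]; simp
  rw [this, inner_sub_right, real_inner_self_eq_norm_sq]
  ring

lemma Pair.tang (hU : ContDiff ℝ 1 U) (hrad : ∃ u : ℝ → ℝ, ∀ z, U z = u ‖z‖)
    {T L R : ℝ} {x0 v0 f0 : Eu n} {x v f : ℝ → Eu n}
    (h : Pair U T L R x0 v0 f0 x v f) : ∀ t ∈ Icc 0 T,
    HasDerivWithinAt (fun t => inner ℝ (x t) x0 • v t - inner ℝ (v t) x0 • x t)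
      (inner ℝ (x t) x0 • f t - inner ℝ (f t) x0 • x t) (Icc 0 T) t := by
  intro t ht
  have hc : HasDerivWithinAt (fun _ : ℝ => x0) 0 (Icc 0 T) t := hasDerivWithinAt_const _ _ _
  have h1 := (((h.hx t ht).inner ℝ hc).smul (h.hv t ht)).sub
    (((h.hv t ht).inner ℝ hc).smul (h.hx t ht))
  refine h1.congr_deriv ?_
  have := grad_tang hU hrad (x t) x0
  simp only [inner_zero_right, zero_add, smul_sub, inner_sub_left, sub_smul, this]
  abel

lemma G_deriv (hU : ContDiff ℝ 1 U) (b : Eu n) {s : ℝ} (hs : 0 < s) :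
    HasDerivAt (fun s => 2 * s * U (√(2 * s) • b))
      (2 * U (√(2 * s) • b) + √(2 * s) * inner ℝ (gradient U (√(2 * s) • b)) b) s := by
  have h1 : HasDerivAt (fun s : ℝ => 2 * s) 2 s := by
    simpa using (hasDerivAt_id s).const_mul 2
  have h2 := h1.sqrt (by positivity)
  have h3 := U_compAt hU (h2.smul_const b)
  have h4 := h1.mul h3
  refine h4.congr_deriv ?_
  rw [inner_smul_right]
  have h5 : √(2 * s) ≠ 0 := (Real.sqrt_pos.2 (by positivity)).ne'
  have h6 : 2 * s = √(2 * s) * √(2 * s) := (Real.mul_self_sqrt (by positivity)).symm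
  have h7 : 2 * s * (2 / (2 * √(2 * s))) = √(2 * s) := by
    rw [mul_div_assoc', div_eq_iff (by positivity)]
    linarith
  rw [← mul_assoc, h7]

set_option maxHeartbeats 1000000 in
lemma pair_multi (hU : ContDiff ℝ 1 U) (hrad : ∃ u : ℝ → ℝ, ∀ z, U z = u ‖z‖)
    {T L R : ℝ} (hT : 0 < T) (hL : 0 ≤ L) (hR : 1 ≤ R)
    {x0 v0 f0 : Eu n} {x v f y w e : ℝ → Eu n}
    (h1 : Pair U T L R x0 v0 f0 x v f) (h2 : Pair U T L R x0 v0 f0 y w e)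
    (hx0 : x0 ≠ 0)
    (hreg : inner ℝ x0 v0 ≠ 0 ∨ ‖v0‖ ^ 2 + inner ℝ x0 (f0 - gradient U x0) ≠ 0)
    (c : ℝ) (hc : 0 < c) :
    ∀ᶠ η in 𝓝[>] (0 : ℝ), ∀ K, 0 ≤ K →
      (∀ t ∈ Icc 0 η, ‖f t - e t‖ ≤ K * t) → (∀ t ∈ Icc 0 η, ‖v t - w t‖ ≤ K * t) →
      ∀ t ∈ Icc 0 η, ‖v t - w t‖ ≤ c * K * t := by
  have hR0 : 0 < R := by linarith
  have hxp : 0 < ‖x0‖ := norm_pos_iff.2 hx0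
  set b : Eu n := ‖x0‖⁻¹ • x0 with hb
  have hb1 : ‖b‖ = 1 := by
    rw [hb, norm_smul, norm_inv, norm_norm, inv_mul_cancel₀ hxp.ne']
  set κ := ‖x0‖ ^ 2 / 4 with hκ
  have hκ0 : 0 < κ := by positivity
  set ε := κ ^ 2 * c / (14 * R ^ 4) with hε
  have hε0 : 0 < ε := by positivity
  have h0T : (0 : ℝ) ∈ Icc 0 T := ⟨le_rfl, hT.le⟩
  have hx0R : ‖x0‖ ≤ R := by rw [← h1.x00]; exact h1.xR 0 h0T
  have hFL : ∀ {x v f : ℝ → Eu n}, Pair U T L R x0 v0 f0 x v f → ∀ t ∈ Icc 0 T,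
      |(2 * (‖v t‖ ^ 2 / 2 + U (x t)) + inner ℝ (x t) (f t)) -
        (2 * (‖v0‖ ^ 2 / 2 + U x0) + inner ℝ x0 f0)| ≤ (3 * R ^ 2 + R * L) * t := by
    intro x v f h t ht
    have e1 := growth (C := R * R) 0 (h.energy hU) (fun t ht => by
      rw [pow_zero, mul_one, Real.norm_eq_abs]; exact inner_abs_le (h.vR t ht) (h.fR t ht)) t ht
    simp only [h.x00, h.v00, Real.norm_eq_abs, zero_add, pow_one, Nat.cast_zero, div_one] at e1
    have e2 : |inner ℝ (x t) (f t) - inner ℝ x0 f0| ≤ R * t * R + R * (L * t) := by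
      have : inner ℝ (x t) (f t) - inner ℝ x0 f0 = inner ℝ (x t - x0) (f t) +
          inner ℝ x0 (f t - f0) := by
        rw [inner_sub_left, inner_sub_right]; ring
      rw [this]
      exact (abs_add_le _ _).trans (add_le_add (inner_abs_le (h.x_sub t ht) (h.fR t ht))
        (inner_abs_le hx0R (h.fL t ht)))
    rw [abs_le] at *
    constructor <;> nlinarith [e1.1, e1.2, e2.1, e2.2]
  have hsc := scalar_lemma (fun s => 2 * s * U (√(2 * s) • b))
    (fun s => 2 * U (√(2 * s) • b) + √(2 * s) * inner ℝ (gradient U (√(2 * s) • b)) b)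
    (‖x0‖ ^ 2 / 2) (inner ℝ x0 v0) (2 * (‖v0‖ ^ 2 / 2 + U x0) + inner ℝ x0 f0)
    (3 * R ^ 2 + R * L) T hT (by positivity)
    (by
      filter_upwards [lt_mem_nhds (show 0 < ‖x0‖ ^ 2 / 2 by positivity)] with s hs
      exact G_deriv hU b hs)
    (by
      have hg := grad_cont' hU
      have hu := hU.continuous
      have : Continuous fun s : ℝ => 2 * U (√(2 * s) • b) +
        √(2 * s) * inner ℝ (gradient U (√(2 * s) • b)) b := by fun_prop
      exact this.continuousAt)
    (fun t => ‖x t‖ ^ 2 / 2) (fun t => ‖y t‖ ^ 2 / 2)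
    (fun t => inner ℝ (x t) (v t)) (fun t => inner ℝ (y t) (w t))
    (fun t => 2 * (‖v t‖ ^ 2 / 2 + U (x t)) + inner ℝ (x t) (f t))
    (fun t => 2 * (‖w t‖ ^ 2 / 2 + U (y t)) + inner ℝ (y t) (e t))
    (fun t ht => ((h1.hx t ht).norm_sq.div_const 2).congr_deriv (by ring))
    (fun t ht => ((h2.hx t ht).norm_sq.div_const 2).congr_deriv (by ring))
    (h1.rho hU hrad hb1) (h2.rho hU hrad hb1)
    (by simp [h1.x00]) (by simp [h2.x00]) (by simp [h1.x00, h1.v00]) (by simp [h2.x00, h2.v00])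
    (hFL h1) (hFL h2)
    (by
      rcases hreg with h | h
      · exact Or.inl h
      · right
        intro h'
        apply h
        rw [← h', mul_div_cancel₀ _ (two_ne_zero), Real.sqrt_sq (norm_nonneg _),
          ← grad_radial hU hrad _ b hb1]
        obtain ⟨u, hu⟩ := hrad
        have : U (‖x0‖ • b) = U x0 := by
          rw [hu, hu, norm_smul, hb1]; simp
        rw [this, inner_sub_right]
        ring) ε hε0
  filter_upwards [hsc, hsmall T hT, hsmall 1 one_pos, hsmall (‖x0‖ / (2 * R)) (by positivity),
    hsmall ε hε0, self_mem_nhdsWithin] with η hη hηT hη1 hηx hηε hη0 K hK hfe hvw t ht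
  have hη0 : 0 < η := hη0
  replace h1 := h1.mono hηT.le
  replace h2 := h2.mono hηT.le
  have ht0 := ht.1
  have ht1 : ∀ t ∈ Icc 0 η, t ≤ 1 := fun t ht => ht.2.trans hη1.le
  -- positions
  have hxy2 : ∀ t ∈ Icc 0 η, ‖x t - y t‖ ≤ K * t ^ 2 / 2 := by
    intro t ht
    have := growth (f := fun t => x t - y t) (C := K) 1
      (fun t ht => (h1.hx t ht).sub (h2.hx t ht)) (fun t ht => by simpa using hvw t ht) t ht
    simp only [h1.x00, h2.x00, sub_self, sub_zero] at this
    norm_num at this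
    exact this
  have hxy : ∀ t ∈ Icc 0 η, ‖x t - y t‖ ≤ K * t := by
    intro t ht
    have h0 := ht.1
    have : K * t * t ≤ K * t * 1 := mul_le_mul_of_nonneg_left (ht1 t ht) (by positivity)
    have h3 := hxy2 t ht
    have : 0 ≤ K * t := by positivity
    nlinarith
  -- energies
  have hE : ∀ t ∈ Icc 0 η, |(‖v t‖ ^ 2 / 2 + U (x t)) - (‖w t‖ ^ 2 / 2 + U (y t))| ≤ R * K * t := by
    intro t ht
    have h0 := ht.1
    have := growth (f := fun t => (‖v t‖ ^ 2 / 2 + U (x t)) - (‖w t‖ ^ 2 / 2 + U (y t)))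
      (C := 2 * R * K) 1
      (fun t ht => (h1.energy hU t ht).sub (h2.energy hU t ht)) (fun t ht => by
        have e0 : inner ℝ (v t) (f t) - inner ℝ (w t) (e t) =
          inner ℝ (v t - w t) (f t) + inner ℝ (w t) (f t - e t) := by
          rw [inner_sub_left, inner_sub_right]; ring
        rw [e0, Real.norm_eq_abs]
        have e1 := inner_abs_le (hvw t ht) (h1.fR t ht)
        have e2 := inner_abs_le (h2.vR t ht) (hfe t ht)
        have := abs_add_le (inner ℝ (v t - w t) (f t)) (inner ℝ (w t) (f t - e t))
        linarith) t ht
    simp only [h1.x00, h2.x00, h1.v00, h2.v00, sub_self, sub_zero, Real.norm_eq_abs] at this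
    norm_num at this
    have h3 : R * K * t * t ≤ R * K * t * 1 := mul_le_mul_of_nonneg_left (ht1 t ht) (by positivity)
    nlinarith
  have hF : ∀ t ∈ Icc 0 η, |(2 * (‖v t‖ ^ 2 / 2 + U (x t)) + inner ℝ (x t) (f t)) -
      (2 * (‖w t‖ ^ 2 / 2 + U (y t)) + inner ℝ (y t) (e t))| ≤ (6 * R * K) * t := by
    intro t ht
    have e0 := hE t ht
    have h0 := ht.1
    have e1 : |inner ℝ (x t) (f t) - inner ℝ (y t) (e t)| ≤ K * t * R + R * (K * t) := by
      have e0 : inner ℝ (x t) (f t) - inner ℝ (y t) (e t) =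
          inner ℝ (x t - y t) (f t) + inner ℝ (y t) (f t - e t) := by
        rw [inner_sub_left, inner_sub_right]; ring
      rw [e0]
      exact (abs_add_le _ _).trans (add_le_add (inner_abs_le (hxy t ht) (h1.fR t ht))
        (inner_abs_le (h2.xR t ht) (hfe t ht)))
    have e2 : 0 ≤ R * K * t := by positivity
    rw [abs_le] at *
    constructor <;> linarith [e0.1, e0.2, e1.1, e1.2]
  have hρ := hη (6 * R * K) (by positivity) hF t ht
  -- tangential part
  have hTd : ‖(inner ℝ (x t) x0 • v t - inner ℝ (v t) x0 • x t) -
      (inner ℝ (y t) x0 • w t - inner ℝ (w t) x0 • y t)‖ ≤ 2 * R ^ 2 * K * t ^ 2 := by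
    have := growth (f := fun t => (inner ℝ (x t) x0 • v t - inner ℝ (v t) x0 • x t) -
      (inner ℝ (y t) x0 • w t - inner ℝ (w t) x0 • y t)) (C := 4 * R ^ 2 * K) 1
      (fun t ht => (h1.tang hU hrad t ht).sub (h2.tang hU hrad t ht)) (fun t ht => by
        have e0 : (inner ℝ (x t) x0 • f t - inner ℝ (f t) x0 • x t) -
            (inner ℝ (y t) x0 • e t - inner ℝ (e t) x0 • y t) =
          inner ℝ (x t - y t) x0 • f t + (inner ℝ (y t) x0 • (f t - e t)) -
            (inner ℝ (f t - e t) x0 • x t + inner ℝ (e t) x0 • (x t - y t)) := by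
          simp only [inner_sub_left]; module
        rw [e0]
        have i1 := norm_isl (hxy t ht) hx0R (h1.fR t ht)
        have i2 := norm_isl (h2.xR t ht) hx0R (hfe t ht)
        have i3 := norm_isl (hfe t ht) hx0R (h1.xR t ht)
        have i4 := norm_isl (h2.fR t ht) hx0R (hxy t ht)
        refine (norm_sub_le _ _).trans ?_
        refine (add_le_add (norm_add_le _ _) (norm_add_le _ _)).trans ?_
        nlinarith) t ht
    simp only [h1.x00, h2.x00, h1.v00, h2.v00, sub_self, sub_zero] at this
    norm_num at this
    linarith
  set q := inner ℝ (x t) x0 • (v t - w t) - inner ℝ (v t - w t) x0 • x t with hq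
  have hqn : ‖q‖ ≤ 3 * R ^ 2 * K * t ^ 2 := by
    have e0 : q = ((inner ℝ (x t) x0 • v t - inner ℝ (v t) x0 • x t) -
      (inner ℝ (y t) x0 • w t - inner ℝ (w t) x0 • y t)) -
      (inner ℝ (x t - y t) x0 • w t - inner ℝ (w t) x0 • (x t - y t)) := by
      rw [hq]; simp only [inner_sub_left]; module
    rw [e0]
    have i1 := norm_isl (hxy2 t ht) hx0R (h2.vR t ht)
    have i2 := norm_isl (h2.vR t ht) hx0R (hxy2 t ht)
    refine (norm_sub_le _ _).trans ?_
    refine (add_le_add hTd (norm_sub_le _ _)).trans ?_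
    nlinarith
  have hax : |inner ℝ (v t - w t) (x t)| ≤ ε * (6 * R * K) * t + R * K * t ^ 2 := by
    have e0 : inner ℝ (v t - w t) (x t) = (inner ℝ (x t) (v t) - inner ℝ (y t) (w t))
        - inner ℝ (w t) (x t - y t) := by
      rw [inner_sub_left, inner_sub_right, real_inner_comm (v t), real_inner_comm (w t) (y t)]; ring
    rw [e0]
    have i1 := inner_abs_le (h2.vR t ht) (hxy2 t ht)
    have i2 : 0 ≤ R * K * t ^ 2 := by positivity
    refine (abs_sub _ _).trans ?_
    linarith
  have hxx : ‖x t - x0‖ ≤ ‖x0‖ / 2 := by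
    refine (h1.x_sub t ht).trans ?_
    have : R * t ≤ R * (‖x0‖ / (2 * R)) := by
      have := ht.2; gcongr; linarith
    refine this.trans (le_of_eq ?_)
    field_simp
  have hk1 : κ ≤ inner ℝ (x t) x0 := by
    have e0 : inner ℝ (x t) x0 = ‖x0‖ ^ 2 + inner ℝ (x t - x0) x0 := by
      rw [inner_sub_left, real_inner_self_eq_norm_sq]; ring
    have := (abs_le.1 (inner_abs_le hxx (le_refl ‖x0‖))).1
    rw [e0, hκ]
    nlinarith
  have hk2 : κ ≤ ‖x t‖ ^ 2 := by
    have e0 : ‖x0‖ / 2 ≤ ‖x t‖ := by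
      have := norm_sub_le (x t) (x t - x0)
      rw [sub_sub_cancel] at this
      linarith
    rw [hκ]
    nlinarith
  have hrec := recover hκ0 hR (h1.xR t ht) hx0R hk1 hk2 hq.symm
  have htε : t ≤ ε := ht.2.trans hηε.le
  have e1 : 2 * R ^ 2 * ‖q‖ ≤ 2 * R ^ 2 * (3 * R ^ 2 * K * t ^ 2) := by gcongr
  have e2 : R ^ 3 * |inner ℝ (v t - w t) (x t)| ≤
      R ^ 3 * (ε * (6 * R * K) * t + R * K * t ^ 2) := by gcongr
  have e3 : R ^ 4 * (K * t) * t ≤ R ^ 4 * (K * t) * ε := by gcongr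
  have e4 : 14 * R ^ 4 * ε = κ ^ 2 * c := by rw [hε]; field_simp
  have e5 : κ ^ 2 * ‖v t - w t‖ ≤ κ ^ 2 * (c * K * t) := by
    have : κ ^ 2 * (c * K * t) = (14 * R ^ 4 * ε) * (K * t) := by rw [e4]; ring
    rw [this]
    have a1 : 2 * R ^ 2 * (3 * R ^ 2 * K * t ^ 2) = 6 * (R ^ 4 * (K * t) * t) := by ring
    have a2 : R ^ 3 * (ε * (6 * R * K) * t + R * K * t ^ 2) =
      6 * (R ^ 4 * (K * t) * ε) + R ^ 4 * (K * t) * t := by ring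
    have a3 : (14 * R ^ 4 * ε) * (K * t) = 14 * (R ^ 4 * (K * t) * ε) := by ring
    have : 0 ≤ R ^ 4 * (K * t) * ε := by positivity
    linarith
  exact le_of_mul_le_mul_left e5 (by positivity)

end particle2
end CS

namespace CS
open Topology

lemma IsSol.cont {Z : Type*} [NormedAddCommGroup Z] [NormedSpace ℝ Z] {F : Z → Z} {T : ℝ}
    {z : ℝ → Z} (h : IsSol F T z) : ContinuousOn z (Icc 0 T) :=
  fun t ht => (h t ht).continuousWithinAt

lemma IsSol.mono {Z : Type*} [NormedAddCommGroup Z] [NormedSpace ℝ Z] {F : Z → Z} {T T' : ℝ}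
    {z : ℝ → Z} (h : IsSol F T z) (hT : T' ≤ T) : IsSol F T' z := by
  have hsub : Icc 0 T' ⊆ Icc 0 T := Icc_subset_Icc_right hT
  exact fun t ht => (h t (hsub ht)).mono hsub

lemma IsSol.shift {Z : Type*} [NormedAddCommGroup Z] [NormedSpace ℝ Z] {F : Z → Z} {T a : ℝ}
    {z : ℝ → Z} (h : IsSol F T z) (ha : 0 ≤ a) : IsSol F (T - a) (fun t => z (a + t)) := by
  intro t ht
  have h1 : HasDerivWithinAt (fun t : ℝ => a + t) 1 (Icc 0 (T - a)) t :=
    ((hasDerivAt_id t).const_add a).hasDerivWithinAt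
  have h2 := h (a + t) ⟨by linarith [ht.1], by linarith [ht.2]⟩
  have := h2.scomp t h1 (fun s hs => ⟨by linarith [hs.1], by linarith [hs.2]⟩)
  rw [one_smul] at this
  exact this

namespace Sys
variable {n N : ℕ} (S : Sys n)

lemma fric_lip {R : ℝ} (hR : 0 ≤ R) (a b : ZZ n N) (hb : ‖b‖ ≤ R) (i : Fin N) :
    ‖S.fric a i - S.fric b i‖ ≤ (2 * S.Bφ + 4 * S.Lφ * R) * ‖a - b‖ := by
  have hB := S.Bφ_nonneg
  have hLn : (0 : ℝ) ≤ S.Lφ := S.Lφ.2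
  have h1 : ∀ i, ‖a.1 i - b.1 i‖ ≤ ‖a - b‖ := fun i =>
    (norm_le_pi_norm (a - b).1 i).trans (norm_fst_le (a - b))
  have h2 : ∀ i, ‖a.2 i - b.2 i‖ ≤ ‖a - b‖ := fun i =>
    (norm_le_pi_norm (a - b).2 i).trans (norm_snd_le (a - b))
  have h3 : ∀ i, ‖b.2 i‖ ≤ R := fun i =>
    (norm_le_pi_norm b.2 i).trans ((norm_snd_le b).trans hb)
  unfold fric
  rw [← smul_sub, ← Finset.sum_sub_distrib, norm_smul, norm_inv, Real.norm_natCast]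
  have hsum : ‖∑ j, (S.φ (a.1 i - a.1 j) • (a.2 j - a.2 i) - S.φ (b.1 i - b.1 j) • (b.2 j - b.2 i))‖
      ≤ ∑ j : Fin N, (2 * S.Bφ + 4 * S.Lφ * R) * ‖a - b‖ := by
    refine norm_sum_le_of_le _ fun j _ => ?_
    have e : S.φ (a.1 i - a.1 j) • (a.2 j - a.2 i) - S.φ (b.1 i - b.1 j) • (b.2 j - b.2 i) =
        S.φ (a.1 i - a.1 j) • ((a.2 j - b.2 j) - (a.2 i - b.2 i)) +
        (S.φ (a.1 i - a.1 j) - S.φ (b.1 i - b.1 j)) • (b.2 j - b.2 i) := by module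
    rw [e]
    refine (norm_add_le _ _).trans ?_
    rw [norm_smul, norm_smul]
    have e1 : ‖S.φ (a.1 i - a.1 j)‖ ≤ S.Bφ := by
      rw [Real.norm_of_nonneg (S.φnn _)]; exact S.φle _
    have e2 : ‖(a.2 j - b.2 j) - (a.2 i - b.2 i)‖ ≤ 2 * ‖a - b‖ := by
      have := norm_sub_le (a.2 j - b.2 j) (a.2 i - b.2 i)
      linarith [h2 i, h2 j]
    have e3 : ‖S.φ (a.1 i - a.1 j) - S.φ (b.1 i - b.1 j)‖ ≤ S.Lφ * (2 * ‖a - b‖) := by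
      refine (S.φlip.norm_sub_le _ _).trans ?_
      refine mul_le_mul_of_nonneg_left ?_ hLn
      have : a.1 i - a.1 j - (b.1 i - b.1 j) = (a.1 i - b.1 i) - (a.1 j - b.1 j) := by abel
      rw [this]
      have := norm_sub_le (a.1 i - b.1 i) (a.1 j - b.1 j)
      linarith [h1 i, h1 j]
    have e4 : ‖b.2 j - b.2 i‖ ≤ 2 * R := by
      have := norm_sub_le (b.2 j) (b.2 i)
      linarith [h3 i, h3 j]
    have f1 := mul_le_mul e1 e2 (norm_nonneg _) hB
    have f2 := mul_le_mul e3 e4 (norm_nonneg _) (by positivity)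
    nlinarith
  rw [Finset.sum_const, Finset.card_univ, Fintype.card_fin, nsmul_eq_mul] at hsum
  rcases Nat.eq_zero_or_pos N with hN | hN
  · subst hN; exact i.elim0
  · have hN' : (0 : ℝ) < N := by exact_mod_cast hN
    rw [inv_mul_le_iff₀ hN']
    exact hsum

/-- regular points for particle `i` -/
def Reg (z : ZZ n N) (i : Fin N) : Prop :=
  (n = 1 ∧ (z.2 i ≠ 0 ∨ S.acc z i ≠ 0)) ∨
  (z.1 i ≠ 0 ∧ (inner ℝ (z.1 i) (z.2 i) ≠ 0 ∨
    ‖z.2 i‖ ^ 2 + inner ℝ (z.1 i) (S.acc z i) ≠ 0))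

lemma sol_x {T : ℝ} {z : ℝ → ZZ n N} (h : IsSol S.fld T z) (i : Fin N) : ∀ t ∈ Icc 0 T,
    HasDerivWithinAt (fun t => (z t).1 i) ((z t).2 i) (Icc 0 T) t := by
  intro t ht
  exact (((ContinuousLinearMap.proj (R := ℝ) (φ := fun _ : Fin N => Eu n) i).comp
    (ContinuousLinearMap.fst ℝ (Fin N → Eu n) (Fin N → Eu n))).hasFDerivAt.comp_hasDerivWithinAt t
      (h t ht))

lemma sol_v {T : ℝ} {z : ℝ → ZZ n N} (h : IsSol S.fld T z) (i : Fin N) : ∀ t ∈ Icc 0 T,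
    HasDerivWithinAt (fun t => (z t).2 i) (S.acc (z t) i) (Icc 0 T) t := by
  intro t ht
  exact (((ContinuousLinearMap.proj (R := ℝ) (φ := fun _ : Fin N => Eu n) i).comp
    (ContinuousLinearMap.snd ℝ (Fin N → Eu n) (Fin N → Eu n))).hasFDerivAt.comp_hasDerivWithinAt t
      (h t ht))

lemma fld_le {R : ℝ} (z : ZZ n N) (hz : ‖z‖ ≤ R) : ‖S.fld z‖ ≤ R + S.Cacc N * (1 + R) := by
  have hC := S.Cacc_nonneg (N := N)
  have hR : 0 ≤ R := (norm_nonneg _).trans hz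
  unfold fld
  rw [Prod.norm_def]
  have h1 : ‖z.2‖ ≤ R := (norm_snd_le z).trans hz
  have h2 := S.acc_le z
  have h3 : S.Cacc N * (1 + ‖z‖) ≤ S.Cacc N * (1 + R) := by gcongr
  refine max_le ?_ ?_
  · simp only; nlinarith [mul_nonneg hC (by linarith : 0 ≤ 1 + R)]
  · simp only; linarith

lemma sol_lip {T R : ℝ} {z : ℝ → ZZ n N} (h : IsSol S.fld T z) (hz : ∀ t ∈ Icc 0 T, ‖z t‖ ≤ R) :
    ∀ t ∈ Icc 0 T, ‖z t - z 0‖ ≤ (R + S.Cacc N * (1 + R)) * t := by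
  intro t ht
  have := growth (C := R + S.Cacc N * (1 + R)) 0 h (fun t ht => by
    rw [pow_zero, mul_one]; exact S.fld_le _ (hz t ht)) t ht
  simpa using this

lemma sol_pair {T R : ℝ} (hR : 0 ≤ R) (hT : 0 ≤ T) {z : ℝ → ZZ n N} (h : IsSol S.fld T z)
    (hz : ∀ t ∈ Icc 0 T, ‖z t‖ ≤ R) (i : Fin N) :
    Pair S.U T ((2 * S.Bφ + 4 * S.Lφ * R) * (R + S.Cacc N * (1 + R)))
      (1 + R + 2 * S.pmax N * R) ((z 0).1 i) ((z 0).2 i) (S.fric (z 0) i)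
      (fun t => (z t).1 i) (fun t => (z t).2 i) (fun t => S.fric (z t) i) := by
  have hp := S.pmax_nonneg (N := N)
  have hB := S.Bφ_nonneg
  have hLn : (0 : ℝ) ≤ S.Lφ := S.Lφ.2
  have hpR : 0 ≤ 2 * S.pmax N * R := by positivity
  refine ⟨S.sol_x h i, S.sol_v h i, rfl, rfl, ?_, ?_, ?_, ?_⟩
  · intro t ht
    refine (S.fric_lip hR _ _ (hz 0 ⟨le_rfl, hT⟩) i).trans ?_
    have hnn : 0 ≤ 2 * S.Bφ + 4 * S.Lφ * R := by positivity
    exact (mul_le_mul_of_nonneg_left (S.sol_lip h hz t ht) hnn).trans (le_of_eq (by ring))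
  · intro t ht
    have := (norm_le_pi_norm (z t).1 i).trans ((norm_fst_le (z t)).trans (hz t ht))
    linarith
  · intro t ht
    have := (norm_le_pi_norm (z t).2 i).trans ((norm_snd_le (z t)).trans (hz t ht))
    linarith
  · intro t ht
    have h1 := S.fric_le (z t) i
    have h2 := ((norm_snd_le (z t)).trans (hz t ht))
    have h3 := S.Phi_le (z t)
    have h4 : 2 * S.Phi (z t) * ‖(z t).2‖ ≤ 2 * S.pmax N * R := by gcongr
    linarith

lemma loc_uniq {T : ℝ} (hT : 0 < T) {y z : ℝ → ZZ n N} (hy : IsSol S.fld T y)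
    (hz : IsSol S.fld T z) (h0 : y 0 = z 0) (hreg : ∀ i, S.Reg (z 0) i) :
    ∃ η, 0 < η ∧ η ≤ T ∧ ∀ t ∈ Icc 0 η, y t = z t := by
  obtain ⟨R1, hR1⟩ := isCompact_Icc.exists_bound_of_continuousOn hy.cont
  obtain ⟨R2, hR2⟩ := isCompact_Icc.exists_bound_of_continuousOn hz.cont
  set R := max R1 R2 with hRd
  have hyR : ∀ t ∈ Icc 0 T, ‖y t‖ ≤ R := fun t ht => (hR1 t ht).trans (le_max_left _ _)
  have hzR : ∀ t ∈ Icc 0 T, ‖z t‖ ≤ R := fun t ht => (hR2 t ht).trans (le_max_right _ _)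
  have hR : 0 ≤ R := (norm_nonneg _).trans (hyR 0 ⟨le_rfl, hT.le⟩)
  have hp := S.pmax_nonneg (N := N)
  have hB := S.Bφ_nonneg
  have hLn : (0 : ℝ) ≤ S.Lφ := S.Lφ.2
  have hCa := S.Cacc_nonneg (N := N)
  have hpR : 0 ≤ 2 * S.pmax N * R := by positivity
  set Lf := 1 + (2 * S.Bφ + 4 * S.Lφ * R) with hLf
  have hLf1 : 1 ≤ Lf := by rw [hLf]; nlinarith [mul_nonneg hLn hR]
  have hpart : ∀ i : Fin N, ∀ᶠ η in 𝓝[>] (0 : ℝ), ∀ K, 0 ≤ K →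
      (∀ t ∈ Icc 0 η, ‖S.fric (y t) i - S.fric (z t) i‖ ≤ K * t) →
      (∀ t ∈ Icc 0 η, ‖(y t).2 i - (z t).2 i‖ ≤ K * t) →
      ∀ t ∈ Icc 0 η, ‖(y t).2 i - (z t).2 i‖ ≤ (1 / (2 * Lf)) * K * t := by
    intro i
    have p1 := S.sol_pair hR hT.le hy hyR i
    have p2 := S.sol_pair hR hT.le hz hzR i
    rw [h0] at p1
    rcases hreg i with ⟨hn, hr⟩ | ⟨hx0, hr⟩
    · subst hn
      exact pair_one S.UC1 hT (by positivity) p1 p2 hr _ (by positivity)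
    · exact pair_multi S.UC1 S.Urad hT (by positivity) (by linarith) p1 p2 hx0 hr _ (by positivity)
  have hall := (eventually_all.2 hpart).and ((hsmall T hT).and ((hsmall 1 one_pos).and
    (self_mem_nhdsWithin : Ioi (0:ℝ) ∈ 𝓝[>] (0:ℝ))))
  obtain ⟨η, hη, hηT, hη1, hη0⟩ := hall.exists
  have hη0 : 0 < η := hη0
  have hsub : Icc 0 η ⊆ Icc 0 T := Icc_subset_Icc_right hηT.le
  -- position bound
  have hpos : ∀ K, 0 ≤ K → (∀ i, ∀ t ∈ Icc 0 η, ‖(y t).2 i - (z t).2 i‖ ≤ K * t) →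
      ∀ t ∈ Icc 0 η, ‖y t - z t‖ ≤ K * t := by
    intro K hK hv t ht
    have ht0 := ht.1
    have hKt : 0 ≤ K * t := by positivity
    rw [Prod.norm_def]
    refine max_le ?_ ?_
    · rw [pi_norm_le_iff_of_nonneg hKt]
      intro i
      have := growth (f := fun t => (y t).1 i - (z t).1 i) (C := K) 1
        (fun t ht => (S.sol_x (hy.mono hηT.le) i t ht).sub (S.sol_x (hz.mono hηT.le) i t ht))
        (fun t ht => by simpa using hv i t ht) t ht
      simp only [h0, sub_self, sub_zero] at this
      norm_num at this
      have h3 : K * t * t ≤ K * t * 1 :=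
        mul_le_mul_of_nonneg_left (ht.2.trans hη1.le) (by positivity)
      change ‖(y t).1 i - (z t).1 i‖ ≤ _
      nlinarith
    · rw [pi_norm_le_iff_of_nonneg hKt]
      intro i
      exact hv i t ht
  have hstep : ∀ K, 0 ≤ K → (∀ i, ∀ t ∈ Icc 0 η, ‖(y t).2 i - (z t).2 i‖ ≤ K * t) →
      (∀ i, ∀ t ∈ Icc 0 η, ‖(y t).2 i - (z t).2 i‖ ≤ (K / 2) * t) := by
    intro K hK hv i t ht
    have hyz := hpos K hK hv
    have := hη i (Lf * K) (by positivity) (fun t ht => by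
      refine (S.fric_lip hR _ _ (hzR t (hsub ht)) i).trans ?_
      rw [mul_assoc Lf K]
      refine mul_le_mul (by linarith) (hyz t ht) (norm_nonneg _) (by linarith)) (fun t ht => by
      refine (hv i t ht).trans ?_
      have : 0 ≤ K * t := mul_nonneg hK ht.1
      nlinarith) t ht
    refine this.trans (le_of_eq ?_)
    field_simp
  set K0 := 2 * (R + S.Cacc N * (1 + R)) with hK0
  have hK00 : 0 ≤ K0 := by positivity
  have hiter : ∀ k : ℕ, ∀ i, ∀ t ∈ Icc 0 η, ‖(y t).2 i - (z t).2 i‖ ≤ ((1 / 2) ^ k * K0) * t := by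
    intro k
    induction k with
    | zero =>
      intro i t ht
      have e1 := S.sol_lip hy hyR t (hsub ht)
      have e2 := S.sol_lip hz hzR t (hsub ht)
      have e3 : ‖y t - z t‖ ≤ ‖y t - y 0‖ + ‖z t - z 0‖ := by
        have := norm_sub_le (y t - y 0) (z t - z 0)
        rw [h0] at this ⊢
        simpa using this
      have e4 : ‖(y t).2 i - (z t).2 i‖ ≤ ‖y t - z t‖ :=
        (norm_le_pi_norm (y t - z t).2 i).trans (norm_snd_le (y t - z t))
      rw [hK0, pow_zero]
      linarith
    | succ k ih =>
      intro i t ht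
      have := hstep _ (by positivity) ih i t ht
      refine this.trans (le_of_eq ?_)
      rw [pow_succ]; ring
  refine ⟨η, hη0, hηT.le, fun t ht => ?_⟩
  have hz0 : ∀ i, ∀ t ∈ Icc 0 η, ‖(y t).2 i - (z t).2 i‖ ≤ 0 * t := by
    intro i t ht
    have hlim : Tendsto (fun k : ℕ => ((1 / 2 : ℝ) ^ k * K0) * t) atTop (𝓝 ((0 * K0) * t)) :=
      ((tendsto_pow_atTop_nhds_zero_of_lt_one (by norm_num) (by norm_num)).mul_const _).mul_const _
    have := ge_of_tendsto' hlim (fun k => hiter k i t ht)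
    simpa using this
  have := hpos 0 le_rfl hz0 t ht
  rw [zero_mul] at this
  exact sub_eq_zero.1 (norm_le_zero_iff.1 this)

lemma uniq_of_avoid {T : ℝ} {y z : ℝ → ZZ n N} (hy : IsSol S.fld T y)
    (hz : IsSol S.fld T z) (h0 : y 0 = z 0) (hreg : ∀ t ∈ Ico 0 T, ∀ i, S.Reg (z t) i) :
    ∀ t ∈ Icc 0 T, y t = z t := by
  have hcl : IsClosed ({t | y t = z t} ∩ Icc 0 T) := by
    have := (hy.cont.sub hz.cont).preimage_isClosed_of_isClosed isClosed_Icc (isClosed_singleton (x := 0))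
    convert this using 1
    ext t
    constructor
    · rintro ⟨h1, h2⟩; exact ⟨h2, by simpa [sub_eq_zero] using h1⟩
    · rintro ⟨h1, h2⟩; exact ⟨by simpa [sub_eq_zero] using h2, h1⟩
  intro t ht
  refine hcl.Icc_subset_of_forall_exists_gt h0 ?_ ht
  rintro a ⟨hya, ha⟩ b hb
  have hya : y a = z a := hya
  have hb : a < b := hb
  obtain ⟨η, hη0, hηT, hη⟩ := S.loc_uniq (T := T - a) (by linarith [ha.2]) (hy.shift ha.1) (hz.shift ha.1)
    (by simpa using hya) (by simpa using hreg a ha)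
  refine ⟨a + min η (b - a), ?_, ?_, ?_⟩
  · exact hη _ ⟨le_min hη0.le (by linarith), min_le_left _ _⟩
  · have : 0 < min η (b - a) := lt_min hη0 (by linarith)
    linarith
  · have := min_le_right η (b - a)
    linarith

end Sys
end CS

namespace CS
open Topology

/-- slab estimate -/
lemma slab {W : Type*} [NormedAddCommGroup W] [NormedSpace ℝ W] [FiniteDimensional ℝ W]
    [MeasurableSpace W] [BorelSpace W] (μ : Measure W) [μ.IsAddHaarMeasure]
    (l : W →L[ℝ] ℝ) (w : W) (hl : l w = 1) {K ρ η : ℝ} (hw : ‖w‖ ≤ K) (hη : 0 < η) (hη1 : η ≤ 1) :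
    μ {v | ‖v‖ < ρ ∧ |l v| < η} ≤ ENNReal.ofReal η * μ (Metric.ball 0 (ρ + 4 * K)) := by
  set A : Set W := {v | ‖v‖ < ρ ∧ |l v| < η} with hA
  have hAo : IsOpen A := (isOpen_lt continuous_norm continuous_const).inter
    (isOpen_lt l.continuous.abs continuous_const)
  have hK : 0 ≤ K := (norm_nonneg _).trans hw
  set L := ⌈1 / η⌉₊ with hL
  have hL1 : 1 / η ≤ L := Nat.le_ceil _
  have hL2 : (L : ℝ) < 1 / η + 1 := Nat.ceil_lt_add_one (by positivity)
  have hL1' : 1 ≤ η * L := by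
    rw [div_le_iff₀ hη] at hL1; linarith
  have hL2' : η * L ≤ 2 := by
    have : η * L < η * (1 / η + 1) := by gcongr
    rw [mul_add, mul_one_div_cancel hη.ne'] at this
    linarith
  set s : ℕ → Set W := fun k => (fun v => v + (-(2 * η * k)) • w) ⁻¹' A with hs
  have hμs : ∀ k, μ (s k) = μ A := fun k => measure_preimage_add_right μ _ A
  have hval : ∀ k, ∀ v ∈ s k, |l v - 2 * η * k| < η := by
    intro k v hv
    have hv' : |l (v + (-(2 * η * k)) • w)| < η := hv.2
    rw [map_add, map_smul, hl, smul_eq_mul, mul_one] at hv'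
    rwa [sub_eq_add_neg]
  have hsub : ∀ k ∈ Finset.range L, s k ⊆ Metric.ball 0 (ρ + 4 * K) := by
    intro k hk v hv
    have hk : k < L := Finset.mem_range.1 hk
    have hk' : (k : ℝ) ≤ L := by exact_mod_cast hk.le
    rw [mem_ball_zero_iff]
    have h1 : ‖v + (-(2 * η * k)) • w‖ < ρ := hv.1
    have h2 : ‖v‖ ≤ ‖v + (-(2 * η * k)) • w‖ + ‖(-(2 * η * k)) • w‖ := by
      have := norm_sub_le (v + (-(2 * η * k)) • w) ((-(2 * η * k)) • w)
      simpa using this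
    have h3 : ‖(-(2 * η * k)) • w‖ ≤ 4 * K := by
      rw [norm_smul, norm_neg, Real.norm_of_nonneg (by positivity)]
      refine mul_le_mul ?_ hw (norm_nonneg _) (by norm_num)
      nlinarith
    linarith
  have hdisj : (↑(Finset.range L) : Set ℕ).PairwiseDisjoint s := by
    intro k _ k' _ hkk
    change Disjoint (s k) (s k')
    rw [Set.disjoint_left]
    intro v hv hv'
    have h1 := abs_lt.1 (hval k v hv)
    have h2 := abs_lt.1 (hval k' v hv')
    rcases lt_or_gt_of_ne hkk with h | h
    · have : (k : ℝ) + 1 ≤ k' := by exact_mod_cast h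
      nlinarith
    · have : (k' : ℝ) + 1 ≤ k := by exact_mod_cast h
      nlinarith
  have hsum : (L : ENNReal) * μ A ≤ μ (Metric.ball 0 (ρ + 4 * K)) := by
    calc (L : ENNReal) * μ A = ∑ k ∈ Finset.range L, μ (s k) := by
          simp [hμs]
      _ = μ (⋃ k ∈ Finset.range L, s k) := by
          rw [measure_biUnion_finset hdisj]
          intro k _
          exact (hAo.preimage (by fun_prop)).measurableSet
      _ ≤ _ := measure_mono (iUnion₂_subset hsub)
  calc μ A = 1 * μ A := (one_mul _).symm
    _ ≤ (ENNReal.ofReal η * L) * μ A := by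
        gcongr
        rw [← ENNReal.ofReal_natCast, ← ENNReal.ofReal_mul hη.le, ← ENNReal.ofReal_one]
        exact ENNReal.ofReal_le_ofReal hL1'
    _ = ENNReal.ofReal η * (L * μ A) := by ring
    _ ≤ _ := by gcongr

/-- thin tube estimate -/
lemma tube {n N : ℕ} (i : Fin N) (ρ : ℝ) : ∃ C : ENNReal, C ≠ ⊤ ∧ ∀ η, 0 < η →
    volume {x : Fin N → Eu n | ‖x‖ < ρ ∧ ‖x i‖ < η} ≤ ENNReal.ofReal (η ^ n) * C := by
  refine ⟨volume (Metric.ball (0 : Eu n) 1) *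
    ∏ j ∈ Finset.univ \ {i}, volume (Metric.ball (0 : Eu n) ρ), ?_, ?_⟩
  · exact ENNReal.mul_ne_top measure_ball_lt_top.ne
      (ENNReal.prod_ne_top fun _ _ => measure_ball_lt_top.ne)
  · intro η hη
    have hsub : {x : Fin N → Eu n | ‖x‖ < ρ ∧ ‖x i‖ < η} ⊆
        Set.pi univ (Function.update (fun _ => Metric.ball (0 : Eu n) ρ) i (Metric.ball 0 η)) := by
      rintro x hx j _
      have hx : ‖x‖ < ρ ∧ ‖x i‖ < η := hx
      by_cases hj : j = i
      · subst hj
        simpa using hx.2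
      · rw [Function.update_of_ne hj, mem_ball_zero_iff]
        exact (norm_le_pi_norm x j).trans_lt hx.1
    refine (measure_mono hsub).trans ?_
    rw [volume_pi, Measure.pi_pi]
    have e : ∀ j, volume (Function.update (fun _ => Metric.ball (0 : Eu n) ρ) i (Metric.ball 0 η) j) =
        Function.update (fun _ => volume (Metric.ball (0 : Eu n) ρ)) i (volume (Metric.ball (0 : Eu n) η)) j := by
      intro j
      by_cases hj : j = i
      · subst hj; simp
      · simp [Function.update_of_ne hj]
    rw [Finset.prod_congr rfl fun j _ => e j, Finset.prod_update_of_mem (Finset.mem_univ i),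
      Measure.addHaar_ball_of_pos _ _ hη, finrank_euclideanSpace_fin, mul_assoc]

lemma tube_fst {n N : ℕ} (i : Fin N) (ρ : ℝ) : ∃ C : ENNReal, C ≠ ⊤ ∧ ∀ η, 0 < η →
    volume {z : ZZ n N | ‖z‖ < ρ ∧ ‖z.1 i‖ < η} ≤ ENNReal.ofReal (η ^ n) * C := by
  obtain ⟨C, hC, h⟩ := tube (n := n) i ρ
  refine ⟨C * volume (Metric.ball (0 : Fin N → Eu n) ρ), ENNReal.mul_ne_top hC measure_ball_lt_top.ne, ?_⟩
  intro η hη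
  have hsub : {z : ZZ n N | ‖z‖ < ρ ∧ ‖z.1 i‖ < η} ⊆
      {x : Fin N → Eu n | ‖x‖ < ρ ∧ ‖x i‖ < η} ×ˢ Metric.ball (0 : Fin N → Eu n) ρ := by
    rintro z hz
    have hz : ‖z‖ < ρ ∧ ‖z.1 i‖ < η := hz
    exact ⟨⟨(norm_fst_le z).trans_lt hz.1, hz.2⟩, mem_ball_zero_iff.2 ((norm_snd_le z).trans_lt hz.1)⟩
  refine (measure_mono hsub).trans ?_
  rw [Measure.volume_eq_prod, Measure.prod_prod, ← mul_assoc]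
  gcongr
  exact h η hη

lemma tube_snd {n N : ℕ} (i : Fin N) (ρ : ℝ) : ∃ C : ENNReal, C ≠ ⊤ ∧ ∀ η, 0 < η →
    volume {z : ZZ n N | ‖z‖ < ρ ∧ ‖z.2 i‖ < η} ≤ ENNReal.ofReal (η ^ n) * C := by
  obtain ⟨C, hC, h⟩ := tube (n := n) i ρ
  refine ⟨C * volume (Metric.ball (0 : Fin N → Eu n) ρ), ENNReal.mul_ne_top hC measure_ball_lt_top.ne, ?_⟩
  intro η hη
  have hsub : {z : ZZ n N | ‖z‖ < ρ ∧ ‖z.2 i‖ < η} ⊆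
      Metric.ball (0 : Fin N → Eu n) ρ ×ˢ {x : Fin N → Eu n | ‖x‖ < ρ ∧ ‖x i‖ < η} := by
    rintro z hz
    have hz : ‖z‖ < ρ ∧ ‖z.2 i‖ < η := hz
    exact ⟨mem_ball_zero_iff.2 ((norm_fst_le z).trans_lt hz.1), ⟨(norm_snd_le z).trans_lt hz.1, hz.2⟩⟩
  refine (measure_mono hsub).trans ?_
  rw [Measure.volume_eq_prod, Measure.prod_prod, mul_comm (volume _), ← mul_assoc]
  gcongr
  exact h η hη

lemma slab_open {n N : ℕ} (i : Fin N) (ρ κ η : ℝ) :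
    IsOpen {z : ZZ n N | ‖z‖ < ρ ∧ κ < ‖z.1 i‖ ∧ |inner ℝ (z.1 i) (z.2 i)| < η} := by
  have h1 : IsOpen {z : ZZ n N | ‖z‖ < ρ} := isOpen_lt continuous_norm continuous_const
  have h2 : IsOpen {z : ZZ n N | κ < ‖z.1 i‖} := isOpen_lt continuous_const (by fun_prop)
  have h3 : IsOpen {z : ZZ n N | |inner ℝ (z.1 i) (z.2 i)| < η} :=
    isOpen_lt (by fun_prop) continuous_const
  exact h1.inter (h2.inter h3)

lemma slab_inner {n N : ℕ} (i : Fin N) (ρ κ : ℝ) (hκ : 0 < κ) : ∃ C : ENNReal, C ≠ ⊤ ∧ ∀ η, 0 < η → η ≤ 1 →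
    volume {z : ZZ n N | ‖z‖ < ρ ∧ κ < ‖z.1 i‖ ∧ |inner ℝ (z.1 i) (z.2 i)| < η} ≤ ENNReal.ofReal η * C := by
  refine ⟨volume (Metric.ball (0 : Fin N → Eu n) (ρ + 4 * (1 / κ))) *
    volume (Metric.ball (0 : Fin N → Eu n) ρ),
    ENNReal.mul_ne_top measure_ball_lt_top.ne measure_ball_lt_top.ne, ?_⟩
  intro η hη hη1
  set A := {z : ZZ n N | ‖z‖ < ρ ∧ κ < ‖z.1 i‖ ∧ |inner ℝ (z.1 i) (z.2 i)| < η} with hA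
  have hAo : IsOpen A := slab_open i ρ κ η
  rw [Measure.volume_eq_prod, Measure.prod_apply hAo.measurableSet]
  have hx : ∀ x : Fin N → Eu n, volume (Prod.mk x ⁻¹' A) ≤
      (Metric.ball (0 : Fin N → Eu n) ρ).indicator
        (fun _ => ENNReal.ofReal η * volume (Metric.ball (0 : Fin N → Eu n) (ρ + 4 * (1 / κ)))) x := by
    intro x
    by_cases hc : ‖x‖ < ρ ∧ κ < ‖x i‖
    · rw [indicator_of_mem (mem_ball_zero_iff.2 hc.1)]
      have hx0 : 0 < ‖x i‖ := hκ.trans hc.2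
      let l : (Fin N → Eu n) →L[ℝ] ℝ := (innerSL ℝ (x i)).comp (ContinuousLinearMap.proj i)
      have hl : ∀ v, l v = inner ℝ (x i) (v i) := fun v => rfl
      refine le_trans (measure_mono ?_) (slab (volume : Measure (Fin N → Eu n)) l
        (Pi.single i ((‖x i‖ ^ 2)⁻¹ • x i)) ?_ ?_ hη hη1)
      · intro v hv
        have hv : ‖(x, v)‖ < ρ ∧ κ < ‖x i‖ ∧ |inner ℝ (x i) (v i)| < η := hv
        exact ⟨(norm_snd_le (x, v)).trans_lt hv.1, hv.2.2⟩
      · rw [hl, Pi.single_eq_same, inner_smul_right, real_inner_self_eq_norm_sq]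
        field_simp
      · rw [Pi.norm_single, norm_smul, norm_inv, norm_pow, norm_norm, pow_two, mul_inv, mul_assoc,
          inv_mul_cancel₀ hx0.ne', mul_one, one_div]
        gcongr
        exact hc.2.le
    · have : Prod.mk x ⁻¹' A = ∅ := by
        ext v
        simp only [mem_empty_iff_false, iff_false]
        intro hv
        have hv : ‖(x, v)‖ < ρ ∧ κ < ‖x i‖ ∧ |inner ℝ (x i) (v i)| < η := hv
        exact hc ⟨(norm_fst_le (x, v)).trans_lt hv.1, hv.2.1⟩
      rw [this, measure_empty]
      exact zero_le
  refine (lintegral_mono hx).trans ?_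
  rw [lintegral_indicator_const Metric.isOpen_ball.measurableSet, mul_assoc]

end CS

namespace CS
open Topology
namespace Sys
variable {n N : ℕ} (S : Sys n)

lemma sol_lip2 {T R : ℝ} {z : ℝ → ZZ n N} (h : IsSol S.fld T z) (hz : ∀ t ∈ Icc 0 T, ‖z t‖ ≤ R) :
    ∀ s ∈ Icc 0 T, ∀ t ∈ Icc 0 T, ‖z t - z s‖ ≤ (R + S.Cacc N * (1 + R)) * |t - s| := by
  intro s hs t ht
  exact (convex_Icc 0 T).norm_image_sub_le_of_norm_hasDerivWithin_le h
    (fun t ht => S.fld_le _ (hz t ht)) hs ht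

lemma q_small {E : Type*} [NormedAddCommGroup E] [NormedSpace ℝ E] (q b : ZZ n N → E)
    (hb : Continuous b) (T ρ : ℝ)
    (hq : ∀ z, IsSol S.fld T z → ∀ t ∈ Icc 0 T,
      HasDerivWithinAt (fun t => q (z t)) (b (z t)) (Icc 0 T) t)
    (ε : ℝ) (hε : 0 < ε) :
    ∃ δ0, 0 < δ0 ∧ ∀ τ, 0 < τ → τ < δ0 → ∀ z, IsSol S.fld T z → (∀ t ∈ Icc 0 T, ‖z t‖ ≤ ρ) →
      ∀ σ ∈ Icc 0 T, q (z σ) = 0 → b (z σ) = 0 → ∀ t ∈ Icc 0 T, |t - σ| ≤ τ → ‖q (z t)‖ ≤ ε * τ := by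
  have huc := (isCompact_closedBall (0 : ZZ n N) ρ).uniformContinuousOn_of_continuous hb.continuousOn
  rw [Metric.uniformContinuousOn_iff] at huc
  obtain ⟨δ, hδ, hδ'⟩ := huc ε hε
  set L := |ρ + S.Cacc N * (1 + ρ)| with hL
  have hL0 : 0 ≤ L := abs_nonneg _
  refine ⟨δ / (L + 1), by positivity, ?_⟩
  intro τ hτ hτδ z hz hzρ σ hσ hqσ hbσ t ht htσ
  rw [lt_div_iff₀ (by positivity)] at hτδ
  set s := Icc 0 T ∩ Icc (σ - τ) (σ + τ) with hs
  have hconv : Convex ℝ s := (convex_Icc _ _).inter (convex_Icc _ _)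
  have hσs : σ ∈ s := ⟨hσ, by linarith, by linarith⟩
  have hts : t ∈ s := ⟨ht, by linarith [(abs_le.1 htσ).1], by linarith [(abs_le.1 htσ).2]⟩
  have hbd : ∀ u ∈ s, ‖b (z u)‖ ≤ ε := by
    intro u hu
    have hut : |u - σ| ≤ τ := abs_le.2 ⟨by linarith [hu.2.1], by linarith [hu.2.2]⟩
    have h1 := S.sol_lip2 hz hzρ σ hσ u hu.1
    have h2 : ‖z u - z σ‖ < δ := by
      have : (ρ + S.Cacc N * (1 + ρ)) * |u - σ| ≤ L * τ :=
        mul_le_mul (le_abs_self _) hut (abs_nonneg _) hL0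
      nlinarith
    have h3 := hδ' (z u) (mem_closedBall_zero_iff.2 (hzρ u hu.1)) (z σ)
      (mem_closedBall_zero_iff.2 (hzρ σ hσ)) (by rwa [dist_eq_norm])
    rw [hbσ, dist_zero_right] at h3
    exact h3.le
  have := hconv.norm_image_sub_le_of_norm_hasDerivWithin_le
    (fun u hu => (hq z hz u hu.1).mono inter_subset_left) hbd hσs hts
  rw [hqσ, sub_zero] at this
  exact this.trans (by rw [Real.norm_eq_abs]; gcongr)

/-- thin sets -/
def Thin (Sg : Set (ZZ n N)) : Prop := ∀ ρ T ε : ℝ, 0 < ε → ∃ τ, 0 < τ ∧ τ ≤ 1 ∧ ∃ B : Set (ZZ n N),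
  IsOpen B ∧ volume B ≤ ENNReal.ofReal (ε * τ) ∧ ∀ z, IsSol S.fld T z →
    (∀ t ∈ Icc 0 T, ‖z t‖ ≤ ρ) → ∀ σ ∈ Icc 0 T, z σ ∈ Sg → ∀ t ∈ Icc 0 T, |t - σ| ≤ τ → z t ∈ B

lemma mul_bd {C : ENNReal} (hC : C ≠ ⊤) {a b : ℝ} (ha : 0 ≤ a) (h : a * (C.toReal + 1) ≤ b) :
    ENNReal.ofReal a * C ≤ ENNReal.ofReal b := by
  rw [← ENNReal.ofReal_toReal hC, ← ENNReal.ofReal_mul ha]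
  refine ENNReal.ofReal_le_ofReal ?_
  linarith

lemma acci_cont (i : Fin N) : Continuous (fun z : ZZ n N => S.acc z i) :=
  (continuous_apply i).comp S.acc_cont

lemma thin_v (hn : n = 1) (i : Fin N) : S.Thin {z : ZZ n N | z.2 i = 0 ∧ S.acc z i = 0} := by
  intro ρ T ε hε
  obtain ⟨C, hC, hCv⟩ := tube_snd (n := n) i (ρ + 1)
  set c := C.toReal + 1 with hc
  have hc0 : 0 < c := by have := ENNReal.toReal_nonneg (a := C); linarith
  obtain ⟨δ0, hδ0, hsm⟩ := S.q_small (fun z => z.2 i) (fun z => S.acc z i) (S.acci_cont i) T ρ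
    (fun z hz => S.sol_v hz i) (ε / c / 2) (by positivity)
  set τ := min 1 (δ0 / 2) with hτd
  have hτ : 0 < τ := lt_min one_pos (by positivity)
  have hτδ : τ < δ0 := (min_le_right _ _).trans_lt (by linarith)
  refine ⟨τ, hτ, min_le_left _ _, {z : ZZ n N | ‖z‖ < ρ + 1 ∧ ‖z.2 i‖ < ε / c * τ}, ?_, ?_, ?_⟩
  · have h1 : IsOpen {z : ZZ n N | ‖z‖ < ρ + 1} := isOpen_lt continuous_norm continuous_const
    have h2 : IsOpen {z : ZZ n N | ‖z.2 i‖ < ε / c * τ} := isOpen_lt (by fun_prop) continuous_const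
    exact h1.inter h2
  · refine (hCv _ (by positivity)).trans (mul_bd hC (by positivity) ?_)
    rw [hn, pow_one, ← hc]
    apply le_of_eq; field_simp
  · intro z hz hzρ σ hσ hσS t ht htσ
    have hσS : (z σ).2 i = 0 ∧ S.acc (z σ) i = 0 := hσS
    have := hsm τ hτ hτδ z hz hzρ σ hσ hσS.1 hσS.2 t ht htσ
    have h0 : 0 < ε / c * τ := by positivity
    refine ⟨by linarith [hzρ t ht], ?_⟩
    nlinarith

lemma thin_x (hn : 2 ≤ n) (i : Fin N) : S.Thin {z : ZZ n N | z.1 i = 0} := by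
  intro ρ T ε hε
  obtain ⟨C, hC, hCv⟩ := tube_fst (n := n) i (ρ + 1)
  set c := C.toReal + 1 with hc
  have hc0 : 0 < c := by have := ENNReal.toReal_nonneg (a := C); linarith
  set L := |ρ + S.Cacc N * (1 + ρ)| + 1 with hL
  have hL0 : 0 < L := by positivity
  set τ := min 1 (min (1 / L) (ε / (L ^ 2 * c))) with hτd
  have hτ : 0 < τ := lt_min one_pos (lt_min (by positivity) (by positivity))
  have hτ1 : τ * L ≤ 1 := by
    have : τ ≤ 1 / L := (min_le_right _ _).trans (min_le_left _ _)
    rwa [le_div_iff₀ hL0] at this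
  have hτ2 : τ * (L ^ 2 * c) ≤ ε := by
    have : τ ≤ ε / (L ^ 2 * c) := (min_le_right _ _).trans (min_le_right _ _)
    rwa [le_div_iff₀ (by positivity)] at this
  refine ⟨τ, hτ, min_le_left _ _, {z : ZZ n N | ‖z‖ < ρ + 1 ∧ ‖z.1 i‖ < τ * L}, ?_, ?_, ?_⟩
  · have h1 : IsOpen {z : ZZ n N | ‖z‖ < ρ + 1} := isOpen_lt continuous_norm continuous_const
    have h2 : IsOpen {z : ZZ n N | ‖z.1 i‖ < τ * L} := isOpen_lt (by fun_prop) continuous_const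
    exact h1.inter h2
  · refine (hCv _ (by positivity)).trans (mul_bd hC (by positivity) ?_)
    rw [← hc]
    have : (τ * L) ^ n ≤ (τ * L) ^ 2 := pow_le_pow_of_le_one (by positivity) hτ1 hn
    calc (τ * L) ^ n * c ≤ (τ * L) ^ 2 * c := by gcongr
      _ = (τ * (L ^ 2 * c)) * τ := by ring
      _ ≤ _ := by gcongr
  · intro z hz hzρ σ hσ hσS t ht htσ
    have hσS : (z σ).1 i = 0 := hσS
    have h1 := S.sol_lip2 hz hzρ σ hσ t ht
    have h2 : ‖(z t).1 i - (z σ).1 i‖ ≤ ‖z t - z σ‖ :=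
      (norm_le_pi_norm (z t - z σ).1 i).trans (norm_fst_le (z t - z σ))
    rw [hσS, sub_zero] at h2
    have h3 : (ρ + S.Cacc N * (1 + ρ)) * |t - σ| ≤ |ρ + S.Cacc N * (1 + ρ)| * τ :=
      mul_le_mul (le_abs_self _) htσ (abs_nonneg _) (abs_nonneg _)
    refine ⟨by linarith [hzρ t ht], ?_⟩
    rw [hL]; nlinarith

lemma thin_q (i : Fin N) (κ : ℝ) (hκ : 0 < κ) : S.Thin {z : ZZ n N | κ < ‖z.1 i‖ ∧
    inner ℝ (z.1 i) (z.2 i) = 0 ∧ ‖z.2 i‖ ^ 2 + inner ℝ (z.1 i) (S.acc z i) = 0} := by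
  intro ρ T ε hε
  obtain ⟨C, hC, hCv⟩ := slab_inner (n := n) i (ρ + 1) (κ / 2) (by positivity)
  set c := C.toReal + 1 with hc
  have hc0 : 0 < c := by have := ENNReal.toReal_nonneg (a := C); linarith
  have hac := S.acci_cont i
  obtain ⟨δ0, hδ0, hsm⟩ := S.q_small (fun z => (inner ℝ (z.1 i) (z.2 i) : ℝ))
    (fun z => ‖z.2 i‖ ^ 2 + inner ℝ (z.1 i) (S.acc z i)) (by fun_prop) T ρ
    (fun z hz t ht => by
      have := (S.sol_x hz i t ht).inner ℝ (S.sol_v hz i t ht)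
      refine this.congr_deriv ?_
      rw [real_inner_self_eq_norm_sq]; ring) (ε / c / 2) (by positivity)
  set L := |ρ + S.Cacc N * (1 + ρ)| + 1 with hL
  have hL0 : 0 < L := by positivity
  set τ := min 1 (min (δ0 / 2) (min (κ / 2 / L) (c / ε))) with hτd
  have hτ : 0 < τ := lt_min one_pos (lt_min (by positivity) (lt_min (by positivity) (by positivity)))
  have hτδ : τ < δ0 := ((min_le_right _ _).trans (min_le_left _ _)).trans_lt (by linarith)
  have hτ1 : τ * L ≤ κ / 2 := by
    have : τ ≤ κ / 2 / L := (min_le_right _ _).trans ((min_le_right _ _).trans (min_le_left _ _))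
    rwa [le_div_iff₀ hL0] at this
  have hτ2 : ε / c * τ ≤ 1 := by
    have : τ ≤ c / ε := (min_le_right _ _).trans ((min_le_right _ _).trans (min_le_right _ _))
    calc ε / c * τ ≤ ε / c * (c / ε) := by gcongr
      _ = 1 := by field_simp
  refine ⟨τ, hτ, min_le_left _ _, {z : ZZ n N | ‖z‖ < ρ + 1 ∧ κ / 2 < ‖z.1 i‖ ∧
    |inner ℝ (z.1 i) (z.2 i)| < ε / c * τ}, slab_open _ _ _ _, ?_, ?_⟩
  · refine (hCv _ (by positivity) hτ2).trans (mul_bd hC (by positivity) ?_)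
    rw [← hc]
    apply le_of_eq; field_simp
  · intro z hz hzρ σ hσ hσS t ht htσ
    have hσS : κ < ‖(z σ).1 i‖ ∧ inner ℝ ((z σ).1 i) ((z σ).2 i) = 0 ∧
      ‖(z σ).2 i‖ ^ 2 + inner ℝ ((z σ).1 i) (S.acc (z σ) i) = 0 := hσS
    have := hsm τ hτ hτδ z hz hzρ σ hσ hσS.2.1 hσS.2.2 t ht htσ
    have h1 := S.sol_lip2 hz hzρ σ hσ t ht
    have h2 : ‖(z t).1 i - (z σ).1 i‖ ≤ ‖z t - z σ‖ :=
      (norm_le_pi_norm (z t - z σ).1 i).trans (norm_fst_le (z t - z σ))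
    have h3 : (ρ + S.Cacc N * (1 + ρ)) * |t - σ| ≤ |ρ + S.Cacc N * (1 + ρ)| * τ :=
      mul_le_mul (le_abs_self _) htσ (abs_nonneg _) (abs_nonneg _)
    have h4 : ‖(z σ).1 i‖ ≤ ‖(z t).1 i‖ + ‖(z t).1 i - (z σ).1 i‖ := by
      have := norm_sub_le ((z t).1 i) ((z t).1 i - (z σ).1 i)
      simpa using this
    have h0 : 0 < ε / c * τ := by positivity
    refine ⟨by linarith [hzρ t ht], ?_, ?_⟩
    · have : |ρ + S.Cacc N * (1 + ρ)| * τ ≤ τ * L := by rw [hL]; nlinarith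
      linarith [hσS.1]
    · rw [Real.norm_eq_abs] at this
      nlinarith

/-- unique solution -/
def Uq (T : ℝ) (x : ℝ → ZZ n N) : Prop := IsSol S.fld T x ∧
  ∀ y, IsSol S.fld T y → y 0 = x 0 → ∀ t ∈ Icc 0 T, y t = x t

lemma grid (N : ℕ) (h0 : ℝ) (hh : 0 < h0) : ∃ p : ℕ, 1 ≤ p ∧ ∀ m : ℕ, 0 < h0 / (m + p : ℕ) ∧
    h0 / (m + p : ℕ) ≤ 1 ∧ 4 * (h0 / (m + p : ℕ) * S.pmax N) ≤ 1 := by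
  have hp := S.pmax_nonneg (N := N)
  refine ⟨⌈h0⌉₊ + ⌈4 * h0 * S.pmax N⌉₊ + 1, by omega, fun m => ?_⟩
  have h1 := Nat.le_ceil h0
  have h2 := Nat.le_ceil (4 * h0 * S.pmax N)
  set q : ℝ := ((m + (⌈h0⌉₊ + ⌈4 * h0 * S.pmax N⌉₊ + 1) : ℕ) : ℝ) with hq
  have hq' : q = m + (⌈h0⌉₊ + ⌈4 * h0 * S.pmax N⌉₊ + 1) := by rw [hq]; push_cast; ring
  have hm : (0 : ℝ) ≤ m := Nat.cast_nonneg _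
  have hq1 : 0 < q := by rw [hq']; positivity
  have hc1 : (0 : ℝ) ≤ ⌈h0⌉₊ := Nat.cast_nonneg _
  have hc2 : (0 : ℝ) ≤ ⌈4 * h0 * S.pmax N⌉₊ := Nat.cast_nonneg _
  refine ⟨by positivity, ?_, ?_⟩
  · rw [div_le_one hq1, hq']; linarith
  · rw [div_mul_eq_mul_div, ← mul_div_assoc, div_le_one hq1, hq']; linarith

lemma grid_lim (h0 : ℝ) (p : ℕ) : Tendsto (fun m : ℕ => h0 / (m + p : ℕ)) atTop (𝓝 0) := by
  refine Tendsto.div_atTop tendsto_const_nhds ?_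
  exact tendsto_natCast_atTop_atTop.comp (tendsto_add_atTop_nat p)

lemma conv_step {h0 : ℝ} {p : ℕ} (hp : ∀ m : ℕ, 0 < h0 / (m + p : ℕ) ∧
    h0 / (m + p : ℕ) ≤ 1 ∧ 4 * (h0 / (m + p : ℕ) * S.pmax N) ≤ 1) {T : ℝ} {x : ℝ → ZZ n N}
    (hx : S.Uq T x) (ε : ℝ) (hε : 0 < ε) : ∀ᶠ m : ℕ in atTop, ∀ k : ℕ, k * (h0 / (m + p : ℕ)) ≤ T →
      ‖(S.step (h0 / (m + p : ℕ)))^[k] (x 0) - x (k * (h0 / (m + p : ℕ)))‖ ≤ ε := by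
  have hC := S.Cacc_nonneg (N := N)
  refine conv S.fld S.fld_cont (fun m => S.step (h0 / (m + p : ℕ))) (fun m => h0 / (m + p : ℕ))
    (fun m => (hp m).1) (grid_lim h0 p) (S.Cst N) (by unfold Cst; linarith)
    (fun m z => S.step_grow z (hp m).1.le (hp m).2.1) ?_ T (x 0) x hx.1 hx.2 ε hε
  intro R ε hε
  have hlim := (grid_lim h0 p).mul_const (S.Cacc N * (1 + |R|))
  rw [zero_mul] at hlim
  filter_upwards [hlim.eventually (eventually_le_nhds hε)] with m hm z hz
  refine (S.step_cons z (hp m).1.le).trans ?_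
  refine mul_le_mul_of_nonneg_right (le_trans ?_ hm) (hp m).1.le
  have := (hp m).1.le
  have : ‖z‖ ≤ |R| := hz.trans (le_abs_self _)
  gcongr

/-- transport of sets by the unique flow -/
lemma transport (T : ℝ) (hT : 0 ≤ T) (B : Set (ZZ n N)) (hB : IsOpen B)
    (P : Set (ZZ n N)) (x : ZZ n N → ℝ → ZZ n N) (hP : ∀ d ∈ P, x d 0 = d ∧ S.Uq T (x d) ∧ x d T ∈ B) :
    volume P ≤ ENNReal.ofReal (Real.exp (Kd n N * (T * S.pmax N))) * volume B := by
  rcases hT.eq_or_lt with h | hT0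
  · subst h
    rw [zero_mul, mul_zero, Real.exp_zero, ENNReal.ofReal_one, one_mul]
    refine measure_mono fun d hd => ?_
    obtain ⟨h1, _, h2⟩ := hP d hd
    rwa [h1] at h2
  obtain ⟨p, hp1, hp⟩ := S.grid N T hT0
  set A : ℕ → Set (ZZ n N) := fun M => {d | ∀ m ≥ M, (S.step (T / (m + p : ℕ)))^[m + p] d ∈ B} with hA
  have hmono : Monotone A := by
    intro a b hab d hd m hm
    exact hd m (hab.trans hm)
  have hsub : P ⊆ ⋃ M, A M := by
    intro d hd
    obtain ⟨h1, h2, h3⟩ := hP d hd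
    obtain ⟨ε, hε, hεB⟩ := Metric.isOpen_iff.1 hB _ h3
    have := S.conv_step hp h2 (ε / 2) (by positivity)
    obtain ⟨M, hM⟩ := eventually_atTop.1 this
    refine mem_iUnion.2 ⟨M, fun m hm => hεB ?_⟩
    have hmp : ((m + p : ℕ) : ℝ) ≠ 0 := by
      have : 0 < m + p := by omega
      positivity
    have e : ((m + p : ℕ) : ℝ) * (T / (m + p : ℕ)) = T := by field_simp
    have := hM m hm (m + p) (by rw [e])
    rw [e, h1] at this
    rw [Metric.mem_ball, dist_eq_norm]
    linarith
  refine (measure_mono hsub).trans ?_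
  rw [hmono.measure_iUnion]
  refine iSup_le fun M => ?_
  refine S.vol_le (hp M).1 (hp M).2.2 (M + p) _ _ _ hB.measurableSet ?_ (fun z hz => hz M le_rfl)
  intro z _
  have hmp : ((M + p : ℕ) : ℝ) ≠ 0 := by
    have : 0 < M + p := by omega
    positivity
  calc _ ≤ T / (M + p : ℕ) * ∑ j ∈ Finset.range (M + p), S.pmax N := by
        have := (hp M).1.le
        gcongr
        exact S.Phi_le _
    _ = _ := by
        rw [Finset.sum_const, Finset.card_range, nsmul_eq_mul, ← mul_assoc]
        congr 1
        field_simp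

lemma Uq_mono {T T' : ℝ} (h : T' ≤ T) (hT' : 0 ≤ T') {x : ℝ → ZZ n N} (hx : IsSol S.fld T x)
    (hr : ∀ t ∈ Ico 0 T', ∀ i, S.Reg (x t) i) : S.Uq T' x :=
  ⟨hx.mono h, fun _ hy h0 => S.uniq_of_avoid hy (hx.mono h) h0 hr⟩

end Sys
end CS

namespace CS
open Topology
namespace Sys
variable {n N : ℕ} (S : Sys n)

lemma hit_null (Sg : Set (ZZ n N)) (hSg : S.Thin Sg) (T ρ : ℝ) (x : ZZ n N → ℝ → ZZ n N)
    (P : Set (ZZ n N))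
    (hP : ∀ d ∈ P, x d 0 = d ∧ IsSol S.fld T (x d) ∧ ∀ t ∈ Icc 0 T, ‖x d t‖ ≤ ρ)
    (hhit : ∀ d ∈ P, ∃ σ ∈ Icc 0 T, x d σ ∈ Sg ∧ ∀ t ∈ Ico 0 σ, ∀ i, S.Reg (x d t) i) :
    volume P = 0 := by
  rcases P.eq_empty_or_nonempty with rfl | ⟨d0, hd0⟩
  · exact measure_empty
  have hT : 0 ≤ T := by
    obtain ⟨σ, hσ, _⟩ := hhit d0 hd0
    exact hσ.1.trans hσ.2
  set E := Real.exp (Kd n N * (T * S.pmax N)) with hE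
  have hE0 : 0 < E := Real.exp_pos _
  have hpm := S.pmax_nonneg (N := N)
  have hK0 : 0 ≤ Kd n N := by unfold Kd; positivity
  have key : ∀ η : ℝ, 0 < η → volume P ≤ ENNReal.ofReal η := by
    intro η hη
    obtain ⟨τ, hτ, hτ1, B, hB, hBv, hBz⟩ := hSg ρ T (η / (E * (T + 1))) (by positivity)
    set K := ⌊T / τ⌋₊ + 1 with hK
    set Q : ℕ → Set (ZZ n N) := fun j =>
      {d | d ∈ P ∧ j * τ ≤ T ∧ S.Uq (j * τ) (x d) ∧ x d (j * τ) ∈ B} with hQ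
    have hsub : P ⊆ ⋃ j ∈ Finset.range K, Q j := by
      intro d hd
      obtain ⟨h1, h2, h3⟩ := hP d hd
      obtain ⟨σ, hσ, hσS, hσr⟩ := hhit d hd
      have f1 : (⌊σ / τ⌋₊ : ℝ) * τ ≤ σ := by
        have := Nat.floor_le (div_nonneg hσ.1 hτ.le)
        rwa [le_div_iff₀ hτ] at this
      have f2 : σ < (⌊σ / τ⌋₊ + 1 : ℝ) * τ := by
        have := Nat.lt_floor_add_one (σ / τ)
        rwa [div_lt_iff₀ hτ] at this
      have f3 : (0 : ℝ) ≤ (⌊σ / τ⌋₊ : ℝ) * τ := by positivity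
      refine mem_iUnion₂.2 ⟨⌊σ / τ⌋₊, ?_, hd, f1.trans hσ.2, ?_, ?_⟩
      · rw [Finset.mem_range, hK, Nat.lt_succ_iff]
        exact Nat.floor_le_floor (div_le_div_of_nonneg_right hσ.2 hτ.le)
      · exact S.Uq_mono (f1.trans hσ.2) f3 h2 (fun t ht => hσr t ⟨ht.1, ht.2.trans_le f1⟩)
      · refine hBz (x d) h2 h3 σ hσ hσS _ ⟨f3, f1.trans hσ.2⟩ ?_
        rw [abs_le]; constructor <;> nlinarith
    have hQv : ∀ j, volume (Q j) ≤ ENNReal.ofReal (E * (η / (E * (T + 1)) * τ)) := by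
      intro j
      by_cases hj : (j : ℝ) * τ ≤ T
      · refine (S.transport (j * τ) (by positivity) B hB (Q j) x (fun d hd => ?_)).trans ?_
        · have hd : d ∈ P ∧ j * τ ≤ T ∧ S.Uq (j * τ) (x d) ∧ x d (j * τ) ∈ B := hd
          exact ⟨(hP d hd.1).1, hd.2.2.1, hd.2.2.2⟩
        · rw [ENNReal.ofReal_mul hE0.le]
          gcongr
          rw [hE]
          gcongr
      · have : Q j = ∅ := by
          ext d
          simp only [mem_empty_iff_false, iff_false]
          intro hd
          have hd : d ∈ P ∧ j * τ ≤ T ∧ S.Uq (j * τ) (x d) ∧ x d (j * τ) ∈ B := hd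
          exact hj hd.2.1
        rw [this, measure_empty]; exact zero_le
    calc volume P ≤ ∑ j ∈ Finset.range K, volume (Q j) :=
          (measure_mono hsub).trans (measure_biUnion_finset_le _ _)
      _ ≤ ∑ j ∈ Finset.range K, ENNReal.ofReal (E * (η / (E * (T + 1)) * τ)) :=
          Finset.sum_le_sum fun j _ => hQv j
      _ = ENNReal.ofReal (K * (E * (η / (E * (T + 1)) * τ))) := by
          rw [Finset.sum_const, Finset.card_range, nsmul_eq_mul, ENNReal.ofReal_mul (p := (K : ℝ)) (by positivity),
            ENNReal.ofReal_natCast]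
      _ ≤ _ := by
          refine ENNReal.ofReal_le_ofReal ?_
          have f1 : (⌊T / τ⌋₊ : ℝ) * τ ≤ T := by
            have := Nat.floor_le (div_nonneg hT hτ.le)
            rwa [le_div_iff₀ hτ] at this
          have f2 : (K : ℝ) * τ ≤ T + 1 := by rw [hK]; push_cast; linarith
          calc (K : ℝ) * (E * (η / (E * (T + 1)) * τ)) = (K * τ) * (η / (T + 1)) := by
                field_simp
            _ ≤ (T + 1) * (η / (T + 1)) := by gcongr
            _ = η := by field_simp
  refine le_antisymm (ENNReal.le_of_forall_pos_le_add fun ε hε _ => ?_) zero_le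
  have := key ε hε
  rwa [zero_add, ← ENNReal.ofReal_coe_nnreal]

lemma reg_open (i : Fin N) : IsOpen {z : ZZ n N | S.Reg z i} := by
  have hac := S.acci_cont i
  have h1 : IsOpen {z : ZZ n N | z.2 i ≠ 0} := isOpen_ne_fun (by fun_prop) continuous_const
  have h2 : IsOpen {z : ZZ n N | S.acc z i ≠ 0} := isOpen_ne_fun hac continuous_const
  have h3 : IsOpen {z : ZZ n N | z.1 i ≠ 0} := isOpen_ne_fun (by fun_prop) continuous_const
  have h4 : IsOpen {z : ZZ n N | inner ℝ (z.1 i) (z.2 i) ≠ (0 : ℝ)} :=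
    isOpen_ne_fun (by fun_prop) continuous_const
  have h5 : IsOpen {z : ZZ n N | ‖z.2 i‖ ^ 2 + inner ℝ (z.1 i) (S.acc z i) ≠ (0 : ℝ)} :=
    isOpen_ne_fun (by fun_prop) continuous_const
  have h6 : IsOpen {_z : ZZ n N | n = 1} := isOpen_const
  exact (h6.inter (h1.union h2)).union (h3.inter (h4.union h5))

lemma avoid_null (hn : 1 ≤ n) (T ρ : ℝ) (x : ZZ n N → ℝ → ZZ n N) (P : Set (ZZ n N))
    (hP : ∀ d ∈ P, x d 0 = d ∧ IsSol S.fld T (x d) ∧ ∀ t ∈ Icc 0 T, ‖x d t‖ ≤ ρ)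
    (hhit : ∀ d ∈ P, ∃ t ∈ Icc 0 T, ∃ i, ¬ S.Reg (x d t) i) :
    volume P = 0 := by
  have hfirst : ∀ d ∈ P, ∃ σ ∈ Icc 0 T, (∃ i, ¬ S.Reg (x d σ) i) ∧
      ∀ t ∈ Ico 0 σ, ∀ i, S.Reg (x d t) i := by
    intro d hd
    obtain ⟨h1, h2, h3⟩ := hP d hd
    have hcl : IsClosed {z : ZZ n N | ∃ i, ¬ S.Reg z i} := by
      have : {z : ZZ n N | ∃ i, ¬ S.Reg z i} = ⋃ i, {z | S.Reg z i}ᶜ := by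
        ext z; rw [mem_iUnion]; rfl
      rw [this]
      exact isClosed_iUnion_of_finite fun i => (S.reg_open i).isClosed_compl
    have hK := (h2.cont.preimage_isClosed_of_isClosed isClosed_Icc hcl)
    have hKc : IsCompact (Icc 0 T ∩ x d ⁻¹' {z : ZZ n N | ∃ i, ¬ S.Reg z i}) :=
      isCompact_Icc.of_isClosed_subset hK inter_subset_left
    obtain ⟨t, ht, hti⟩ := hhit d hd
    obtain ⟨σ, hσ, hσm⟩ := hKc.exists_isLeast ⟨t, ht, hti⟩
    refine ⟨σ, hσ.1, hσ.2, fun t ht i => ?_⟩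
    by_contra hc
    have := hσm ⟨⟨ht.1, ht.2.le.trans hσ.1.2⟩, ⟨i, hc⟩⟩
    linarith [ht.2]
  -- countable cover
  rcases (by omega : n = 1 ∨ 2 ≤ n) with hn1 | hn2
  · have hsub : P ⊆ ⋃ i : Fin N, {d | d ∈ P ∧ ∃ σ ∈ Icc 0 T,
        x d σ ∈ {z : ZZ n N | z.2 i = 0 ∧ S.acc z i = 0} ∧ ∀ t ∈ Ico 0 σ, ∀ i, S.Reg (x d t) i} := by
      intro d hd
      obtain ⟨σ, hσ, ⟨i, hi⟩, hr⟩ := hfirst d hd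
      refine mem_iUnion.2 ⟨i, hd, σ, hσ, ?_, hr⟩
      unfold Reg at hi
      push Not at hi
      exact hi.1 hn1
    refine measure_mono_null hsub (measure_iUnion_null fun i => ?_)
    exact S.hit_null _ (S.thin_v hn1 i) T ρ x _ (fun d hd => hP d hd.1) (fun d hd => hd.2)
  · have hsub : P ⊆ (⋃ i : Fin N, {d | d ∈ P ∧ ∃ σ ∈ Icc 0 T,
        x d σ ∈ {z : ZZ n N | z.1 i = 0} ∧ ∀ t ∈ Ico 0 σ, ∀ i, S.Reg (x d t) i}) ∪
        ⋃ i : Fin N, ⋃ k : ℕ, {d | d ∈ P ∧ ∃ σ ∈ Icc 0 T,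
        x d σ ∈ {z : ZZ n N | 1 / ((k : ℝ) + 1) < ‖z.1 i‖ ∧
          inner ℝ (z.1 i) (z.2 i) = 0 ∧ ‖z.2 i‖ ^ 2 + inner ℝ (z.1 i) (S.acc z i) = 0} ∧
          ∀ t ∈ Ico 0 σ, ∀ i, S.Reg (x d t) i} := by
      intro d hd
      obtain ⟨σ, hσ, ⟨i, hi⟩, hr⟩ := hfirst d hd
      unfold Reg at hi
      push Not at hi
      by_cases h0 : (x d σ).1 i = 0
      · exact Or.inl (mem_iUnion.2 ⟨i, hd, σ, hσ, h0, hr⟩)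
      · obtain ⟨k, hk⟩ := exists_nat_one_div_lt (norm_pos_iff.2 h0)
        refine Or.inr (mem_iUnion.2 ⟨i, mem_iUnion.2 ⟨k, hd, σ, hσ, ⟨hk, ?_⟩, hr⟩⟩)
        exact hi.2 h0
    refine measure_mono_null hsub (measure_union_null (measure_iUnion_null fun i => ?_)
      (measure_iUnion_null fun i => measure_iUnion_null fun k => ?_))
    · exact S.hit_null _ (S.thin_x hn2 i) T ρ x _ (fun d hd => hP d hd.1) (fun d hd => hd.2)
    · exact S.hit_null _ (S.thin_q i (1 / ((k : ℝ) + 1)) (by positivity)) T ρ x _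
        (fun d hd => hP d hd.1) (fun d hd => hd.2)

end Sys
end CS

namespace CS
open Topology
namespace Sys
variable {n N : ℕ} (S : Sys n)

lemma rec_count {h δ M R : ℝ} (h0 : 0 < h) (hs : 4 * (h * S.pmax N) ≤ 1) (hδ : 0 < δ) (hM : 0 ≤ M)
    (q nb : ℕ) (D : Set (ZZ n N)) (hDm : MeasurableSet D)
    (hR : ∀ z ∈ D, ∀ l < nb, ‖(S.step h)^[l] z‖ < R)
    (hsum : ∀ z ∈ D, h * ∑ j ∈ Finset.range (q + nb), S.Phi ((S.step h)^[j] z) ≤ M)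
    (hq : ∀ z ∈ D, δ ≤ S.Phi ((S.step h)^[q] z)) :
    (nb : ENNReal) * volume D ≤ ENNReal.ofReal (Real.exp (Kd n N * M)) *
      (ENNReal.ofReal (M / (h * δ)) * volume (Metric.ball (0 : ZZ n N) R)) := by
  classical
  set f := S.step h (N := N) with hf
  have hfc : Continuous f := S.step_cont h
  have hfi : Function.Injective f := S.step_inj h0 hs
  have himg : ∀ l, MeasurableSet (f^[l] '' D) := fun l =>
    hDm.image_of_continuousOn_injOn (hfc.iterate l).continuousOn (hfi.iterate l).injOn
  have h1 : ∀ l ∈ Finset.range nb, volume D ≤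
      ENNReal.ofReal (Real.exp (Kd n N * M)) * volume (f^[l] '' D) := by
    intro l hl
    have hl : l < nb := Finset.mem_range.1 hl
    refine S.vol_le h0 hs l M D _ (himg l) (fun z hz => ?_) (fun z hz => mem_image_of_mem _ hz)
    refine le_trans ?_ (hsum z hz)
    refine mul_le_mul_of_nonneg_left ?_ h0.le
    refine Finset.sum_le_sum_of_subset_of_nonneg ?_ (fun _ _ _ => S.Phi_nonneg _)
    exact Finset.range_subset_range.2 (by omega)
  have h2 : (nb : ENNReal) * volume D ≤ ENNReal.ofReal (Real.exp (Kd n N * M)) *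
      ∑ l ∈ Finset.range nb, volume (f^[l] '' D) := by
    calc (nb : ENNReal) * volume D = ∑ l ∈ Finset.range nb, volume D := by simp
      _ ≤ _ := by rw [Finset.mul_sum]; exact Finset.sum_le_sum h1
  refine h2.trans ?_
  gcongr
  have h3 : ∑ l ∈ Finset.range nb, volume (f^[l] '' D) =
      ∫⁻ y, ∑ l ∈ Finset.range nb, (f^[l] '' D).indicator (fun _ => (1 : ENNReal)) y := by
    rw [lintegral_finsetSum _ (fun l _ => measurable_const.indicator (himg l))]
    refine Finset.sum_congr rfl fun l _ => ?_
    rw [lintegral_indicator_const (himg l), one_mul]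
  rw [h3, ← lintegral_indicator_const Metric.isOpen_ball.measurableSet]
  refine lintegral_mono fun y => ?_
  set A := (Finset.range nb).filter (fun l => y ∈ f^[l] '' D) with hA
  have hcard : ∑ l ∈ Finset.range nb, (f^[l] '' D).indicator (fun _ => (1 : ENNReal)) y = A.card := by
    simp [indicator_apply, hA, Finset.sum_ite]
  simp only
  rw [hcard]
  rcases A.eq_empty_or_nonempty with hAe | hAne
  · rw [hAe]; simp
  set L := A.max' hAne with hL
  have hLA : L ∈ A := A.max'_mem hAne
  rw [hA, Finset.mem_filter, Finset.mem_range] at hLA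
  obtain ⟨hLn, d, hd, hdy⟩ := hLA
  have hyR : y ∈ Metric.ball (0 : ZZ n N) R := by
    rw [mem_ball_zero_iff, ← hdy]; exact hR d hd L hLn
  rw [indicator_of_mem hyR, ← ENNReal.ofReal_natCast]
  refine ENNReal.ofReal_le_ofReal ?_
  rw [le_div_iff₀ (by positivity)]
  have h4 : ∀ l ∈ A, δ ≤ S.Phi (f^[q + (L - l)] d) := by
    intro l hl
    have hlL : l ≤ L := A.le_max' l hl
    rw [hA, Finset.mem_filter] at hl
    obtain ⟨_, e, he, hey⟩ := hl
    have : e = f^[L - l] d := by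
      apply hfi.iterate l
      rw [hey, ← hdy, ← Function.iterate_add_apply]
      congr 2; omega
    rw [Function.iterate_add_apply, ← this]
    exact hq e he
  have h5 : (A.card : ℝ) * δ ≤ ∑ l ∈ A, S.Phi (f^[q + (L - l)] d) := by
    have := Finset.sum_le_sum h4
    simpa using this
  have hinj : Set.InjOn (fun l => q + (L - l)) (A : Set ℕ) := by
    intro a ha b hb hab
    have ha : a ≤ L := A.le_max' a ha
    have hb : b ≤ L := A.le_max' b hb
    simp only at hab
    omega
  have h6 : ∑ l ∈ A, S.Phi (f^[q + (L - l)] d) ≤ ∑ j ∈ Finset.range (q + nb), S.Phi (f^[j] d) := by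
    rw [← Finset.sum_image (f := fun j => S.Phi (f^[j] d)) hinj]
    refine Finset.sum_le_sum_of_subset_of_nonneg ?_ (fun _ _ _ => S.Phi_nonneg _)
    intro j hj
    obtain ⟨l, hl, rfl⟩ := Finset.mem_image.1 hj
    rw [Finset.mem_range]; omega
  have h7 := hsum d hd
  have h8 : h * ((A.card : ℝ) * δ) ≤ h * ∑ j ∈ Finset.range (q + nb), S.Phi (f^[j] d) :=
    mul_le_mul_of_nonneg_left (h5.trans h6) h0.le
  linarith

/-- Lipschitz constant of `Phi` -/
noncomputable def Lp (N : ℕ) : ℝ := N * (N * (S.Lφ * 2))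

lemma Lp_nonneg : 0 ≤ S.Lp N := by
  have : (0 : ℝ) ≤ S.Lφ := S.Lφ.2
  unfold Lp; positivity

lemma Phi_lip (a b : ZZ n N) : |S.Phi a - S.Phi b| ≤ S.Lp N * ‖a - b‖ := by
  have hLn : (0 : ℝ) ≤ S.Lφ := S.Lφ.2
  have h1 : ∀ i, ‖a.1 i - b.1 i‖ ≤ ‖a - b‖ := fun i =>
    (norm_le_pi_norm (a - b).1 i).trans (norm_fst_le (a - b))
  have e3 : ∀ i j, ‖S.φ (a.1 i - a.1 j) - S.φ (b.1 i - b.1 j)‖ ≤ S.Lφ * (2 * ‖a - b‖) := by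
    intro i j
    refine (S.φlip.norm_sub_le _ _).trans ?_
    refine mul_le_mul_of_nonneg_left ?_ hLn
    have : a.1 i - a.1 j - (b.1 i - b.1 j) = (a.1 i - b.1 i) - (a.1 j - b.1 j) := by abel
    rw [this]
    have := norm_sub_le (a.1 i - b.1 i) (a.1 j - b.1 j)
    linarith [h1 i, h1 j]
  unfold Phi Lp
  rw [← Finset.sum_sub_distrib, ← Real.norm_eq_abs]
  calc _ ≤ ∑ i : Fin N, N * (S.Lφ * (2 * ‖a - b‖)) := by
        refine norm_sum_le_of_le _ fun i _ => ?_
        rw [← Finset.sum_sub_distrib]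
        calc _ ≤ ∑ j ∈ Finset.univ.erase i, (S.Lφ * (2 * ‖a - b‖) : ℝ) :=
              norm_sum_le_of_le _ fun j _ => e3 i j
          _ ≤ ∑ j : Fin N, (S.Lφ * (2 * ‖a - b‖) : ℝ) :=
              Finset.sum_le_sum_of_subset_of_nonneg (Finset.subset_univ _) (fun _ _ _ => by positivity)
          _ = _ := by simp
    _ = _ := by simp; ring

lemma riemann {g : ℝ → ℝ} {h Lg T : ℝ} (h0 : 0 < h)
    (hg : ∀ s ∈ Icc 0 T, ∀ t ∈ Icc 0 T, |g t - g s| ≤ Lg * |t - s|) (hLg : 0 ≤ Lg)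
    (k : ℕ) (hk : k * h ≤ T) : h * ∑ j ∈ Finset.range k, g (j * h) ≤
      (∫ s in (0 : ℝ)..(k * h), g s) + k * (Lg * h * h) := by
  have hgc : ContinuousOn g (Icc 0 T) := by
    have : LipschitzOnWith ⟨Lg, hLg⟩ g (Icc 0 T) := by
      refine LipschitzOnWith.of_dist_le_mul fun a ha b hb => ?_
      rw [Real.dist_eq, Real.dist_eq]
      exact hg b hb a ha
    exact this.continuousOn
  induction k with
  | zero => simp
  | succ k ih =>
    have hk' : (k : ℝ) * h + h ≤ T := by push_cast at hk; linarith
    have hk0 : (0 : ℝ) ≤ k * h := by positivity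
    have hkk := ih (by linarith)
    have i1 : IntervalIntegrable g volume 0 (k * h) :=
      (hgc.mono (Icc_subset_Icc_right (by linarith))).intervalIntegrable_of_Icc hk0
    have i2 : IntervalIntegrable g volume (k * h) ((k + 1 : ℕ) * h) := by
      refine (hgc.mono ?_).intervalIntegrable_of_Icc (by push_cast; linarith)
      refine Icc_subset_Icc hk0 ?_
      push_cast; linarith
    rw [← intervalIntegral.integral_add_adjacent_intervals i1 i2, Finset.sum_range_succ, mul_add]
    have h3 : (∫ s in (k * h : ℝ)..((k + 1 : ℕ) * h), (g (k * h) - Lg * h)) ≤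
        ∫ s in (k * h : ℝ)..((k + 1 : ℕ) * h), g s := by
      refine intervalIntegral.integral_mono_on (by push_cast; linarith) (by simp) i2 ?_
      intro s hs
      have hs2 : s ≤ k * h + h := by have := hs.2; push_cast at this; linarith
      have := hg (k * h) ⟨hk0, by linarith⟩ s ⟨hk0.trans hs.1, by linarith⟩
      have h4 := (abs_le.1 this).1
      have h5 : |s - k * h| ≤ h := by
        rw [abs_of_nonneg (by linarith [hs.1])]; linarith
      have h6 : Lg * |s - k * h| ≤ Lg * h := by gcongr
      linarith
    rw [intervalIntegral.integral_const, smul_eq_mul] at h3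
    have h7 : ((k + 1 : ℕ) : ℝ) * h - k * h = h := by push_cast; ring
    rw [h7] at h3
    push_cast at h3 ⊢
    nlinarith

end Sys
end CS

namespace CS
open Topology
namespace Sys
variable {n N : ℕ} (S : Sys n)

lemma rec_null (ρ δ M t0 : ℝ) (hδ : 0 < δ) (hM : 0 ≤ M) (ht0 : 0 < t0)
    (x : ZZ n N → ℝ → ZZ n N) (D : Set (ZZ n N))
    (hD0 : ∀ d ∈ D, x d 0 = d) (hDu : ∀ d ∈ D, ∀ T, S.Uq T (x d))
    (hDρ : ∀ d ∈ D, ∀ t, 0 ≤ t → ‖x d t‖ ≤ ρ) (hDδ : ∀ d ∈ D, δ < S.Phi (x d t0))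
    (hDM : ∀ d ∈ D, ∀ T, 0 ≤ T → ∫ s in (0 : ℝ)..T, S.Phi (x d s) ≤ M) :
    volume D = 0 := by
  rcases D.eq_empty_or_nonempty with rfl | ⟨d0, hd0⟩
  · exact measure_empty
  have hρ : 0 ≤ ρ := (norm_nonneg _).trans (hDρ d0 hd0 0 le_rfl)
  obtain ⟨p, hp1, hp⟩ := S.grid N t0 ht0
  have hLp := S.Lp_nonneg (N := N)
  have hCa := S.Cacc_nonneg (N := N)
  set Lg := S.Lp N * (ρ + S.Cacc N * (1 + ρ)) with hLg
  have hLg0 : 0 ≤ Lg := by positivity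
  set C : ENNReal := ENNReal.ofReal (Real.exp (Kd n N * (M + 1))) *
      (ENNReal.ofReal ((M + 1) / δ) * volume (Metric.ball (0 : ZZ n N) (ρ + 1))) with hC
  have hCt : C ≠ ⊤ := ENNReal.mul_ne_top ENNReal.ofReal_ne_top
    (ENNReal.mul_ne_top ENNReal.ofReal_ne_top measure_ball_lt_top.ne)
  have key : ∀ b : ℕ, ENNReal.ofReal (b * t0) * volume D ≤ C := by
    intro b
    set G : ℕ → Set (ZZ n N) := fun m => {z |
      (∀ l : ℕ, l < b * (m + p) → ‖(S.step (t0 / (m + p : ℕ)))^[l] z‖ < ρ + 1) ∧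
      t0 / (m + p : ℕ) * ∑ j ∈ Finset.range ((m + p) + b * (m + p)),
        S.Phi ((S.step (t0 / (m + p : ℕ)))^[j] z) ≤ M + 1 ∧
      δ ≤ S.Phi ((S.step (t0 / (m + p : ℕ)))^[m + p] z)} with hG
    have hGm : ∀ m, MeasurableSet (G m) := by
      intro m
      have hc : ∀ l, Continuous ((S.step (t0 / (m + p : ℕ)) (N := N))^[l]) :=
        fun l => (S.step_cont _).iterate l
      have hΦ := S.Phi_cont (N := N)
      have m1 : MeasurableSet {z : ZZ n N |
          ∀ l : ℕ, l < b * (m + p) → ‖(S.step (t0 / (m + p : ℕ)))^[l] z‖ < ρ + 1} := by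
        have : {z : ZZ n N | ∀ l : ℕ, l < b * (m + p) → ‖(S.step (t0 / (m + p : ℕ)))^[l] z‖ < ρ + 1} =
          ⋂ l : ℕ, ⋂ (_ : l < b * (m + p)), {z | ‖(S.step (t0 / (m + p : ℕ)))^[l] z‖ < ρ + 1} := by
          ext z; rw [mem_iInter₂]; rfl
        rw [this]
        exact MeasurableSet.iInter fun l => MeasurableSet.iInter fun _ =>
          (isOpen_lt (hc l).norm continuous_const).measurableSet
      have m2 : IsClosed {z : ZZ n N | t0 / (m + p : ℕ) * ∑ j ∈ Finset.range ((m + p) + b * (m + p)),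
        S.Phi ((S.step (t0 / (m + p : ℕ)))^[j] z) ≤ M + 1} :=
        isClosed_le (continuous_const.mul (continuous_finsetSum _ fun j _ => hΦ.comp (hc j)))
          continuous_const
      have m3 : IsClosed {z : ZZ n N | δ ≤ S.Phi ((S.step (t0 / (m + p : ℕ)))^[m + p] z)} :=
        isClosed_le continuous_const (hΦ.comp (hc _))
      exact m1.inter (m2.measurableSet.inter m3.measurableSet)
    have hGv : ∀ m, ENNReal.ofReal (b * t0) * volume (G m) ≤ C := by
      intro m
      obtain ⟨hh0, hh1, hh2⟩ := hp m
      have hmp : (0 : ℝ) < ((m + p : ℕ) : ℝ) := by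
        have : 0 < m + p := by omega
        exact_mod_cast this
      have := S.rec_count hh0 hh2 hδ (by linarith : 0 ≤ M + 1) (m + p) (b * (m + p)) (G m) (hGm m)
        (fun z hz => hz.1) (fun z hz => hz.2.1) (fun z hz => hz.2.2)
      have e : ENNReal.ofReal (b * t0) = ENNReal.ofReal (t0 / (m + p : ℕ)) * ((b * (m + p) : ℕ) : ENNReal) := by
        rw [← ENNReal.ofReal_natCast, ← ENNReal.ofReal_mul hh0.le]
        congr 1
        push_cast at hmp ⊢
        field_simp
      rw [e, mul_assoc]
      refine (mul_le_mul_right this _).trans (le_of_eq ?_)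
      have e2 : ENNReal.ofReal ((M + 1) / δ) = ENNReal.ofReal (t0 / (m + p : ℕ)) *
          ENNReal.ofReal ((M + 1) / (t0 / (m + p : ℕ) * δ)) := by
        rw [← ENNReal.ofReal_mul hh0.le]
        congr 1
        field_simp
      rw [hC, e2]
      ring
    set A : ℕ → Set (ZZ n N) := fun K => {d | ∀ m ≥ K, d ∈ G m} with hA
    have hmono : Monotone A := by
      intro a b hab d hd m hm
      exact hd m (hab.trans hm)
    have hsub : D ⊆ ⋃ K, A K := by
      intro d hd
      have hΦd := hDδ d hd
      set T := t0 + b * t0 with hT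
      have hT0 : 0 < T := by positivity
      set ε := min (1 / 2) (min (1 / (4 * (T * S.Lp N + 1))) ((S.Phi (x d t0) - δ) / (S.Lp N + 1))) with hε
      have hε0 : 0 < ε := by
        refine lt_min (by norm_num) (lt_min (by positivity) ?_)
        exact div_pos (by linarith) (by positivity)
      have hε1 : ε ≤ 1 / 2 := min_le_left _ _
      have hε2 : ε * (T * S.Lp N) ≤ 1 / 4 := by
        have : ε ≤ 1 / (4 * (T * S.Lp N + 1)) := (min_le_right _ _).trans (min_le_left _ _)
        rw [le_div_iff₀ (by positivity)] at this
        nlinarith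
      have hε3 : S.Lp N * ε ≤ S.Phi (x d t0) - δ := by
        have : ε ≤ (S.Phi (x d t0) - δ) / (S.Lp N + 1) := (min_le_right _ _).trans (min_le_right _ _)
        rw [le_div_iff₀ (by positivity)] at this
        nlinarith
      have hlim := (grid_lim t0 p).mul_const (T * Lg)
      rw [zero_mul] at hlim
      have hev := (S.conv_step hp (hDu d hd T) ε hε0).and
        (hlim.eventually (eventually_le_nhds (by norm_num : (0 : ℝ) < 1 / 2)))
      obtain ⟨K, hK⟩ := eventually_atTop.1 hev
      refine mem_iUnion.2 ⟨K, fun m hm => ?_⟩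
      obtain ⟨hcv, hsm⟩ := hK m hm
      rw [hD0 d hd] at hcv
      obtain ⟨hh0, hh1, hh2⟩ := hp m
      have hmp : (0 : ℝ) < ((m + p : ℕ) : ℝ) := by
        have : 0 < m + p := by omega
        exact_mod_cast this
      set q := m + p with hq
      set h := t0 / (q : ℕ) with hh
      have hqh : (q : ℝ) * h = t0 := by rw [hh]; field_simp
      have hqb : ((q + b * q : ℕ) : ℝ) * h = T := by
        push_cast; rw [hT, add_mul, mul_assoc, hqh]
      have hle : ∀ l : ℕ, l ≤ q + b * q → (l : ℝ) * h ≤ T := by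
        intro l hl
        rw [← hqb]
        have : (l : ℝ) ≤ ((q + b * q : ℕ) : ℝ) := by exact_mod_cast hl
        gcongr
      refine ⟨?_, ?_, ?_⟩
      · intro l hl
        have hl : l < b * q := hl
        have h1 := hcv l (hle l (by omega))
        have h2 := hDρ d hd (l * h) (by positivity)
        have h3 : ‖(S.step h)^[l] d‖ ≤ ‖(S.step h)^[l] d - x d (l * h)‖ + ‖x d (l * h)‖ := by
          have := norm_add_le ((S.step h)^[l] d - x d (l * h)) (x d (l * h))
          simpa using this
        linarith
      · have hb : ∀ j ∈ Finset.range (q + b * q), S.Phi ((S.step h)^[j] d) ≤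
            S.Phi (x d (j * h)) + S.Lp N * ε := by
          intro j hj
          have h1 := hcv j (hle j (Finset.mem_range.1 hj).le)
          have h2 := (abs_le.1 (S.Phi_lip ((S.step h)^[j] d) (x d (j * h)))).2
          have h3 : S.Lp N * ‖(S.step h)^[j] d - x d (j * h)‖ ≤ S.Lp N * ε := by gcongr
          linarith
        have hr := riemann (g := fun s => S.Phi (x d s)) (Lg := Lg) (T := T) hh0 (fun s hs t ht => by
          refine (S.Phi_lip _ _).trans ?_
          rw [hLg, mul_assoc]
          refine mul_le_mul_of_nonneg_left ?_ hLp
          exact S.sol_lip2 (hDu d hd T).1 (fun t ht => hDρ d hd t ht.1) s hs t ht) hLg0 (q + b * q)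
          (by rw [hqb])
        rw [hqb] at hr
        have hi := hDM d hd T hT0.le
        have hs := Finset.sum_le_sum hb
        rw [Finset.sum_add_distrib, Finset.sum_const, Finset.card_range, nsmul_eq_mul] at hs
        have hs2 := mul_le_mul_of_nonneg_left hs hh0.le
        have e1 : h * (((q + b * q : ℕ) : ℝ) * (S.Lp N * ε)) = ε * (T * S.Lp N) := by
          rw [← hqb]; ring
        have e2 : ((q + b * q : ℕ) : ℝ) * (Lg * h * h) = h * (T * Lg) := by
          rw [← hqb]; ring
        rw [mul_add h, e1] at hs2
        rw [e2] at hr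
        linarith
      · have h1 := hcv q (hle q (by omega))
        rw [hqh] at h1
        have h2 := (abs_le.1 (S.Phi_lip ((S.step h)^[q] d) (x d t0))).1
        have h3 : S.Lp N * ‖(S.step h)^[q] d - x d t0‖ ≤ S.Lp N * ε := by gcongr
        linarith
    calc ENNReal.ofReal (b * t0) * volume D ≤ ENNReal.ofReal (b * t0) * ⨆ K, volume (A K) := by
          rw [← hmono.measure_iUnion]
          gcongr
      _ = ⨆ K, ENNReal.ofReal (b * t0) * volume (A K) := ENNReal.mul_iSup _ _
      _ ≤ C := by
          refine iSup_le fun K => le_trans ?_ (hGv K)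
          gcongr
          exact fun d hd => hd K le_rfl
  by_contra hne
  -- choose b large
  have hfin : volume D ≠ ⊤ := by
    intro htop
    have := key 1
    rw [htop, ENNReal.mul_top (by simp [ht0])] at this
    exact hCt (top_le_iff.1 this)
  have hpos : 0 < (volume D).toReal := ENNReal.toReal_pos hne hfin
  obtain ⟨b, hb⟩ := exists_nat_gt (C.toReal / (t0 * (volume D).toReal))
  rw [div_lt_iff₀ (by positivity)] at hb
  have := ENNReal.toReal_mono hCt (key b)
  rw [ENNReal.toReal_mul, ENNReal.toReal_ofReal (by positivity)] at this
  nlinarith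

end Sys
end CS

namespace CS
open Topology

lemma mkSys {n : ℕ} {r₀ : ℝ} (φ : Eu n → ℝ)
    (hφC1 : ContDiff ℝ 1 φ) (hφnonneg : ∀ z, 0 ≤ φ z)
    (hφrad : ∀ z w : Eu n, ‖z‖ ≤ ‖w‖ → φ w ≤ φ z)
    (hφsupp : ∀ z, 0 < φ z ↔ ‖z‖ < r₀)
    (U : Eu n → ℝ) (hU : ContDiff ℝ 1 U)
    (hUrad : ∃ u : ℝ → ℝ, ∀ z, U z = u ‖z‖) (R : ℝ) :
    ∃ S : Sys n, S.φ = φ ∧ ∀ x, ‖x‖ < R → gradient S.U x = gradient U x := by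
  have hφ0 : HasCompactSupport φ := by
    refine HasCompactSupport.intro (isCompact_closedBall (0 : Eu n) r₀) fun z hz => ?_
    rw [mem_closedBall_zero_iff, not_le] at hz
    refine le_antisymm ?_ (hφnonneg z)
    by_contra h
    exact absurd ((hφsupp z).1 (not_le.1 h)) (not_lt.2 hz.le)
  obtain ⟨L, hL⟩ := hφC1.lipschitzWith_of_hasCompactSupport hφ0 (by simp)
  set W : Eu n → ℝ := fun x => Real.smoothTransition (R ^ 2 + 1 - ‖x‖ ^ 2) * U x with hW
  have hWC : ContDiff ℝ 1 W := by
    refine ContDiff.mul ?_ hU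
    exact (Real.smoothTransition.contDiff (n := 1)).comp
      (contDiff_const.sub (contDiff_norm_sq ℝ))
  have hW0 : HasCompactSupport W := by
    refine HasCompactSupport.intro (isCompact_closedBall (0 : Eu n) (R ^ 2 + 1)) fun z hz => ?_
    rw [mem_closedBall_zero_iff, not_le] at hz
    simp only [hW]
    rw [Real.smoothTransition.zero_of_nonpos, zero_mul]
    nlinarith [sq_nonneg R, norm_nonneg z]
  obtain ⟨B, hB⟩ := (hWC.continuous_fderiv (by simp)).bounded_above_of_compact_support
    (hW0.fderiv (𝕜 := ℝ))
  refine ⟨⟨φ, W, L, hL, hφnonneg, φ 0, fun z => hφrad 0 z (by simp), hWC, ?_, B, ?_⟩, rfl, ?_⟩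
  · obtain ⟨u, hu⟩ := hUrad
    exact ⟨fun r => Real.smoothTransition (R ^ 2 + 1 - r ^ 2) * u r, fun z => by simp only [hW, hu]⟩
  · intro z
    rw [gradient, LinearIsometryEquiv.norm_map]
    exact hB z
  · intro x hx
    change gradient W x = gradient U x
    have : W =ᶠ[𝓝 x] U := by
      filter_upwards [(isOpen_lt continuous_norm continuous_const).mem_nhds hx] with y hy
      have hy : ‖y‖ < R := hy
      simp only [hW]
      rw [Real.smoothTransition.one_of_one_le, one_mul]
      nlinarith [norm_nonneg y]
    rw [gradient, gradient, this.fderiv_eq]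

lemma diss {n N : ℕ} (φ : Eu n → ℝ) (hnn : ∀ z, 0 ≤ φ z) (hs : ∀ z, φ (-z) = φ z)
    (x v : Fin N → Eu n) :
    ∑ i, inner ℝ (v i) ((N : ℝ)⁻¹ • ∑ j, φ (x i - x j) • (v j - v i)) ≤ 0 := by
  have e1 : ∑ i, inner ℝ (v i) ((N : ℝ)⁻¹ • ∑ j, φ (x i - x j) • (v j - v i)) =
      (N : ℝ)⁻¹ * ∑ i, ∑ j, φ (x i - x j) * inner ℝ (v i) (v j - v i) := by
    simp only [inner_smul_right, inner_sum, Finset.mul_sum]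
  rw [e1]
  refine mul_nonpos_of_nonneg_of_nonpos (by positivity) ?_
  set A := ∑ i, ∑ j, φ (x i - x j) * inner ℝ (v i) (v j - v i) with hA
  have e2 : A = ∑ i, ∑ j, φ (x i - x j) * inner ℝ (v j) (v i - v j) := by
    rw [hA, Finset.sum_comm]
    refine Finset.sum_congr rfl fun i _ => Finset.sum_congr rfl fun j _ => ?_
    rw [← hs, neg_sub]
  have e3 : A + A = ∑ i, ∑ j, -(φ (x i - x j) * ‖v i - v j‖ ^ 2) := by
    nth_rewrite 2 [e2]
    rw [hA, ← Finset.sum_add_distrib]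
    refine Finset.sum_congr rfl fun i _ => ?_
    rw [← Finset.sum_add_distrib]
    refine Finset.sum_congr rfl fun j _ => ?_
    rw [← real_inner_self_eq_norm_sq]
    simp only [inner_sub_left, inner_sub_right, real_inner_comm (v i) (v j)]
    ring
  have e4 : A + A ≤ 0 := by
    rw [e3]
    refine Finset.sum_nonpos fun i _ => Finset.sum_nonpos fun j _ => ?_
    have := mul_nonneg (hnn (x i - x j)) (sq_nonneg ‖v i - v j‖)
    linarith
  linarith

lemma energy {n N : ℕ} (φ : Eu n → ℝ) (hnn : ∀ z, 0 ≤ φ z) (hs : ∀ z, φ (-z) = φ z)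
    (U : Eu n → ℝ) (hU : ContDiff ℝ 1 U)
    (hUconf : ∀ M : ℝ, ∃ R : ℝ, ∀ z, R ≤ ‖z‖ → M ≤ U z)
    (X V : ℝ → Fin N → Eu n)
    (hX : ∀ i, ∀ t ∈ Set.Ici (0 : ℝ),
      HasDerivWithinAt (fun s => X s i) (V t i) (Set.Ici 0) t)
    (hV : ∀ i, ∀ t ∈ Set.Ici (0 : ℝ),
      HasDerivWithinAt (fun s => V s i)
        ((N : ℝ)⁻¹ • ∑ j, φ (X t i - X t j) • (V t j - V t i)
          - gradient U (X t i)) (Set.Ici 0) t) :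
    ∃ ρ : ℝ, ∀ t, 0 ≤ t → ‖((X t, V t) : ZZ n N)‖ ≤ ρ := by
  set E : ℝ → ℝ := fun t => ∑ i, (2⁻¹ * ‖V t i‖ ^ 2 + U (X t i)) with hE
  have hEd : ∀ t ∈ Ici (0 : ℝ), HasDerivWithinAt E
      (∑ i, inner ℝ (V t i) ((N : ℝ)⁻¹ • ∑ j, φ (X t i - X t j) • (V t j - V t i))) (Ici 0) t := by
    intro t ht
    refine HasDerivWithinAt.fun_sum fun i _ => ?_
    have h1 := ((hV i t ht).norm_sq.const_mul (2⁻¹ : ℝ)).add (U_comp hU (hX i t ht))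
    refine h1.congr_deriv ?_
    rw [inner_sub_right, real_inner_comm (V t i) (gradient U (X t i))]
    ring
  have hanti : AntitoneOn E (Ici 0) := by
    refine antitoneOn_of_deriv_nonpos (convex_Ici 0) (fun t ht => (hEd t ht).continuousWithinAt)
      (fun t ht => ?_) (fun t ht => ?_)
    · rw [interior_Ici] at ht
      exact ((hEd t (Ioi_subset_Ici_self ht)).hasDerivAt (Ici_mem_nhds ht)).differentiableAt.differentiableWithinAt
    · rw [interior_Ici] at ht
      rw [((hEd t (Ioi_subset_Ici_self ht)).hasDerivAt (Ici_mem_nhds ht)).deriv]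
      exact diss φ hnn hs _ _
  obtain ⟨c, hc0, hc⟩ : ∃ c : ℝ, 0 ≤ c ∧ ∀ z, -c ≤ U z := by
    obtain ⟨R, hR⟩ := hUconf 0
    obtain ⟨C, hC⟩ := (isCompact_closedBall (0 : Eu n) R).exists_bound_of_continuousOn
      hU.continuous.continuousOn
    refine ⟨max C 0, le_max_right _ _, fun z => ?_⟩
    rcases le_total R ‖z‖ with h | h
    · have := hR z h
      have := le_max_right C 0
      linarith
    · have := hC z (mem_closedBall_zero_iff.2 h)
      have h2 := neg_abs_le (U z)
      rw [Real.norm_eq_abs] at this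
      have := le_max_left C 0
      linarith
  set K := E 0 + N * c with hK
  have hterm : ∀ t, 0 ≤ t → ∀ i, 2⁻¹ * ‖V t i‖ ^ 2 + U (X t i) + c ≤ K := by
    intro t ht i
    have h1 : E t ≤ E 0 := hanti (mem_Ici.2 le_rfl) ht ht
    have h2 : ∑ i, (2⁻¹ * ‖V t i‖ ^ 2 + U (X t i) + c) = E t + N * c := by
      rw [Finset.sum_add_distrib]; simp [hE]
    have h3 := Finset.single_le_sum (s := Finset.univ)
      (f := fun i => 2⁻¹ * ‖V t i‖ ^ 2 + U (X t i) + c)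
      (fun i _ => by
        have := hc (X t i)
        have := sq_nonneg ‖V t i‖
        change (0 : ℝ) ≤ 2⁻¹ * ‖V t i‖ ^ 2 + U (X t i) + c
        linarith) (Finset.mem_univ i)
    linarith
  obtain ⟨R, hR⟩ := hUconf (K + 1)
  have hρ0 : 0 ≤ max (max R (1 + 2 * K)) 0 := le_max_right _ _
  refine ⟨max (max R (1 + 2 * K)) 0, fun t ht => ?_⟩
  rw [Prod.norm_def]
  refine max_le ((pi_norm_le_iff_of_nonneg hρ0).2 fun i => ?_)
    ((pi_norm_le_iff_of_nonneg hρ0).2 fun i => ?_)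
  · have h1 := hterm t ht i
    have h2 := sq_nonneg ‖V t i‖
    by_contra h
    push Not at h
    have h3 := hR (X t i) (((le_max_left _ _).trans (le_max_left _ _)).trans h.le)
    linarith
  · have h1 := hterm t ht i
    have h2 := hc (X t i)
    refine le_trans ?_ ((le_max_right R _).trans (le_max_left _ _))
    nlinarith [sq_nonneg (‖V t i‖ - 1)]
end CS

namespace CS
open Topology

lemma sys_sol {n N : ℕ} {φ : Eu n → ℝ} {U : Eu n → ℝ} {X V : ℝ → Fin N → Eu n}
    (hX : ∀ i, ∀ t ∈ Set.Ici (0 : ℝ),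
      HasDerivWithinAt (fun s => X s i) (V t i) (Set.Ici 0) t)
    (hV : ∀ i, ∀ t ∈ Set.Ici (0 : ℝ),
      HasDerivWithinAt (fun s => V s i)
        ((N : ℝ)⁻¹ • ∑ j, φ (X t i - X t j) • (V t j - V t i)
          - gradient U (X t i)) (Set.Ici 0) t)
    {ρ : ℝ} (hρ : ∀ t, 0 ≤ t → ‖((X t, V t) : ZZ n N)‖ ≤ ρ)
    (S : Sys n) (hS : S.φ = φ) (hSU : ∀ x, ‖x‖ < ρ + 1 → gradient S.U x = gradient U x) (T : ℝ) :
    IsSol S.fld T (fun t => ((X t, V t) : ZZ n N)) := by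
  intro t ht
  have ht0 : t ∈ Ici (0 : ℝ) := ht.1
  refine (HasDerivWithinAt.prodMk (f₁ := X) (f₂ := V) (hasDerivWithinAt_pi.2 fun i => hX i t ht0)
    (hasDerivWithinAt_pi.2 fun i => ?_)).mono Icc_subset_Ici_self
  have h := hV i t ht0
  refine h.congr_deriv ?_
  change _ = (N : ℝ)⁻¹ • ∑ j, S.φ (X t i - X t j) • (V t j - V t i) - gradient S.U (X t i)
  rw [hS, hSU]
  have := (norm_le_pi_norm (X t) i).trans ((norm_fst_le ((X t, V t) : ZZ n N)).trans (hρ t ht.1))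
  linarith

lemma int_le {f : ℝ → ℝ} (hf : ContinuousOn f (Ici 0)) (hf0 : ∀ t, 0 ≤ f t) {M : ℝ}
    (hM : ∫⁻ s in Ioi (0 : ℝ), ENNReal.ofReal (f s) ≠ ⊤)
    (hM' : (∫⁻ s in Ioi (0 : ℝ), ENNReal.ofReal (f s)).toReal ≤ M) {T : ℝ} (hT : 0 ≤ T) :
    ∫ s in (0 : ℝ)..T, f s ≤ M := by
  rw [intervalIntegral.integral_of_le hT, integral_eq_lintegral_of_nonneg_ae
    (Eventually.of_forall hf0)
    ((hf.mono (fun s hs => le_of_lt hs.1)).aestronglyMeasurable measurableSet_Ioc)]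
  exact (ENNReal.toReal_mono hM (lintegral_mono_set fun s hs => hs.1)).trans hM'

lemma rat_time {f : ℝ → ℝ} (hf : ContinuousOn f (Ici 0)) {t : ℝ} (ht : 0 ≤ t) (hft : 0 < f t) :
    ∃ q : ℚ, (0 : ℝ) < q ∧ 0 < f q := by
  have h1 : ∀ᶠ s in 𝓝[>] t, 0 < f s :=
    ((hf t ht).mono (fun s hs => ht.trans (le_of_lt hs))).eventually (lt_mem_nhds hft)
  obtain ⟨u, hu, hsub⟩ := mem_nhdsGT_iff_exists_Ioo_subset.1 h1
  obtain ⟨q, hq1, hq2⟩ := exists_rat_btwn (show t < u from hu)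
  exact ⟨q, ht.trans_lt hq1, hsub ⟨hq1, hq2⟩⟩

lemma Phi_pos {n N : ℕ} {r₀ : ℝ} {φ : Eu n → ℝ} (hnn : ∀ z, 0 ≤ φ z)
    (hφsupp : ∀ z, 0 < φ z ↔ ‖z‖ < r₀) {x : Fin N → Eu n} {i j : Fin N} (hij : i ≠ j)
    (h : ‖x i - x j‖ < r₀) :
    φ (x i - x j) ≤ ∑ i, ∑ j ∈ Finset.univ.erase i, φ (x i - x j) := by
  refine le_trans ?_ (Finset.single_le_sum (f := fun i => ∑ j ∈ Finset.univ.erase i, φ (x i - x j))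
    (fun i _ => Finset.sum_nonneg fun j _ => hnn _) (Finset.mem_univ i))
  exact Finset.single_le_sum (f := fun j => φ (x i - x j)) (fun j _ => hnn _)
    (Finset.mem_erase.2 ⟨hij.symm, Finset.mem_univ j⟩)

theorem main (n N : ℕ)
    (r₀ : ℝ) (hr₀ : 0 < r₀)
    (φ : Eu n → ℝ)
    (hφC1 : ContDiff ℝ 1 φ) (hφnonneg : ∀ z, 0 ≤ φ z)
    (hφrad : ∀ z w : Eu n, ‖z‖ ≤ ‖w‖ → φ w ≤ φ z)
    (hφsupp : ∀ z, 0 < φ z ↔ ‖z‖ < r₀)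
    (U : Eu n → ℝ) (hU : ContDiff ℝ 1 U)
    (hUrad : ∃ u : ℝ → ℝ, ∀ z, U z = u ‖z‖)
    (hUconf : ∀ M : ℝ, ∃ R : ℝ, ∀ z, R ≤ ‖z‖ → M ≤ U z)
    (X V : ZZ n N → ℝ → Fin N → Eu n)
    (hinit : ∀ d, X d 0 = d.1 ∧ V d 0 = d.2)
    (hX : ∀ d i, ∀ t ∈ Set.Ici (0 : ℝ),
      HasDerivWithinAt (fun s => X d s i) (V d t i) (Set.Ici 0) t)
    (hV : ∀ d i, ∀ t ∈ Set.Ici (0 : ℝ),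
      HasDerivWithinAt (fun s => V d s i)
        ((N : ℝ)⁻¹ • ∑ j, φ (X d t i - X d t j) • (V d t j - V d t i)
          - gradient U (X d t i)) (Set.Ici 0) t) :
    ∀ᵐ d ∂(volume : Measure (ZZ n N)),
      (¬ (∀ t ∈ Set.Ici (0 : ℝ), ∀ i j, i ≠ j → r₀ ≤ ‖X d t i - X d t j‖) →
        ∫⁻ s in Set.Ioi (0 : ℝ),
          ENNReal.ofReal (∑ i, ∑ j ∈ Finset.univ.erase i, φ (X d s i - X d s j)) = ⊤) := by
  rcases Nat.eq_zero_or_pos n with rfl | hn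
  · refine Eventually.of_forall fun d hd => ?_
    push Not at hd
    obtain ⟨t, ht, i, j, hij, h⟩ := hd
    have hz : ∀ z : Eu 0, z = 0 := fun z => Subsingleton.elim _ _
    have hpos : 0 < φ 0 := (hφsupp 0).2 (by simpa using hr₀)
    rw [eq_top_iff]
    have hle : ∀ s, ENNReal.ofReal (φ 0) ≤
        ENNReal.ofReal (∑ i, ∑ j ∈ Finset.univ.erase i, φ (X d s i - X d s j)) := by
      intro s
      refine ENNReal.ofReal_le_ofReal ?_
      have := Phi_pos (x := X d s) hφnonneg hφsupp hij (by rw [hz (X d s i - X d s j)]; simpa using hr₀)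
      rwa [hz (X d s i - X d s j)] at this
    refine le_trans ?_ (lintegral_mono hle)
    rw [setLIntegral_const, Real.volume_Ioi, ENNReal.mul_top]
    exact (ENNReal.ofReal_pos.2 hpos).ne'
  set x : ZZ n N → ℝ → ZZ n N := fun d t => (X d t, V d t) with hx
  have hx0 : ∀ d, x d 0 = d := fun d => Prod.ext (hinit d).1 (hinit d).2
  have hbd : ∀ d, ∃ ρ : ℕ, ∀ t, 0 ≤ t → ‖x d t‖ ≤ ρ := by
    intro d
    obtain ⟨ρ, hρ⟩ := energy φ hφnonneg
      (fun z => le_antisymm (hφrad _ _ (by simp)) (hφrad _ _ (by simp))) U hU hUconf (X d) (V d)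
      (hX d) (hV d)
    obtain ⟨k, hk⟩ := exists_nat_ge ρ
    exact ⟨k, fun t ht => (hρ t ht).trans hk⟩
  choose S hS hSU using fun ρ : ℕ => mkSys φ hφC1 hφnonneg hφrad hφsupp U hU hUrad ((ρ : ℝ) + 1)
  have hsol : ∀ (ρ : ℕ) d, (∀ t, 0 ≤ t → ‖x d t‖ ≤ ρ) → ∀ T, IsSol (S ρ).fld T (x d) :=
    fun ρ d h T => sys_sol (hX d) (hV d) h (S ρ) (hS ρ) (hSU ρ) T
  have hPhi : ∀ (ρ : ℕ) d s, (S ρ).Phi (x d s) =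
      ∑ i, ∑ j ∈ Finset.univ.erase i, φ (X d s i - X d s j) := by
    intro ρ d s
    unfold Sys.Phi
    rw [hS]
  have hxc : ∀ d, ContinuousOn (x d) (Ici 0) := fun d t ht =>
    (HasDerivWithinAt.prodMk (f₁ := X d) (f₂ := V d) (hasDerivWithinAt_pi.2 fun i => hX d i t ht)
      (hasDerivWithinAt_pi.2 fun i => hV d i t ht)).continuousWithinAt
  let P : ℕ → ℕ → Set (ZZ n N) := fun ρ T => {d | (∀ t, 0 ≤ t → ‖x d t‖ ≤ ρ) ∧
    ∃ t ∈ Icc (0 : ℝ) T, ∃ i, ¬ (S ρ).Reg (x d t) i}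
  let D : ℕ → ℕ → ℕ → ℚ → Set (ZZ n N) := fun ρ k M q => {d | (0 : ℝ) < q ∧
    (∀ t, 0 ≤ t → ‖x d t‖ ≤ ρ) ∧ (∀ t, 0 ≤ t → ∀ i, (S ρ).Reg (x d t) i) ∧
    1 / ((k : ℝ) + 1) < (S ρ).Phi (x d q) ∧
    ∀ T, 0 ≤ T → ∫ s in (0 : ℝ)..T, (S ρ).Phi (x d s) ≤ M}
  have hP0 : ∀ ρ T, volume (P ρ T) = 0 := by
    intro ρ T
    refine (S ρ).avoid_null hn T ρ x (P ρ T) (fun d hd => ?_) (fun d hd => hd.2)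
    exact ⟨hx0 d, hsol ρ d hd.1 T, fun t ht => hd.1 t ht.1⟩
  have hD0 : ∀ ρ k M q, volume (D ρ k M q) = 0 := by
    intro ρ k M q
    by_cases hq : (0 : ℝ) < q
    · refine (S ρ).rec_null ρ (1 / ((k : ℝ) + 1)) M q (by positivity) (by positivity) hq x _
        (fun d _ => hx0 d) (fun d hd T => ?_) (fun d hd => hd.2.1) (fun d hd => hd.2.2.2.1)
        (fun d hd => hd.2.2.2.2)
      refine ⟨hsol ρ d hd.2.1 T, fun y hy hy0 => ?_⟩
      exact (S ρ).uniq_of_avoid hy (hsol ρ d hd.2.1 T) hy0 (fun t ht => hd.2.2.1 t ht.1)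
    · have : D ρ k M q = ∅ := eq_empty_of_forall_notMem fun d hd => hq hd.1
      rw [this, measure_empty]
  have hnull : volume ((⋃ ρ, ⋃ T, P ρ T) ∪ ⋃ ρ, ⋃ k, ⋃ M, ⋃ q, D ρ k M q) = 0 := by
    refine measure_union_null ?_ ?_
    · exact measure_iUnion_null fun ρ => measure_iUnion_null fun T => hP0 ρ T
    · exact measure_iUnion_null fun ρ => measure_iUnion_null fun k => measure_iUnion_null fun M =>
        measure_iUnion_null fun q => hD0 ρ k M q
  rw [ae_iff]
  refine measure_mono_null (fun d hd => ?_) hnull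
  have hd' : ¬ (_ → _) := hd
  rw [Classical.not_imp] at hd'
  obtain ⟨hd1, hfin⟩ := hd'
  push Not at hd1
  obtain ⟨t, ht, i, j, hij, hlt⟩ := hd1
  obtain ⟨ρ, hρ⟩ := hbd d
  by_cases hreg : ∀ t, 0 ≤ t → ∀ i, (S ρ).Reg (x d t) i
  · right
    have hfc : ContinuousOn (fun s => (S ρ).Phi (x d s)) (Ici 0) :=
      (S ρ).Phi_cont.comp_continuousOn (hxc d)
    have hpos : 0 < (S ρ).Phi (x d t) := by
      rw [hPhi]
      exact lt_of_lt_of_le ((hφsupp _).2 hlt) (Phi_pos hφnonneg hφsupp hij hlt)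
    obtain ⟨q, hq0, hq⟩ := rat_time hfc ht hpos
    obtain ⟨k, hk⟩ := exists_nat_one_div_lt hq
    simp only [← hPhi ρ] at hfin
    obtain ⟨M, hM⟩ := exists_nat_ge
      (∫⁻ s in Ioi (0 : ℝ), ENNReal.ofReal ((S ρ).Phi (x d s))).toReal
    refine mem_iUnion.2 ⟨ρ, mem_iUnion.2 ⟨k, mem_iUnion.2 ⟨M, mem_iUnion.2 ⟨q, ?_⟩⟩⟩⟩
    exact ⟨hq0, hρ, hreg, hk, fun T hT => int_le hfc (fun s => (S ρ).Phi_nonneg _) hfin hM hT⟩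
  · left
    push Not at hreg
    obtain ⟨s, hs, l, hl⟩ := hreg
    obtain ⟨T, hT⟩ := exists_nat_ge s
    exact mem_iUnion.2 ⟨ρ, mem_iUnion.2 ⟨T, hρ, s, ⟨hs, hT⟩, l, hl⟩⟩
end CS


/-- **Proposition 4.1.** For the Cucker–Smale system with a confining
potential, for almost every initial datum outside the decoupled-oscillator set `ℋ`
(the data whose solutions keep all pairwise distances `≥ r₀` for all `t ≥ 0`) the
communication integral diverges: `∫_0^∞ Σ_{i≠j} φ(x_i − x_j) ds = ∞`. In particular
this holds for a.e. datum having `|x_i⁰ − x_j⁰| < r₀` for at least one pair `i ≠ j`. -/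
theorem stmt13 (n N : ℕ) (hN : 1 ≤ N)
    (r₀ : ℝ) (hr₀ : 0 < r₀)
    (φ : EuclideanSpace ℝ (Fin n) → ℝ)
    (hφC1 : ContDiff ℝ 1 φ) (hφnonneg : ∀ z, 0 ≤ φ z)
    (hφrad : ∀ z w : EuclideanSpace ℝ (Fin n), ‖z‖ ≤ ‖w‖ → φ w ≤ φ z)
    (hφsupp : ∀ z, 0 < φ z ↔ ‖z‖ < r₀)
    (U : EuclideanSpace ℝ (Fin n) → ℝ) (hU : ContDiff ℝ 1 U)
    (hUrad : ∃ u : ℝ → ℝ, ∀ z, U z = u ‖z‖)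
    (hUconf : ∀ M : ℝ, ∃ R : ℝ, ∀ z, R ≤ ‖z‖ → M ≤ U z)
    (X V : (Fin N → EuclideanSpace ℝ (Fin n)) × (Fin N → EuclideanSpace ℝ (Fin n)) →
      ℝ → Fin N → EuclideanSpace ℝ (Fin n))
    (hinit : ∀ d, X d 0 = d.1 ∧ V d 0 = d.2)
    (hX : ∀ d i, ∀ t ∈ Set.Ici (0 : ℝ),
      HasDerivWithinAt (fun s => X d s i) (V d t i) (Set.Ici 0) t)
    (hV : ∀ d i, ∀ t ∈ Set.Ici (0 : ℝ),
      HasDerivWithinAt (fun s => V d s i)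
        ((N : ℝ)⁻¹ • ∑ j, φ (X d t i - X d t j) • (V d t j - V d t i)
          - gradient U (X d t i)) (Set.Ici 0) t) :
    ∀ᵐ d ∂(volume : Measure ((Fin N → EuclideanSpace ℝ (Fin n)) ×
        (Fin N → EuclideanSpace ℝ (Fin n)))),
      (d ∉ {d' | ∀ t ∈ Set.Ici (0 : ℝ), ∀ i j, i ≠ j → r₀ ≤ ‖X d' t i - X d' t j‖} →
        ∫⁻ s in Set.Ioi (0 : ℝ),
          ENNReal.ofReal (∑ i, ∑ j ∈ Finset.univ.erase i, φ (X d s i - X d s j)) = ⊤) ∧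
      ((∃ i j, i ≠ j ∧ ‖d.1 i - d.1 j‖ < r₀) →
        ∫⁻ s in Set.Ioi (0 : ℝ),
          ENNReal.ofReal (∑ i, ∑ j ∈ Finset.univ.erase i, φ (X d s i - X d s j)) = ⊤) := by
  have key := CS.main n N r₀ hr₀ φ hφC1 hφnonneg hφrad hφsupp U hU hUrad hUconf X V hinit hX hV
  filter_upwards [key] with d hd
  refine ⟨fun h => hd h, fun h => hd fun hall => ?_⟩
  obtain ⟨i, j, hij, hlt⟩ := h
  have h0 := hall 0 (Set.mem_Ici.2 le_rfl) i j hij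
  rw [(hinit d).1] at h0
  exact absurd hlt (not_lt.2 h0)
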